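/- Let n ≥ 3, m ≥ 2 and ζ > n. Let f : ℝⁿ → ℝ be continuous, C^m outside some compact set, with finite limit f(∞) and limsup_{|x|→∞} |x|^{ζ+k} |D^k(f(x) − f(∞))| < ∞ for every k = 0,1,…,m, and let u ∈ C²(ℝⁿ) satisfy det D²u = e^{n f} on ℝⁿ with D²u everywhere positive definite; let A (symmetric positive definite, det A = e^{n f(∞)}), b ∈ ℝⁿ, c ∈ ℝ be such that Q(x) = ½xᵀAx + b·x + c satisfies u − Q = O_{m+1}(|x|^{2−n}) (as provided by the first-order asymptotic theorem). Set N = n−1 if ζ ≥ 2n and N = n − 1 − ⌊2n−ζ⌋ if n < ζ < 2n. Then there exist c₀ ∈ ℝ and, for each 1 ≤ k ≤ N, a polynomial P_k on ℝⁿ homogeneous of degree k with Σᵢ ∂²P_k/∂xᵢ² ≡ 0, such that u(x) − Q(x) − c₀ (n xᵀAx)^{(2−n)/2} − Σ_{k=1}^{N} P_k(θ(x)) (n xᵀAx)^{(2−n−k)/2} = O_m(|x|^{2−min{2n,ζ}}) as |x| → ∞ if min{2n,ζ} − n is not an integer, and = O_m(|x|^{2−min{2n,ζ}} ln|x|) if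 min{2n,ζ} − n is an integer, where θ(x) = (nA)^{1/2}x / (n xᵀAx)^{1/2} and (nA)^{1/2} is the positive definite symmetric square root of nA. -/

import Mathlib

open Filter

/-- The Hessian matrix `(∂ᵢ∂ⱼ u(x))` of a function on Euclidean space. -/
noncomputable def hess {n : ℕ} (u : EuclideanSpace ℝ (Fin n) → ℝ)
    (x : EuclideanSpace ℝ (Fin n)) : Matrix (Fin n) (Fin n) ℝ :=
  Matrix.of fun i j =>
    iteratedFDeriv ℝ 2 u x ![EuclideanSpace.single i 1, EuclideanSpace.single j 1]

open Topology

namespace MAE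

abbrev EE (n : ℕ) := EuclideanSpace ℝ (Fin n)

noncomputable def ei {n : ℕ} (i : Fin n) : EE n := EuclideanSpace.single i 1

noncomputable def pd {n : ℕ} (i : Fin n) (f : EE n → ℝ) (x : EE n) : ℝ := fderiv ℝ f x (ei i)

noncomputable def hs {n : ℕ} (w : EE n → ℝ) (x p q : EE n) : ℝ := fderiv ℝ (fderiv ℝ w) x p q

noncomputable def lap {n : ℕ} (f : EE n → ℝ) (x : EE n) : ℝ := ∑ i, pd i (pd i f) x

variable {n : ℕ}

lemma ei_apply (i j : Fin n) : (ei i : EE n) j = if j = i then 1 else 0 := by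
  simp [ei]

lemma norm_ei (i : Fin n) : ‖(ei i : EE n)‖ = 1 := by simp [ei]

lemma sum_ei (p : EE n) : p = ∑ i, p i • ei i := by
  ext j
  simp [ei, Finset.sum_apply, Pi.single_apply]

lemma pd_congr {f g : EE n → ℝ} {x : EE n} (i : Fin n) (h : f =ᶠ[𝓝 x] g) : pd i f x = pd i g x := by
  simp [pd, h.fderiv_eq]

lemma pd_congr_ev {f g : EE n → ℝ} {x : EE n} (i : Fin n) (h : f =ᶠ[𝓝 x] g) :
    pd i f =ᶠ[𝓝 x] pd i g := by
  filter_upwards [h.eventuallyEq_nhds] with y hy using pd_congr i hy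

lemma pd_congr_on {f g : EE n → ℝ} {U : Set (EE n)} (hU : IsOpen U) (i : Fin n)
    (h : ∀ x ∈ U, f x = g x) : ∀ x ∈ U, pd i f x = pd i g x := fun x hx =>
  pd_congr i (by filter_upwards [hU.mem_nhds hx] with y hy using h y hy)

lemma pd_add {f g : EE n → ℝ} {x : EE n} (i : Fin n) (hf : DifferentiableAt ℝ f x)
    (hg : DifferentiableAt ℝ g x) : pd i (fun y => f y + g y) x = pd i f x + pd i g x := by
  simp [pd, fderiv_fun_add hf hg]

lemma pd_sub {f g : EE n → ℝ} {x : EE n} (i : Fin n) (hf : DifferentiableAt ℝ f x)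
    (hg : DifferentiableAt ℝ g x) : pd i (fun y => f y - g y) x = pd i f x - pd i g x := by
  simp [pd, fderiv_fun_sub hf hg]

lemma pd_mul {f g : EE n → ℝ} {x : EE n} (i : Fin n) (hf : DifferentiableAt ℝ f x)
    (hg : DifferentiableAt ℝ g x) :
    pd i (fun y => f y * g y) x = f x * pd i g x + g x * pd i f x := by
  simp [pd, fderiv_fun_mul hf hg]

lemma pd_const (i : Fin n) (c : ℝ) (x : EE n) : pd i (fun _ => c) x = 0 := by simp [pd]

lemma pd_const_mul {f : EE n → ℝ} {x : EE n} (i : Fin n) (c : ℝ) (hf : DifferentiableAt ℝ f x) :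
    pd i (fun y => c * f y) x = c * pd i f x := by
  simp [pd, fderiv_const_mul hf c]

lemma pd_neg {f : EE n → ℝ} {x : EE n} (i : Fin n) :
    pd i (fun y => - f y) x = - pd i f x := by
  simp [pd, fderiv_fun_neg]

lemma pd_sum {ι : Type*} (s : Finset ι) {f : ι → EE n → ℝ} {x : EE n} (i : Fin n)
    (hf : ∀ a ∈ s, DifferentiableAt ℝ (f a) x) :
    pd i (fun y => ∑ a ∈ s, f a y) x = ∑ a ∈ s, pd i (f a) x := by
  simp [pd, fderiv_fun_sum hf]

lemma pd_comp_add (i : Fin n) (f : EE n → ℝ) (a x : EE n) :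
    pd i (fun y => f (y + a)) x = pd i f (x + a) := by
  simp [pd, fderiv_comp_add_right]

lemma fderiv_eq_sum (f : EE n → ℝ) (x h : EE n) : fderiv ℝ f x h = ∑ i, h i * pd i f x := by
  conv_lhs => rw [sum_ei h]
  simp [pd]

lemma contDiffAt_pd {f : EE n → ℝ} {x : EE n} {k : ℕ} (i : Fin n) (h : ContDiffAt ℝ (k + 1 : ℕ) f x) :
    ContDiffAt ℝ k (pd i f) x := by
  have := h.fderiv_right (m := k) (by norm_cast)
  exact this.clm_apply contDiffAt_const

lemma differentiableAt_pd {f : EE n → ℝ} {x : EE n} (i : Fin n) (h : ContDiffAt ℝ 2 f x) :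
    DifferentiableAt ℝ (pd i f) x :=
  (contDiffAt_pd (k := 1) i (by exact_mod_cast h)).differentiableAt (by simp)

lemma pd_pd {w : EE n → ℝ} {x : EE n} (i j : Fin n) (h : ContDiffAt ℝ 2 w x) :
    pd i (pd j w) x = hs w x (ei i) (ei j) := by
  have h1 : DifferentiableAt ℝ (fderiv ℝ w) x :=
    (h.fderiv_right (m := 1) (by norm_num)).differentiableAt (by simp)
  unfold hs
  change fderiv ℝ (fun y => fderiv ℝ w y (ei j)) x (ei i) = _
  rw [fderiv_clm_apply h1 (by fun_prop)]
  simp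

lemma hs_symm {w : EE n → ℝ} {x : EE n} (h : ContDiffAt ℝ 2 w x) (p q : EE n) :
    hs w x p q = hs w x q p := by
  have := h.isSymmSndFDerivAt (by simp)
  exact this p q

lemma pd_comm {w : EE n → ℝ} {x : EE n} (i j : Fin n) (h : ContDiffAt ℝ 2 w x) :
    pd i (pd j w) x = pd j (pd i w) x := by
  rw [pd_pd i j h, pd_pd j i h, hs_symm h]

lemma hs_eq_sum (w : EE n → ℝ) (x p q : EE n) :
    hs w x p q = ∑ i, ∑ j, p i * q j * hs w x (ei i) (ei j) := by
  unfold hs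
  conv_lhs => rw [sum_ei p, sum_ei q]
  simp [Finset.mul_sum, mul_assoc]
  rw [Finset.sum_comm]
  exact Finset.sum_congr rfl fun _ _ => Finset.sum_congr rfl fun _ _ => by ring

lemma hs_add_left (w : EE n → ℝ) (x p p' q : EE n) :
    hs w x (p + p') q = hs w x p q + hs w x p' q := by simp [hs]
lemma hs_add_right (w : EE n → ℝ) (x p q q' : EE n) :
    hs w x p (q + q') = hs w x p q + hs w x p q' := by simp [hs]
lemma hs_smul_left (w : EE n → ℝ) (x p q : EE n) (c : ℝ) :
    hs w x (c • p) q = c * hs w x p q := by simp [hs]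
lemma hs_smul_right (w : EE n → ℝ) (x p q : EE n) (c : ℝ) :
    hs w x p (c • q) = c * hs w x p q := by simp [hs]

lemma lap_eq {w : EE n → ℝ} {x : EE n} (h : ContDiffAt ℝ 2 w x) :
    lap w x = ∑ i, hs w x (ei i) (ei i) := by
  simp [lap, fun i => pd_pd i i h]

lemma hess_eq {w : EE n → ℝ} {x : EE n} (h : ContDiffAt ℝ 2 w x) (i j : Fin n) :
    hess w x i j = pd i (pd j w) x := by
  rw [pd_pd i j h]
  simp [hess, iteratedFDeriv_two_apply, hs, ei]

/-- one dimensional second derivative data -/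
def D2 (φ : ℝ → ℝ) (c : ℝ) : Prop :=
  ∃ φ1 : ℝ → ℝ, (∀ᶠ t in 𝓝 (0:ℝ), HasDerivAt φ (φ1 t) t) ∧ HasDerivAt φ1 c 0

lemma D2.add {φ ψ : ℝ → ℝ} {c d : ℝ} (h : D2 φ c) (k : D2 ψ d) : D2 (fun t => φ t + ψ t) (c + d) := by
  obtain ⟨a, ha, ha'⟩ := h
  obtain ⟨b, hb, hb'⟩ := k
  exact ⟨fun t => a t + b t, by filter_upwards [ha, hb] with t h1 h2 using h1.add h2, ha'.add hb'⟩

lemma D2.const_mul {φ : ℝ → ℝ} {c : ℝ} (h : D2 φ c) (k : ℝ) : D2 (fun t => k * φ t) (k * c) := by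
  obtain ⟨a, ha, ha'⟩ := h
  exact ⟨fun t => k * a t, by filter_upwards [ha] with t h1 using h1.const_mul k, ha'.const_mul k⟩

lemma D2.sub {φ ψ : ℝ → ℝ} {c d : ℝ} (h : D2 φ c) (k : D2 ψ d) : D2 (fun t => φ t - ψ t) (c - d) := by
  have := h.add (k.const_mul (-1))
  convert this using 2 <;> ring

lemma D2_line {w : EE n → ℝ} {x : EE n} (h : ContDiffAt ℝ 2 w x) (p : EE n) :
    D2 (fun t => w (x + t • p)) (hs w x p p) := by
  have hl : ∀ t : ℝ, HasDerivAt (fun t : ℝ => x + t • p) p t := fun t => by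
    simpa using ((hasDerivAt_id t).smul_const p).const_add x
  have h0 : Tendsto (fun t : ℝ => x + t • p) (𝓝 0) (𝓝 x) := by
    have := (hl 0).continuousAt
    simpa [ContinuousAt] using this
  refine ⟨fun t => fderiv ℝ w (x + t • p) p, ?_, ?_⟩
  · have h1 : ∀ᶠ y in 𝓝 x, ContDiffAt ℝ 2 w y := h.eventually (by simp)
    filter_upwards [h0.eventually h1] with t ht
    exact (ht.differentiableAt (by simp)).hasFDerivAt.comp_hasDerivAt t (hl t)
  · have h1 : DifferentiableAt ℝ (fderiv ℝ w) x :=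
      (h.fderiv_right (m := 1) (by norm_num)).differentiableAt (by simp)
    have h2 : HasFDerivAt (fderiv ℝ w) (fderiv ℝ (fderiv ℝ w) x) (x + (0:ℝ) • p) := by
      simpa using h1.hasFDerivAt
    have h3 := h2.comp_hasDerivAt (0:ℝ) (hl 0)
    have := h3.clm_apply (hasDerivAt_const (0:ℝ) p)
    simpa [hs] using this

lemma D2.nonpos_of_max {φ : ℝ → ℝ} {c : ℝ} (h : D2 φ c) (hm : IsLocalMax φ 0) : c ≤ 0 := by
  obtain ⟨φ1, h1, h2⟩ := h
  by_contra! hc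
  have hd : deriv φ =ᶠ[𝓝 0] φ1 := by filter_upwards [h1] with t ht using ht.deriv
  have hd2 : deriv (deriv φ) 0 = c := by rw [hd.deriv_eq, h2.deriv]
  have hmin : IsLocalMin φ 0 := isLocalMin_of_deriv_deriv_pos (by rw [hd2]; exact hc)
    hm.deriv_eq_zero h1.self_of_nhds.continuousAt
  have hconst : φ =ᶠ[𝓝 0] fun _ => φ 0 := by
    filter_upwards [hm, hmin] with t a b using le_antisymm a b
  have : deriv (deriv φ) 0 = 0 := by
    rw [hconst.deriv.deriv_eq]; simp
  linarith

end MAE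

open Filter Topology
namespace MAE
variable {n : ℕ}

lemma D2_quad (a b c : ℝ) : D2 (fun t => a + b * t + c * t ^ 2) (2 * c) := by
  refine ⟨fun t => b + c * (2 * t), Eventually.of_forall fun t => ?_, ?_⟩
  · have := ((hasDerivAt_id t).const_mul b).const_add a |>.add (((hasDerivAt_id t).pow 2).const_mul c)
    refine this.congr_deriv ?_
    simp
  · have := (((hasDerivAt_id (0:ℝ)).const_mul 2).const_mul c).const_add b
    refine this.congr_deriv ?_
    ring

lemma nonpos_of_right {φ : ℝ → ℝ} {c d : ℝ} (hd : 0 < d) (h : HasDerivAt φ c 0)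
    (hle : ∀ t, 0 < t → t < d → φ t ≤ φ 0) : c ≤ 0 := by
  have h1 := (hasDerivAt_iff_tendsto_slope.1 h).mono_left
    (nhdsWithin_mono 0 (fun x (hx : x ∈ Set.Ioi (0:ℝ)) => ne_of_gt hx))
  refine le_of_tendsto h1 ?_
  filter_upwards [Ioo_mem_nhdsGT hd] with t ht
  rw [slope_def_field]
  exact div_nonpos_of_nonpos_of_nonneg (by linarith [hle t ht.1 ht.2]) (by linarith [ht.1])

lemma norm_le_sum (x : EE n) : ‖x‖ ≤ ∑ j, |x j| := by
  conv_lhs => rw [sum_ei x]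
  refine (norm_sum_le _ _).trans (le_of_eq ?_)
  simp [norm_smul, norm_ei]

lemma abs_coord_le (x : EE n) (j : Fin n) : |x j| ≤ ‖x‖ := by
  simpa using PiLp.norm_apply_le x j

lemma grad_aux (w : EE n → ℝ) (x0 : EE n) {d M G G' : ℝ} (hd : 0 < d) (hGG : G < G') (i : Fin n)
    (hC : ∀ x : EE n, (∀ j, |x j - x0 j| ≤ d) → ContDiffAt ℝ 2 w x)
    (hM : ∀ x : EE n, (∀ j, |x j - x0 j| ≤ d) → |w x| ≤ M)
    (hG : ∀ x : EE n, (∀ j, |x j - x0 j| ≤ d) → |lap w x| ≤ G) :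
    pd i w x0 ≤ n * M / d + d * G' / 2 := by
  have hM0 : 0 ≤ M := (abs_nonneg _).trans (hM x0 (by simp [hd.le]))
  have hG0 : 0 ≤ G := (abs_nonneg _).trans (hG x0 (by simp [hd.le]))
  set R : EE n → EE n := fun x => x - (2 * (x i - x0 i)) • ei i with hR
  have Rj : ∀ x j, R x j - x0 j = if j = i then -(x j - x0 j) else x j - x0 j := by
    intro x j
    by_cases h : j = i
    · subst h; simp [hR, ei_apply]; ring
    · simp [hR, ei_apply, h]
  have Rbox : ∀ x : EE n, (∀ j, |x j - x0 j| ≤ d) → (∀ j, |R x j - x0 j| ≤ d) := by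
    intro x hx j
    rw [Rj]; split_ifs
    · rw [abs_neg]; exact hx j
    · exact hx j
  set ψ : EE n → ℝ := fun x => (M / d ^ 2) * (∑ j, (x j - x0 j) ^ 2 - n * (x i - x0 i) ^ 2
    + n * d * (x i - x0 i)) + (G' / 2) * ((x i - x0 i) * (d - (x i - x0 i))) with hψ
  set Ψ : EE n → ℝ := fun x => (1 / 2) * (w x - w (R x)) - ψ x with hΨ
  set Q : Set (EE n) := {x | (∀ j, |x j - x0 j| ≤ d) ∧ x0 i ≤ x i} with hQ
  have hQc : IsCompact Q := by
    refine Metric.isCompact_of_isClosed_isBounded ?_ ?_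
    · have c1 : IsClosed {x : EE n | x0 i ≤ x i} := isClosed_le continuous_const (by fun_prop)
      have c2 : IsClosed {x : EE n | ∀ j, |x j - x0 j| ≤ d} := by
        simp only [Set.ofPred_forall]
        exact isClosed_iInter fun j => isClosed_le (by fun_prop) continuous_const
      exact c2.inter c1
    · refine (Metric.isBounded_closedBall (x := x0) (r := n * d)).subset fun x hx => ?_
      rw [mem_closedBall_iff_norm]
      refine (norm_le_sum _).trans ?_
      calc _ ≤ ∑ j : Fin n, d := Finset.sum_le_sum fun j _ => by simpa using hx.1 j
        _ = n * d := by simp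
  have hQ0 : x0 ∈ Q := ⟨by simp [hd.le], le_rfl⟩
  have Rcont : Continuous R := by simp only [hR]; fun_prop
  have hcont : ContinuousOn Ψ Q := by
    intro x hx
    have h1 := (hC x hx.1).continuousAt
    have h2 := (hC (R x) (Rbox x hx.1)).continuousAt
    have h3 : ContinuousAt (fun x => w (R x)) x := ContinuousAt.comp h2 Rcont.continuousAt
    have h4 : ContinuousAt ψ x := by simp only [hψ]; fun_prop
    exact ((continuousAt_const.mul (h1.sub h3)).sub h4).continuousWithinAt
  have hψ0 : ∀ x ∈ Q, 0 ≤ ψ x ∧ (x i - x0 i = d → M ≤ ψ x) ∧ (∀ j, |x j - x0 j| = d → M ≤ ψ x) := by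
    intro x hx
    have hs0 : 0 ≤ x i - x0 i := by linarith [hx.2]
    have hsd : x i - x0 i ≤ d := (le_abs_self _).trans (hx.1 i)
    have hn1 : (1:ℝ) ≤ n := by exact_mod_cast i.pos
    have hB : 0 ≤ (G' / 2) * ((x i - x0 i) * (d - (x i - x0 i))) := by
      have : 0 ≤ (x i - x0 i) * (d - (x i - x0 i)) := mul_nonneg hs0 (by linarith)
      have : 0 ≤ G' / 2 := by linarith
      positivity
    set s := x i - x0 i
    have hk : 0 ≤ n * d * s - n * s ^ 2 := by
      have : 0 ≤ s * (d - s) := mul_nonneg hs0 (by linarith)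
      nlinarith
    have key : ∀ j, |x j - x0 j| = d → M ≤ ψ x := by
      intro j hj
      have : d ^ 2 ≤ ∑ j, (x j - x0 j) ^ 2 := by
        rw [← hj, sq_abs]
        exact Finset.single_le_sum (f := fun j => (x j - x0 j) ^ 2)
          (fun j _ => sq_nonneg _) (Finset.mem_univ j)
      have : M / d ^ 2 * d ^ 2 ≤ M / d ^ 2 * (∑ j, (x j - x0 j) ^ 2 - n * s ^ 2 + n * d * s) :=
        mul_le_mul_of_nonneg_left (by linarith) (by positivity)
      have e : M / d ^ 2 * d ^ 2 = M := by field_simp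
      simp only [hψ]; linarith
    refine ⟨?_, fun h => key i (by rw [abs_of_nonneg hs0]; exact h), key⟩
    have : 0 ≤ ∑ j, (x j - x0 j) ^ 2 := Finset.sum_nonneg fun j _ => sq_nonneg _
    have : 0 ≤ M / d ^ 2 * (∑ j, (x j - x0 j) ^ 2 - n * s ^ 2 + n * d * s) :=
      mul_nonneg (by positivity) (by linarith)
    simp only [hψ]; linarith
  obtain ⟨p, hp, hmax⟩ := hQc.exists_isMaxOn ⟨x0, hQ0⟩ hcont
  have hle : Ψ p ≤ 0 := by
    by_contra! hpos
    have hφM : (1 / 2) * (w p - w (R p)) ≤ M := by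
      have h1 := abs_le.1 (hM p hp.1)
      have h2 := abs_le.1 (hM _ (Rbox p hp.1))
      linarith
    obtain ⟨q1, q2, q3⟩ := hψ0 p hp
    have hj : ∀ j, |p j - x0 j| < d := fun j => lt_of_le_of_ne (hp.1 j) fun h => by
      have := q3 j h
      simp only [hΨ] at hpos; linarith
    have hi0 : x0 i < p i := lt_of_le_of_ne hp.2 fun h => by
      have : R p = p := by simp [hR, h]
      simp only [hΨ, this] at hpos; linarith
    have hnb : ∀ᶠ x in 𝓝 p, x ∈ Q := by
      have h1 : ∀ᶠ x in 𝓝 p, ∀ j, |x j - x0 j| < d := by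
        refine eventually_all.2 fun j => ?_
        exact (by fun_prop : Continuous fun x : EE n => |x j - x0 j|).continuousAt.eventually_lt
          continuousAt_const (hj j)
      have h2 : ∀ᶠ x in 𝓝 p, x0 i < x i :=
        continuousAt_const.eventually_lt (by fun_prop : Continuous fun x : EE n => x i).continuousAt hi0
      filter_upwards [h1, h2] with x a b using ⟨fun j => (a j).le, b.le⟩
    have hsec : ∀ j, (1 / 2) * (hs w p (ei j) (ei j) - hs w (R p) (ei j) (ei j)) -
        (2 * (M / d ^ 2 * (1 - n * (if j = i then 1 else 0)) - G' / 2 * (if j = i then 1 else 0))) ≤ 0 := by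
      intro j
      have hloc : IsLocalMax (fun t : ℝ => Ψ (p + t • ei j)) 0 := by
        have h0 : Tendsto (fun t : ℝ => p + t • ei j) (𝓝 0) (𝓝 p) := by
          have : Continuous (fun t : ℝ => p + t • (ei j : EE n)) := by fun_prop
          simpa using this.tendsto 0
        filter_upwards [h0.eventually hnb] with t ht
        simpa using hmax ht
      refine D2.nonpos_of_max ?_ hloc
      set ε : ℝ := if j = i then -1 else 1 with hε
      have hRl : ∀ t : ℝ, R (p + t • ei j) = R p + t • (ε • ei j) := by
        intro t
        ext k
        by_cases h : j = i
        · subst h; simp [hR, hε, ei_apply]; split_ifs <;> ring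
        · have h' : ¬ i = j := fun e => h e.symm
          simp [hR, hε, ei_apply, h, h']; split_ifs <;> ring
      have hh : hs w (R p) (ε • ei j) (ε • ei j) = hs w (R p) (ei j) (ei j) := by
        rw [hs_smul_left, hs_smul_right]
        simp only [hε]; split_ifs <;> ring
      have e1 := D2_line (hC p hp.1) (ei j)
      have e2 := D2_line (hC (R p) (Rbox p hp.1)) (ε • ei j)
      rw [hh] at e2
      have e3 := ((e1.sub e2).const_mul (1 / 2)).sub (D2_quad (ψ p)
        (M / d ^ 2 * (2 * (p j - x0 j) - n * (2 * (p i - x0 i)) * (if j = i then 1 else 0)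
          + n * d * (if j = i then 1 else 0)) + G' / 2 * ((d - 2 * (p i - x0 i)) * (if j = i then 1 else 0)))
        (M / d ^ 2 * (1 - n * (if j = i then 1 else 0)) - G' / 2 * (if j = i then 1 else 0)))
      convert e3 using 1
      funext t
      have hsum : ∑ k, ((p + t • ei j : EE n) k - x0 k) ^ 2
          = ∑ k, (p k - x0 k) ^ 2 + 2 * t * (p j - x0 j) + t ^ 2 := by
        have : ∀ k, ((p + t • ei j : EE n) k - x0 k) ^ 2 = (p k - x0 k) ^ 2 +
            (if k = j then 2 * t * (p k - x0 k) + t ^ 2 else 0) := by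
          intro k
          simp [ei_apply]; split_ifs <;> ring
        simp only [this, Finset.sum_add_distrib, Finset.sum_ite_eq', Finset.mem_univ, if_true]
        ring
      simp only [hΨ, hRl, hψ, hsum]
      by_cases h : j = i
      · subst h; simp [ei_apply]; ring
      · have h' : ¬ i = j := fun e => h e.symm
        simp [ei_apply, h, h']; ring
    have htot := Finset.sum_nonpos fun j (_ : j ∈ Finset.univ) => hsec j
    have l1 := abs_le.1 (hG p hp.1)
    have l2 := abs_le.1 (hG _ (Rbox p hp.1))
    rw [lap_eq (hC p hp.1)] at l1
    rw [lap_eq (hC _ (Rbox p hp.1))] at l2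
    rw [Finset.sum_sub_distrib, ← Finset.mul_sum, Finset.sum_sub_distrib, ← Finset.mul_sum,
      Finset.sum_sub_distrib, ← Finset.mul_sum, ← Finset.mul_sum, Finset.sum_sub_distrib,
      ← Finset.mul_sum] at htot
    simp at htot
    linarith
  have hall : ∀ x ∈ Q, Ψ x ≤ 0 := fun x hx => (hmax hx).trans hle
  have hl : ∀ t : ℝ, HasDerivAt (fun t : ℝ => x0 + t • (ei i : EE n)) (ei i) t := fun t => by
    simpa using ((hasDerivAt_id t).smul_const (ei i : EE n)).const_add x0
  have hl' : ∀ t : ℝ, HasDerivAt (fun t : ℝ => x0 + t • (-ei i : EE n)) (-ei i) t := fun t => by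
    simpa using ((hasDerivAt_id t).smul_const (-ei i : EE n)).const_add x0
  have hw : HasFDerivAt w (fderiv ℝ w x0) x0 := ((hC x0 hQ0.1).differentiableAt (by simp)).hasFDerivAt
  have d1 := (show HasFDerivAt w (fderiv ℝ w x0) (x0 + (0:ℝ) • ei i) by simpa using hw).comp_hasDerivAt
    (0:ℝ) (hl 0)
  have d2 := (show HasFDerivAt w (fderiv ℝ w x0) (x0 + (0:ℝ) • (-ei i)) by simpa using hw).comp_hasDerivAt
    (0:ℝ) (hl' 0)
  have d3 := ((hasDerivAt_id (0:ℝ)).const_mul (n * M / d + d * G' / 2))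
  have d4 := ((hasDerivAt_id (0:ℝ)).pow 2).const_mul (M / d ^ 2 * (1 - n) - G' / 2)
  have := nonpos_of_right hd ((((d1.sub d2).const_mul (1 / 2)).sub d3).sub d4) (by
    intro t ht0 ht1
    have hmem : x0 + t • ei i ∈ Q := by
      refine ⟨fun j => ?_, ?_⟩
      · simp [ei_apply]; split_ifs <;> simp [abs_of_pos ht0, ht1.le, hd.le]
      · simp [ei_apply, ht0.le]
    have h := hall _ hmem
    have hRR : R (x0 + t • ei i) = x0 + t • (-ei i) := by
      ext k; simp [hR, ei_apply]; try split_ifs <;> ring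
    have hsum : ∑ k, ((x0 + t • ei i : EE n) k - x0 k) ^ 2 = t ^ 2 := by
      simp [ei_apply]
    simp only [hΨ, hψ, hRR, hsum] at h
    simp [ei_apply] at h
    simp
    have e : M / d ^ 2 * (t ^ 2 - n * t ^ 2 + n * d * t) = M / d ^ 2 * (1 - n) * t ^ 2 + n * M / d * t := by
      field_simp
    nlinarith [h, e])
  simp at this
  unfold pd
  linarith

lemma grad_est (w : EE n → ℝ) (x0 : EE n) {d M G : ℝ} (hd : 0 < d) (i : Fin n)
    (hC : ∀ x : EE n, (∀ j, |x j - x0 j| ≤ d) → ContDiffAt ℝ 2 w x)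
    (hM : ∀ x : EE n, (∀ j, |x j - x0 j| ≤ d) → |w x| ≤ M)
    (hG : ∀ x : EE n, (∀ j, |x j - x0 j| ≤ d) → |lap w x| ≤ G) :
    |pd i w x0| ≤ n * M / d + d * G / 2 := by
  have lim : ∀ a : ℝ, (∀ G', G < G' → a ≤ n * M / d + d * G' / 2) → a ≤ n * M / d + d * G / 2 := by
    intro a h
    refine le_of_forall_pos_le_add fun ε hε => ?_
    have := h (G + 2 * ε / d) (by linarith [div_pos (mul_pos two_pos hε) hd])
    have e : d * (G + 2 * ε / d) / 2 = d * G / 2 + ε := by field_simp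
    linarith
  rw [abs_le]
  constructor
  · have := lim (pd i (fun y => - w y) x0) fun G' h => grad_aux _ x0 hd h i
      (fun x hx => (hC x hx).neg) (fun x hx => by simpa using hM x hx) (fun x hx => by
        have : lap (fun y => - w y) x = - lap w x := by
          have e : ∀ j, pd j (fun y => - w y) = fun y => - pd j w y := fun j => by
            funext y; exact pd_neg j
          simp only [lap, e, pd_neg, Finset.sum_neg_distrib]
        rw [this, abs_neg]; exact hG x hx)
    rw [pd_neg] at this
    linarith
  · exact lim _ fun G' h => grad_aux _ x0 hd h i hC hM hG

end MAE

open Filter Topology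
namespace MAE
variable {n : ℕ}

noncomputable def CZ (γ : ℝ) : ℝ := (1 - (2:ℝ) ^ (-γ))⁻¹

lemma CZ_aux {γ : ℝ} (hγ : 0 < γ) : (2:ℝ) ^ (-γ) < 1 ∧ 0 < (2:ℝ) ^ (-γ) :=
  ⟨Real.rpow_lt_one_of_one_lt_of_neg (by norm_num) (by linarith), by positivity⟩

lemma CZ_pos {γ : ℝ} (hγ : 0 < γ) : 0 < CZ γ := by
  have := CZ_aux hγ
  exact inv_pos.2 (by linarith)

lemma two_pow_aux (γ : ℝ) (j : ℕ) : (2:ℝ) ^ j * ((2:ℝ)⁻¹ ^ j) ^ (1 + γ) = ((2:ℝ) ^ (-γ)) ^ j := by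
  have h2 : ((2:ℝ)⁻¹ ^ j) = (2:ℝ) ^ (-(j:ℝ)) := by
    rw [Real.rpow_neg (by norm_num), Real.rpow_natCast, inv_pow]
  rw [h2, ← Real.rpow_natCast, ← Real.rpow_natCast, ← Real.rpow_mul (by norm_num), ← Real.rpow_mul (by norm_num),
    ← Real.rpow_add (by norm_num)]
  congr 1; ring

lemma zyg {f : EE n → ℝ} {x0 : EE n} {R K γ : ℝ} (hγ : 0 < γ) (hγ1 : γ ≤ 1) (hK : 0 ≤ K)
    (hc : ContinuousOn f (Metric.ball x0 R))
    (h2 : ∀ x h : EE n, x ∈ Metric.ball x0 R → x + (2:ℝ) • h ∈ Metric.ball x0 R →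
      |f (x + (2:ℝ) • h) - 2 * f (x + h) + f x| ≤ K * ‖h‖ ^ (1 + γ))
    {x : EE n} (hx : x ∈ Metric.ball x0 R) :
    DifferentiableAt ℝ f x ∧ ∀ h : EE n, x + h ∈ Metric.ball x0 R →
      |f (x + h) - f x - fderiv ℝ f x h| ≤ CZ γ * K * ‖h‖ ^ (1 + γ) := by
  obtain ⟨r1, r0⟩ := CZ_aux hγ
  set D : ℕ → EE n → ℝ := fun j h => 2 ^ j * (f (x + (2:ℝ)⁻¹ ^ j • h) - f x) with hD
  have hstep : ∀ h, x + h ∈ Metric.ball x0 R → ∀ j,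
      dist (D j h) (D (j + 1) h) ≤ (K * ‖h‖ ^ (1 + γ)) * ((2:ℝ) ^ (-γ)) ^ j := by
    intro h hh j
    have hin : x + (2:ℝ) • ((2:ℝ)⁻¹ ^ (j + 1) • h) ∈ Metric.ball x0 R := by
      have : x + (2:ℝ) • ((2:ℝ)⁻¹ ^ (j + 1) • h) = x + (2:ℝ)⁻¹ ^ j • h := by
        rw [smul_smul, pow_succ]; congr 2; ring
      rw [this]
      exact (convex_ball x0 R).add_smul_mem hx hh ⟨by positivity, pow_le_one₀ (by norm_num) (by norm_num)⟩
    have e := h2 x _ hx hin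
    have e1 : (2:ℝ) • ((2:ℝ)⁻¹ ^ (j + 1) • h) = (2:ℝ)⁻¹ ^ j • h := by
      rw [smul_smul, pow_succ]; congr 1; ring
    rw [e1] at e
    have : dist (D j h) (D (j + 1) h) = 2 ^ j * |f (x + (2:ℝ)⁻¹ ^ j • h) - 2 * f (x + (2:ℝ)⁻¹ ^ (j + 1) • h) + f x| := by
      rw [Real.dist_eq, show D j h - D (j + 1) h = 2 ^ j * (f (x + (2:ℝ)⁻¹ ^ j • h) -
        2 * f (x + (2:ℝ)⁻¹ ^ (j + 1) • h) + f x) by simp only [hD]; ring, abs_mul,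
        abs_of_pos (show (0:ℝ) < 2 ^ j by positivity)]
    rw [this]
    calc _ ≤ 2 ^ j * (K * ‖(2:ℝ)⁻¹ ^ (j + 1) • h‖ ^ (1 + γ)) := by gcongr
      _ ≤ 2 ^ j * (K * ((2:ℝ)⁻¹ ^ j * ‖h‖) ^ (1 + γ)) := by
          gcongr
          rw [norm_smul, Real.norm_of_nonneg (by positivity)]
          gcongr ?_ * _
          exact pow_le_pow_of_le_one (by norm_num) (by norm_num) (by omega)
      _ = (2 ^ j * ((2:ℝ)⁻¹ ^ j) ^ (1 + γ)) * (K * ‖h‖ ^ (1 + γ)) := by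
          rw [Real.mul_rpow (by positivity) (norm_nonneg _)]; ring
      _ = _ := by rw [two_pow_aux]; ring
  have hsmall : ∀ h : EE n, ∃ J : ℕ, ∀ j ≥ J, x + (2:ℝ)⁻¹ ^ j • h ∈ Metric.ball x0 R := by
    intro h
    have : Tendsto (fun j : ℕ => x + (2:ℝ)⁻¹ ^ j • h) atTop (𝓝 (x + (0:ℝ) • h)) :=
      ((tendsto_pow_atTop_nhds_zero_of_lt_one (by norm_num) (by norm_num)).smul_const h).const_add x
    rw [zero_smul, add_zero] at this
    exact eventually_atTop.1 (this.eventually (Metric.isOpen_ball.mem_nhds hx))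
  have hlim : ∀ h, ∃ l, Tendsto (fun j => D j h) atTop (𝓝 l) := by
    intro h
    obtain ⟨J, hJ⟩ := hsmall h
    obtain ⟨l, hl⟩ := cauchySeq_tendsto_of_complete
      (cauchySeq_of_le_geometric _ _ r1 (hstep _ (hJ J le_rfl)))
    refine ⟨2 ^ J * l, ?_⟩
    rw [← tendsto_add_atTop_iff_nat J]
    refine (hl.const_mul (2 ^ J)).congr fun j => ?_
    simp only [hD, smul_smul, ← pow_add]
    ring
  choose L hL using hlim
  have hadd : ∀ h k, L (h + k) = L h + L k := by
    intro h k
    obtain ⟨J1, hJ1⟩ := hsmall h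
    obtain ⟨J2, hJ2⟩ := hsmall k
    obtain ⟨J3, hJ3⟩ := hsmall (h + k)
    have h0 : Tendsto (fun j => D j (h + k) - (D j h + D j k)) atTop (𝓝 0) := by
      have hb : ∀ᶠ j in atTop, |D j (h + k) - (D j h + D j k)| ≤
          (K * ‖(2:ℝ)⁻¹ • (h + k)‖ ^ (1 + γ) + K * ‖(2:ℝ)⁻¹ • (k - h)‖ ^ (1 + γ)) * ((2:ℝ) ^ (-γ)) ^ j := by
        filter_upwards [eventually_ge_atTop J1, eventually_ge_atTop J2, eventually_ge_atTop J3] with j j1 j2 j3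
        have a1 := h2 x ((2:ℝ)⁻¹ ^ j • ((2:ℝ)⁻¹ • (h + k))) hx (by
          rw [smul_comm, smul_smul (2:ℝ)]; simpa using hJ3 j j3)
        have a2 := h2 (x + (2:ℝ)⁻¹ ^ j • h) ((2:ℝ)⁻¹ ^ j • ((2:ℝ)⁻¹ • (k - h))) (hJ1 j j1) (by
          rw [smul_comm, smul_smul (2:ℝ)]
          have : x + (2:ℝ)⁻¹ ^ j • h + (2:ℝ)⁻¹ ^ j • ((2 * (2:ℝ)⁻¹) • (k - h)) = x + (2:ℝ)⁻¹ ^ j • k := by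
            rw [mul_inv_cancel₀ (by norm_num)]; module
          rw [this]; exact hJ2 j j2)
        rw [show x + (2:ℝ)⁻¹ ^ j • h + (2:ℝ) • ((2:ℝ)⁻¹ ^ j • ((2:ℝ)⁻¹ • (k - h))) = x + (2:ℝ)⁻¹ ^ j • k by module,
          show x + (2:ℝ)⁻¹ ^ j • h + ((2:ℝ)⁻¹ ^ j • ((2:ℝ)⁻¹ • (k - h))) = x + ((2:ℝ)⁻¹ ^ j • ((2:ℝ)⁻¹ • (h + k))) by module] at a2
        rw [show (2:ℝ) • ((2:ℝ)⁻¹ ^ j • ((2:ℝ)⁻¹ • (h + k))) = (2:ℝ)⁻¹ ^ j • (h + k) by module] at a1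
        have e : D j (h + k) - (D j h + D j k) = 2 ^ j *
          ((f (x + (2:ℝ)⁻¹ ^ j • (h + k)) - 2 * f (x + ((2:ℝ)⁻¹ ^ j • ((2:ℝ)⁻¹ • (h + k)))) + f x) -
          (f (x + (2:ℝ)⁻¹ ^ j • k) - 2 * f (x + ((2:ℝ)⁻¹ ^ j • ((2:ℝ)⁻¹ • (h + k)))) + f (x + (2:ℝ)⁻¹ ^ j • h))) := by
          simp only [hD]; ring
        rw [e, abs_mul, abs_of_pos (show (0:ℝ) < 2 ^ j by positivity)]
        have hn : ∀ q : EE n, ‖(2:ℝ)⁻¹ ^ j • q‖ ^ (1 + γ) = ((2:ℝ)⁻¹ ^ j) ^ (1 + γ) * ‖q‖ ^ (1 + γ) := by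
          intro q
          rw [norm_smul, Real.norm_of_nonneg (by positivity), Real.mul_rpow (by positivity) (norm_nonneg _)]
        rw [hn] at a1 a2
        calc _ ≤ 2 ^ j * (K * (((2:ℝ)⁻¹ ^ j) ^ (1 + γ) * ‖(2:ℝ)⁻¹ • (h + k)‖ ^ (1 + γ)) +
              K * (((2:ℝ)⁻¹ ^ j) ^ (1 + γ) * ‖(2:ℝ)⁻¹ • (k - h)‖ ^ (1 + γ))) := by
              gcongr
              exact (abs_sub _ _).trans (add_le_add a1 a2)
          _ = _ := by rw [← two_pow_aux]; ring
      refine squeeze_zero_norm' hb ?_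
      simpa using (tendsto_pow_atTop_nhds_zero_of_lt_one r0.le r1).const_mul
        (K * ‖(2:ℝ)⁻¹ • (h + k)‖ ^ (1 + γ) + K * ‖(2:ℝ)⁻¹ • (k - h)‖ ^ (1 + γ))
    have := tendsto_nhds_unique h0 ((hL (h + k)).sub ((hL h).add (hL k)))
    linarith
  have hest : ∀ h : EE n, x + h ∈ Metric.ball x0 R → |f (x + h) - f x - L h| ≤ CZ γ * K * ‖h‖ ^ (1 + γ) := by
    intro h hh
    have := dist_le_of_le_geometric_of_tendsto₀ _ _ r1 (hstep h hh) (hL h)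
    rw [Real.dist_eq] at this
    simp only [hD, pow_zero, one_smul, one_mul] at this
    refine this.trans (le_of_eq ?_)
    rw [CZ]; field_simp
  set La : EE n →+ ℝ := AddMonoidHom.mk' L hadd with hLa
  have hcont : Continuous La := by
    refine continuous_of_continuousAt_zero La ?_
    have hb : ∀ᶠ h : EE n in 𝓝 0, x + h ∈ Metric.ball x0 R := by
      have : Tendsto (fun h : EE n => x + h) (𝓝 0) (𝓝 x) := by
        simpa using (continuous_const_add x).tendsto (0 : EE n)
      exact this.eventually (Metric.isOpen_ball.mem_nhds hx)
    rw [ContinuousAt, map_zero]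
    refine squeeze_zero_norm' (a := fun h => |f (x + h) - f x| + CZ γ * K * ‖h‖ ^ (1 + γ)) ?_ ?_
    · filter_upwards [hb] with h hh
      have := hest h hh
      show |L h| ≤ _
      have := abs_sub_abs_le_abs_sub (L h) (f (x + h) - f x)
      rw [abs_sub_comm (L h)] at this
      linarith
    · have h1 : ContinuousAt (fun h : EE n => |f (x + h) - f x| + CZ γ * K * ‖h‖ ^ (1 + γ)) 0 := by
        have hfx : ContinuousAt f (x + 0) := by
          rw [add_zero]; exact hc.continuousAt (Metric.isOpen_ball.mem_nhds hx)
        have hg : ContinuousAt (fun h : EE n => f (x + h)) 0 := ContinuousAt.comp (f := fun h : EE n => x + h) hfx (by fun_prop)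
        refine (hg.sub continuousAt_const).abs.add (continuousAt_const.mul ?_)
        exact ContinuousAt.rpow_const (by fun_prop) (Or.inr (by linarith))
      have := h1.tendsto
      simpa [Real.zero_rpow (show 1 + γ ≠ 0 by linarith)] using this
  set Lc : EE n →L[ℝ] ℝ := La.toRealLinearMap hcont with hLc
  have hLcL : ∀ h, Lc h = L h := fun h => rfl
  have hder : HasFDerivAt f Lc x := by
    rw [hasFDerivAt_iff_isLittleO_nhds_zero]
    have hb : ∀ᶠ h : EE n in 𝓝 0, x + h ∈ Metric.ball x0 R := by
      have : Tendsto (fun h : EE n => x + h) (𝓝 0) (𝓝 x) := by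
        simpa using (continuous_const_add x).tendsto (0 : EE n)
      exact this.eventually (Metric.isOpen_ball.mem_nhds hx)
    have O1 : (fun h : EE n => f (x + h) - f x - Lc h) =O[𝓝 0] fun h : EE n => ‖h‖ ^ (1 + γ) := by
      refine Asymptotics.IsBigO.of_bound (CZ γ * K) ?_
      filter_upwards [hb] with h hh
      rw [Real.norm_of_nonneg (by positivity : 0 ≤ ‖h‖ ^ (1 + γ)), hLcL]
      exact hest h hh
    refine O1.trans_isLittleO ?_
    rw [Asymptotics.isLittleO_iff]
    intro c hc'
    have h1 : Tendsto (fun h : EE n => ‖h‖ ^ γ) (𝓝 0) (𝓝 0) := by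
      have : ContinuousAt (fun h : EE n => ‖h‖ ^ γ) 0 :=
        ContinuousAt.rpow_const (by fun_prop) (Or.inr hγ.le)
      simpa [ContinuousAt, Real.zero_rpow hγ.ne'] using this
    filter_upwards [h1.eventually (gt_mem_nhds hc')] with h hh
    rw [Real.norm_of_nonneg (by positivity : 0 ≤ ‖h‖ ^ (1 + γ)), add_comm,
      Real.rpow_add_one' (norm_nonneg _) (by linarith)]
    gcongr
  refine ⟨hder.differentiableAt, fun h hh => ?_⟩
  rw [hder.fderiv, hLcL]
  exact hest h hh

lemma zyg_holder {f : EE n → ℝ} {x0 : EE n} {R K γ : ℝ} (hγ : 0 < γ) (hγ1 : γ ≤ 1) (hK : 0 ≤ K)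
    (hc : ContinuousOn f (Metric.ball x0 R))
    (h2 : ∀ x h : EE n, x ∈ Metric.ball x0 R → x + (2:ℝ) • h ∈ Metric.ball x0 R →
      |f (x + (2:ℝ) • h) - 2 * f (x + h) + f x| ≤ K * ‖h‖ ^ (1 + γ))
    {x x' : EE n} (hx : x ∈ Metric.ball x0 (R / 4)) (hx' : x' ∈ Metric.ball x0 (R / 4)) (p : EE n) :
    |fderiv ℝ f x' p - fderiv ℝ f x p| ≤ 6 * CZ γ * K * ‖x' - x‖ ^ γ * ‖p‖ := by
  rw [mem_ball_iff_norm] at hx hx'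
  have hCZ := CZ_pos hγ
  have hR : 0 < R := by linarith [norm_nonneg (x - x0)]
  rcases eq_or_ne x' x with rfl | hne
  · simp [Real.zero_rpow hγ.ne']
  rcases eq_or_ne p 0 with rfl | hp
  · simp
  set d := ‖x' - x‖ with hd
  have hd0 : 0 < d := norm_pos_iff.2 (sub_ne_zero.2 hne)
  have hdR : d < R / 2 := by
    calc d = ‖(x' - x0) - (x - x0)‖ := by rw [hd]; congr 1; abel
      _ ≤ _ := norm_sub_le _ _
      _ < R / 2 := by linarith
  have hp0 : 0 < ‖p‖ := norm_pos_iff.2 hp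
  set e : EE n := (d / ‖p‖) • p with he
  have hen : ‖e‖ = d := by
    rw [he, norm_smul, Real.norm_of_nonneg (by positivity)]; field_simp
  have inb : ∀ q : EE n, ‖q - x0‖ < R → q ∈ Metric.ball x0 R := fun q h => by rwa [mem_ball_iff_norm]
  have b1 : x ∈ Metric.ball x0 R := inb _ (by linarith)
  have b2 : x' ∈ Metric.ball x0 R := inb _ (by linarith)
  have b3 : x' + e ∈ Metric.ball x0 R := inb _ (by
    calc ‖x' + e - x0‖ = ‖(x' - x0) + e‖ := by congr 1; abel
      _ ≤ _ := norm_add_le _ _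
      _ < R := by linarith)
  have s1 := (zyg hγ hγ1 hK hc h2 b1).2 (x' - x + e) (by rwa [show x + (x' - x + e) = x' + e by abel])
  have s2 := (zyg hγ hγ1 hK hc h2 b1).2 (x' - x) (by rwa [show x + (x' - x) = x' by abel])
  have s3 := (zyg hγ hγ1 hK hc h2 b2).2 e b3
  rw [show x + (x' - x + e) = x' + e by abel, map_add] at s1
  rw [show x + (x' - x) = x' by abel] at s2
  have n1 : ‖x' - x + e‖ ^ (1 + γ) ≤ 4 * d ^ (1 + γ) := by
    calc _ ≤ (2 * d) ^ (1 + γ) := by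
          gcongr
          exact (norm_add_le _ _).trans (by linarith)
      _ = 2 ^ (1 + γ) * d ^ (1 + γ) := Real.mul_rpow (by norm_num) hd0.le
      _ ≤ 2 ^ (2:ℝ) * d ^ (1 + γ) := by
          gcongr
          · norm_num
          · linarith
      _ = _ := by norm_num
  rw [hen] at s3
  have hCK : 0 ≤ CZ γ * K := by positivity
  have s1' := s1.trans (mul_le_mul_of_nonneg_left n1 hCK)
  have main : |fderiv ℝ f x' e - fderiv ℝ f x e| ≤ 6 * (CZ γ * K * d ^ (1 + γ)) := by
    rw [abs_le] at *
    constructor <;> linarith [s1'.1, s1'.2, s2.1, s2.2, s3.1, s3.2]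
  rw [he, map_smul, map_smul, ← smul_sub, smul_eq_mul, abs_mul, abs_of_pos (by positivity)] at main
  rw [Real.rpow_one_add' hd0.le (by linarith)] at main
  have : |fderiv ℝ f x' p - fderiv ℝ f x p| = (‖p‖ / d) * (d / ‖p‖ * |fderiv ℝ f x' p - fderiv ℝ f x p|) := by
    field_simp
  rw [this]
  calc _ ≤ (‖p‖ / d) * (6 * (CZ γ * K * (d * d ^ γ))) := by gcongr
    _ = _ := by field_simp

end MAE

open Filter Topology
namespace MAE
variable {n : ℕ}

def Jt (φ : ℝ → ℝ) (b c : ℝ) : Prop :=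
  ∃ φ1 : ℝ → ℝ, (∀ᶠ t in 𝓝 (0:ℝ), HasDerivAt φ (φ1 t) t) ∧ φ1 0 = b ∧ HasDerivAt φ1 c 0

lemma Jt.D2 {φ : ℝ → ℝ} {b c : ℝ} (h : Jt φ b c) : D2 φ c := by
  obtain ⟨f, h1, _, h2⟩ := h
  exact ⟨f, h1, h2⟩

lemma Jt.mul {φ ψ : ℝ → ℝ} {b c b' c' : ℝ} (h : Jt φ b c) (k : Jt ψ b' c') :
    Jt (fun t => φ t * ψ t) (b * ψ 0 + φ 0 * b') (c * ψ 0 + 2 * b * b' + φ 0 * c') := by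
  obtain ⟨f, h1, h2, h3⟩ := h
  obtain ⟨g, k1, k2, k3⟩ := k
  refine ⟨fun t => f t * ψ t + φ t * g t, ?_, by simp [h2, k2], ?_⟩
  · filter_upwards [h1, k1] with t a b using a.mul b
  · refine ((h3.mul k1.self_of_nhds).add (h1.self_of_nhds.mul k3)).congr_deriv ?_
    rw [h2, k2]; ring

lemma Jt.add {φ ψ : ℝ → ℝ} {b c b' c' : ℝ} (h : Jt φ b c) (k : Jt ψ b' c') :
    Jt (fun t => φ t + ψ t) (b + b') (c + c') := by
  obtain ⟨f, h1, h2, h3⟩ := h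
  obtain ⟨g, k1, k2, k3⟩ := k
  refine ⟨fun t => f t + g t, ?_, by simp [h2, k2], h3.add k3⟩
  filter_upwards [h1, k1] with t a b using a.add b

lemma Jt_quad (a b c : ℝ) : Jt (fun t => a + b * t + c * t ^ 2) b (2 * c) := by
  refine ⟨fun t => b + c * (2 * t), Eventually.of_forall fun t => ?_, by simp, ?_⟩
  · have := ((hasDerivAt_id t).const_mul b).const_add a |>.add (((hasDerivAt_id t).pow 2).const_mul c)
    refine this.congr_deriv ?_
    simp
  · have := (((hasDerivAt_id (0:ℝ)).const_mul 2).const_mul c).const_add b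
    refine this.congr_deriv ?_
    ring

lemma Jt_const (a : ℝ) : Jt (fun _ => a) 0 0 := by
  simpa using Jt_quad a 0 0

lemma Jt.rpow {φ : ℝ → ℝ} {b c : ℝ} (h : Jt φ b c) (h0 : 0 < φ 0) (a : ℝ) :
    Jt (fun t => φ t ^ a) (a * φ 0 ^ a * (b / φ 0)) (φ 0 ^ a * (a * (c / φ 0) + a * (a - 1) * (b / φ 0) ^ 2)) := by
  obtain ⟨f, h1, h2, h3⟩ := h
  refine ⟨fun t => f t * a * φ t ^ (a - 1), ?_, ?_, ?_⟩
  · have hc : ContinuousAt φ 0 := h1.self_of_nhds.continuousAt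
    filter_upwards [h1, hc.eventually (lt_mem_nhds h0)] with t ht h0t
    exact ht.rpow_const (Or.inl h0t.ne')
  · simp only [h2]; rw [Real.rpow_sub_one h0.ne']; field_simp
  · refine ((h3.mul_const a).mul (h1.self_of_nhds.rpow_const (p := a - 1) (Or.inl h0.ne'))).congr_deriv ?_
    rw [h2, Real.rpow_sub_one h0.ne', Real.rpow_sub_one h0.ne', Real.rpow_sub_one h0.ne']
    field_simp

noncomputable def psi (K M : ℝ) (x y z : EE n) : ℝ :=
  K * ((‖y‖ ^ 2) ^ (7/16 : ℝ) * (‖z‖ ^ 2) ^ (7/16 : ℝ)) +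
    M * (‖x‖ ^ 2 * ((‖y‖ ^ 2) ^ (1/4 : ℝ) * (‖z‖ ^ 2) ^ (1/4 : ℝ)))

/-- bracket -/
noncomputable def br (a p q P R : ℝ) : ℝ := a * (P + R) + a * (a - 1) * (p ^ 2 + q ^ 2) + 2 * a ^ 2 * p * q

noncomputable def Qf (K M : ℝ) (x y z X Y Z : EE n) : ℝ :=
  K * ((‖y‖ ^ 2) ^ (7/16 : ℝ) * (‖z‖ ^ 2) ^ (7/16 : ℝ)) *
    br (7/16) (2 * inner ℝ y Y / ‖y‖ ^ 2) (2 * inner ℝ z Z / ‖z‖ ^ 2) (2 * ‖Y‖ ^ 2 / ‖y‖ ^ 2) (2 * ‖Z‖ ^ 2 / ‖z‖ ^ 2) +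
  M * ((‖y‖ ^ 2) ^ (1/4 : ℝ) * (‖z‖ ^ 2) ^ (1/4 : ℝ)) *
    (2 * ‖X‖ ^ 2 + inner ℝ x X * (2 * inner ℝ y Y / ‖y‖ ^ 2 + 2 * inner ℝ z Z / ‖z‖ ^ 2) + ‖x‖ ^ 2 *
    br (1/4) (2 * inner ℝ y Y / ‖y‖ ^ 2) (2 * inner ℝ z Z / ‖z‖ ^ 2) (2 * ‖Y‖ ^ 2 / ‖y‖ ^ 2) (2 * ‖Z‖ ^ 2 / ‖z‖ ^ 2))

lemma Jt_norm (y Y : EE n) : Jt (fun t => ‖y + t • Y‖ ^ 2) (2 * inner ℝ y Y) (2 * ‖Y‖ ^ 2) := by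
  have := Jt_quad (‖y‖ ^ 2) (2 * inner ℝ y Y) (‖Y‖ ^ 2)
  convert this using 2 with t
  rw [norm_add_sq_real, inner_smul_right, norm_smul, mul_pow, Real.norm_eq_abs, sq_abs]
  ring

lemma psi_D2 (K M : ℝ) (x y z X Y Z : EE n) (hy : y ≠ 0) (hz : z ≠ 0) :
    D2 (fun t => psi K M (x + t • X) (y + t • Y) (z + t • Z)) (Qf K M x y z X Y Z) := by
  have hy0 : 0 < ‖y‖ ^ 2 := by positivity
  have hz0 : 0 < ‖z‖ ^ 2 := by positivity
  have jy := fun a => (Jt_norm y Y).rpow (by simpa using hy0) a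
  have jz := fun a => (Jt_norm z Z).rpow (by simpa using hz0) a
  have := ((Jt_const K).mul ((jy (7/16)).mul (jz (7/16)))).add ((Jt_const M).mul ((Jt_norm x X).mul ((jy (1/4)).mul (jz (1/4)))))
  have h2 := this.D2
  have e0 : ∀ a b : EE n, a + (0:ℝ) • b = a := fun a b => by rw [zero_smul, add_zero]
  refine (?_ : _ = Qf K M x y z X Y Z) ▸ h2
  simp only [e0, Qf, br]
  ring

lemma br_le {a p q P R : ℝ} (ha : 0 ≤ a) (ha2 : a ≤ 1/2) (hP : 0 ≤ P) (hR : 0 ≤ R) : br a p q P R ≤ (P + R) / 2 := by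
  unfold br
  have h1 : a * (P + R) ≤ (P + R) / 2 := by nlinarith
  have h2 : a * (a - 1) * (p ^ 2 + q ^ 2) + 2 * a ^ 2 * p * q = - (a * (1 - 2 * a) * (p ^ 2 + q ^ 2)) - a ^ 2 * (p - q) ^ 2 := by ring
  have h3 : 0 ≤ a * (1 - 2 * a) * (p ^ 2 + q ^ 2) := by
    have : 0 ≤ 1 - 2 * a := by linarith
    positivity
  have h4 : 0 ≤ a ^ 2 * (p - q) ^ 2 := by positivity
  linarith

lemma inner_div_le (x X y Y : EE n) (hy : y ≠ 0) :
    inner ℝ x X * (2 * inner ℝ y Y / ‖y‖ ^ 2) ≤ ‖X‖ ^ 2 + ‖x‖ ^ 2 * (‖Y‖ ^ 2 / ‖y‖ ^ 2) := by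
  have hy0 : 0 < ‖y‖ := by positivity
  have h1 := abs_real_inner_le_norm x X
  have h2 := abs_real_inner_le_norm y Y
  have h3 : |inner ℝ x X * (2 * inner ℝ y Y / ‖y‖ ^ 2)| ≤ (‖x‖ * ‖X‖) * (2 * (‖y‖ * ‖Y‖) / ‖y‖ ^ 2) := by
    rw [abs_mul, abs_div, abs_mul, abs_of_pos (by positivity : 0 < ‖y‖ ^ 2), abs_two]
    gcongr
  have h4 : (‖x‖ * ‖X‖) * (2 * (‖y‖ * ‖Y‖) / ‖y‖ ^ 2) = 2 * ‖X‖ * (‖x‖ * (‖Y‖ / ‖y‖)) := by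
    field_simp
  have h5 := two_mul_le_add_sq ‖X‖ (‖x‖ * (‖Y‖ / ‖y‖))
  rw [mul_pow, div_pow] at h5
  linarith [le_abs_self (inner ℝ x X * (2 * inner ℝ y Y / ‖y‖ ^ 2))]

lemma Qf_le {K M : ℝ} (hK : 0 ≤ K) (hM : 0 ≤ M) (x y z X Y Z : EE n) (hy : y ≠ 0) (hz : z ≠ 0) :
    Qf K M x y z X Y Z ≤ (K * ((‖y‖ ^ 2) ^ (7/16 : ℝ) * (‖z‖ ^ 2) ^ (7/16 : ℝ)) +
      2 * (M * ((‖y‖ ^ 2) ^ (1/4 : ℝ) * (‖z‖ ^ 2) ^ (1/4 : ℝ)) * ‖x‖ ^ 2)) * (‖Y‖ ^ 2 / ‖y‖ ^ 2 + ‖Z‖ ^ 2 / ‖z‖ ^ 2)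
      + 4 * (M * ((‖y‖ ^ 2) ^ (1/4 : ℝ) * (‖z‖ ^ 2) ^ (1/4 : ℝ))) * ‖X‖ ^ 2 := by
  have hP : 0 ≤ 2 * ‖Y‖ ^ 2 / ‖y‖ ^ 2 := by positivity
  have hR : 0 ≤ 2 * ‖Z‖ ^ 2 / ‖z‖ ^ 2 := by positivity
  have b1 := br_le (a := 7/16) (p := 2 * inner ℝ y Y / ‖y‖ ^ 2) (q := 2 * inner ℝ z Z / ‖z‖ ^ 2) (by norm_num) (by norm_num) hP hR
  have b2 := br_le (a := 1/4) (p := 2 * inner ℝ y Y / ‖y‖ ^ 2) (q := 2 * inner ℝ z Z / ‖z‖ ^ 2) (by norm_num) (by norm_num) hP hR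
  have i1 := inner_div_le x X y Y hy
  have i2 := inner_div_le x X z Z hz
  set A := (‖y‖ ^ 2) ^ (7/16 : ℝ) * (‖z‖ ^ 2) ^ (7/16 : ℝ) with hA
  set B := (‖y‖ ^ 2) ^ (1/4 : ℝ) * (‖z‖ ^ 2) ^ (1/4 : ℝ) with hB
  have hA0 : 0 ≤ K * A := by positivity
  have hB0 : 0 ≤ M * B := by positivity
  have e : (2 * ‖Y‖ ^ 2 / ‖y‖ ^ 2 + 2 * ‖Z‖ ^ 2 / ‖z‖ ^ 2) / 2 = ‖Y‖ ^ 2 / ‖y‖ ^ 2 + ‖Z‖ ^ 2 / ‖z‖ ^ 2 := by ring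
  rw [e] at b1 b2
  have b3 := mul_le_mul_of_nonneg_left b2 (sq_nonneg ‖x‖)
  calc Qf K M x y z X Y Z ≤ K * A * (‖Y‖ ^ 2 / ‖y‖ ^ 2 + ‖Z‖ ^ 2 / ‖z‖ ^ 2) + M * B * (2 * ‖X‖ ^ 2 +
        (‖X‖ ^ 2 + ‖x‖ ^ 2 * (‖Y‖ ^ 2 / ‖y‖ ^ 2) + (‖X‖ ^ 2 + ‖x‖ ^ 2 * (‖Z‖ ^ 2 / ‖z‖ ^ 2))) +
        ‖x‖ ^ 2 * (‖Y‖ ^ 2 / ‖y‖ ^ 2 + ‖Z‖ ^ 2 / ‖z‖ ^ 2)) := by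
        unfold Qf
        rw [mul_add (inner ℝ x X)]
        gcongr
    _ = _ := by ring

lemma Qf_y {K M : ℝ} (hM : 0 ≤ M) (x y z : EE n) (hy : y ≠ 0) :
    Qf K M x y z 0 ((‖y‖)⁻¹ • y) 0 ≤ - (7/64) * (K * ((‖y‖ ^ 2) ^ (7/16 : ℝ) * (‖z‖ ^ 2) ^ (7/16 : ℝ)) +
      (M * ((‖y‖ ^ 2) ^ (1/4 : ℝ) * (‖z‖ ^ 2) ^ (1/4 : ℝ)) * ‖x‖ ^ 2)) * (1 / ‖y‖ ^ 2) := by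
  have hy0 : 0 < ‖y‖ := by positivity
  have e1 : 2 * inner ℝ y ((‖y‖)⁻¹ • y) / ‖y‖ ^ 2 = 2 / ‖y‖ := by
    rw [inner_smul_right, real_inner_self_eq_norm_sq]; field_simp
  have e2 : ‖(‖y‖)⁻¹ • y‖ = 1 := by rw [norm_smul]; simp [hy]
  unfold Qf br
  rw [e1, e2]
  simp only [inner_zero_right, norm_zero]
  have : 0 ≤ M * ((‖y‖ ^ 2) ^ (1/4 : ℝ) * (‖z‖ ^ 2) ^ (1/4 : ℝ)) * ‖x‖ ^ 2 * (1 / ‖y‖ ^ 2) := by positivity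
  have e3 : (2 / ‖y‖) ^ 2 = 4 * (1 / ‖y‖ ^ 2) := by field_simp; norm_num
  have e4 : 2 * (1:ℝ) ^ 2 / ‖y‖ ^ 2 = 2 * (1 / ‖y‖ ^ 2) := by ring
  have z1 : 2 * (0:ℝ) / ‖z‖ ^ 2 = 0 := by simp
  have z2 : 2 * (0:ℝ) ^ 2 / ‖z‖ ^ 2 = 0 := by simp
  rw [e3, e4, z1, z2]
  generalize 1 / ‖y‖ ^ 2 = c at this ⊢
  linarith [this]

lemma Qf_swap (K M : ℝ) (x y z X Y Z : EE n) : Qf K M x y z X Y Z = Qf K M x z y X Z Y := by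
  unfold Qf br; ring

lemma trace_proj (w : EE n → ℝ) (P p : EE n) (hp : ‖p‖ = 1) :
    ∑ i, hs w P (ei i - p i • p) (ei i - p i • p) = ∑ i, hs w P (ei i) (ei i) - hs w P p p := by
  have h1 : ∀ i, hs w P (ei i - p i • p) (ei i - p i • p) = hs w P (ei i) (ei i) - p i * hs w P (ei i) p
      - p i * hs w P p (ei i) + p i ^ 2 * hs w P p p := by
    intro i; simp [hs]; ring
  simp only [h1, Finset.sum_add_distrib, Finset.sum_sub_distrib, ← Finset.sum_mul]
  have h2 : ∑ i, p i * hs w P (ei i) p = hs w P p p := by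
    conv_rhs => rw [hs]
    conv_rhs => enter [1, 2]; rw [sum_ei p]
    simp [hs]
  have h3 : ∑ i, p i * hs w P p (ei i) = hs w P p p := by
    conv_rhs => rw [hs]
    conv_rhs => enter [2]; rw [sum_ei p]
    simp [hs]
  have h4 : ∑ i, p i ^ 2 = 1 := by
    have := EuclideanSpace.real_norm_sq_eq p
    rw [hp] at this; linarith
  rw [h2, h3, h4]; ring

lemma norm_proj_le (p : EE n) (hp : ‖p‖ = 1) (i : Fin n) : ‖ei i - p i • p‖ ^ 2 ≤ 1 := by
  have : inner ℝ (ei i : EE n) p = p i := by simp [ei, EuclideanSpace.inner_single_left]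
  rw [norm_sub_sq_real, norm_ei, inner_smul_right, this, norm_smul, hp, Real.norm_eq_abs, mul_pow, sq_abs]
  nlinarith [sq_nonneg (p i)]

end MAE

open Filter Topology
namespace MAE
variable {n : ℕ}

lemma lin4 {ε C0 C1 C2 C3 b0 b1 b2 b3 q : ℝ} (h0 : |C0| ≤ ε) (h1 : |C1| ≤ ε) (h2 : |C2| ≤ ε) (h3 : |C3| ≤ ε)
    (k0 : |b0| ≤ q) (k1 : |b1| ≤ q) (k2 : |b2| ≤ q) (k3 : |b3| ≤ q) :
    C0 * b0 + C1 * b1 + C2 * b2 + C3 * b3 ≤ 4 * (ε * q) := by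
  have key : ∀ C b : ℝ, |C| ≤ ε → |b| ≤ q → C * b ≤ ε * q := fun C b h k => by
    calc C * b ≤ |C * b| := le_abs_self _
      _ = |C| * |b| := abs_mul _ _
      _ ≤ ε * q := mul_le_mul h k (abs_nonneg _) ((abs_nonneg _).trans h)
  linarith [key _ _ h0 k0, key _ _ h1 k1, key _ _ h2 k2, key _ _ h3 k3]

set_option maxHeartbeats 1600000 in
lemma dbl_core (hn : 1 ≤ n) (w : EE n → ℝ) (P1 P2 P3 P4 x y z : EE n) {K M : ℝ} (hK : 0 ≤ K) (hM : 0 ≤ M)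
    (s1 : ∀ p q, hs w P1 p q = hs w P1 q p) (s2 : ∀ p q, hs w P2 p q = hs w P2 q p)
    (s3 : ∀ p q, hs w P3 p q = hs w P3 q p) (s4 : ∀ p q, hs w P4 p q = hs w P4 q p)
    (hy : y ≠ 0) (hz : z ≠ 0)
    (hD : ∀ X Y Z : EE n, hs w P1 (X + Y + Z) (X + Y + Z) - hs w P2 (X + Y - Z) (X + Y - Z)
      - hs w P3 (X - Y + Z) (X - Y + Z) + hs w P4 (X - Y - Z) (X - Y - Z) ≤ Qf K M x y z X Y Z)
    (a1 a2 a3 a4 : Fin n → Fin n → ℝ)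
    (ha1 : ∀ i j, |a1 i j| ≤ 1 / (1000 * n ^ 2)) (ha2 : ∀ i j, |a2 i j| ≤ 1 / (1000 * n ^ 2))
    (ha3 : ∀ i j, |a3 i j| ≤ 1 / (1000 * n ^ 2)) (ha4 : ∀ i j, |a4 i j| ≤ 1 / (1000 * n ^ 2))
    (hL1 : |∑ i, hs w P1 (ei i) (ei i) + ∑ i, ∑ j, a1 i j * hs w P1 (ei i) (ei j)| ≤ 1)
    (hL2 : |∑ i, hs w P2 (ei i) (ei i) + ∑ i, ∑ j, a2 i j * hs w P2 (ei i) (ei j)| ≤ 1)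
    (hL3 : |∑ i, hs w P3 (ei i) (ei i) + ∑ i, ∑ j, a3 i j * hs w P3 (ei i) (ei j)| ≤ 1)
    (hL4 : |∑ i, hs w P4 (ei i) (ei i) + ∑ i, ∑ j, a4 i j * hs w P4 (ei i) (ei j)| ≤ 1) :
    (1/50) * (K * ((‖y‖ ^ 2) ^ (7/16 : ℝ) * (‖z‖ ^ 2) ^ (7/16 : ℝ)) * (1 / ‖y‖ ^ 2 + 1 / ‖z‖ ^ 2)) ≤
      4 + (4 * n + 1) * (M * ((‖y‖ ^ 2) ^ (1/4 : ℝ) * (‖z‖ ^ 2) ^ (1/4 : ℝ))) := by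
  have hQ := fun X Y Z => Qf_le hK hM x y z X Y Z hy hz
  have hQy := Qf_y (K := K) hM x y z hy
  have hQz := Qf_y (K := K) hM x z y hz
  rw [mul_comm ((‖z‖ ^ 2) ^ (7/16 : ℝ)), mul_comm ((‖z‖ ^ 2) ^ (1/4 : ℝ)), ← Qf_swap] at hQz
  set MB := M * ((‖y‖ ^ 2) ^ (1/4 : ℝ) * (‖z‖ ^ 2) ^ (1/4 : ℝ)) with hMB
  have hMB0 : 0 ≤ MB := by positivity
  set T1 := K * ((‖y‖ ^ 2) ^ (7/16 : ℝ) * (‖z‖ ^ 2) ^ (7/16 : ℝ)) with hT1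
  have hT10 : 0 ≤ T1 := by positivity
  set T2 := MB * ‖x‖ ^ 2 with hT2
  have hT20 : 0 ≤ T2 := by positivity
  have hy0 : 0 ≤ 1 / ‖y‖ ^ 2 := by positivity
  have hz0 : 0 ≤ 1 / ‖z‖ ^ 2 := by positivity
  set Wy := 1 / ‖y‖ ^ 2 with hWy
  set Wz := 1 / ‖z‖ ^ 2 with hWz
  have hQ' : ∀ X Y Z : EE n, ‖X‖ ^ 2 ≤ 4 → ‖Y‖ ^ 2 ≤ 1 → ‖Z‖ ^ 2 ≤ 1 →
      Qf K M x y z X Y Z ≤ 2 * (T1 + T2) * (Wy + Wz) + 16 * MB := by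
    intro X Y Z hX hY hZ
    refine (hQ X Y Z).trans ?_
    have e1 : ‖Y‖ ^ 2 / ‖y‖ ^ 2 ≤ Wy := by rw [hWy]; gcongr
    have e2 : ‖Z‖ ^ 2 / ‖z‖ ^ 2 ≤ Wz := by rw [hWz]; gcongr
    have e3 : (T1 + 2 * T2) * (‖Y‖ ^ 2 / ‖y‖ ^ 2 + ‖Z‖ ^ 2 / ‖z‖ ^ 2) ≤ (2 * (T1 + T2)) * (Wy + Wz) := by
      gcongr; linarith
    have e4 := mul_le_mul_of_nonneg_left hX (by positivity : 0 ≤ 4 * MB)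
    linarith only [e3, e4]
  set h : EE n → ℝ := fun p => hs w P1 p p - hs w P2 p p - hs w P3 p p + hs w P4 p p with hh
  have hX : ∀ p, h p ≤ Qf K M x y z p 0 0 := fun p => by simpa [hh] using hD p 0 0
  have hY : ∀ p, h p ≤ Qf K M x y z 0 p 0 := fun p => by simpa [hh, hs] using hD 0 p 0
  have hZ : ∀ p, h p ≤ Qf K M x y z 0 0 p := fun p => by simpa [hh, hs] using hD 0 0 p
  set Qm := 2 * (T1 + T2) * (Wy + Wz) + 16 * MB with hQm
  set g1 := fun i j => hs w P1 (ei i) (ei j) with hg1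
  set g2 := fun i j => hs w P2 (ei i) (ei j) with hg2
  set g3 := fun i j => hs w P3 (ei i) (ei j) with hg3
  set g4 := fun i j => hs w P4 (ei i) (ei j) with hg4
  have n1 : ∀ i, ‖(ei i : EE n)‖ ^ 2 ≤ 1 := fun i => by rw [norm_ei]; norm_num
  have n1' : ∀ i, ‖(ei i : EE n)‖ ^ 2 ≤ 4 := fun i => by rw [norm_ei]; norm_num
  have nn : ∀ i, ‖-(ei i : EE n)‖ ^ 2 ≤ 1 := fun i => by rw [norm_neg, norm_ei]; norm_num
  have n0 : ‖(0:EE n)‖ ^ 2 ≤ 4 := by simp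
  have n0' : ‖(0:EE n)‖ ^ 2 ≤ 1 := by simp
  have n2 : ∀ i j, ‖(ei i : EE n) + ei j‖ ^ 2 ≤ 4 := fun i j => by
    have := norm_add_le (ei i : EE n) (ei j); rw [norm_ei, norm_ei] at this
    exact (pow_le_pow_left₀ (norm_nonneg _) this 2).trans (by norm_num)
  have n3 : ∀ i j, ‖(ei i : EE n) - ei j‖ ^ 2 ≤ 4 := fun i j => by
    have := norm_sub_le (ei i : EE n) (ei j); rw [norm_ei, norm_ei] at this
    exact (pow_le_pow_left₀ (norm_nonneg _) this 2).trans (by norm_num)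
  have hS : ∀ i j, a1 i j * g1 i j - a2 i j * g2 i j - a3 i j * g3 i j + a4 i j * g4 i j
      ≤ 4 * (1 / (1000 * n ^ 2) * ((Qm - h (ei i) - h (ei j)) / 2)) := by
    intro i j
    have b0 : |g1 i j - g2 i j - g3 i j + g4 i j| ≤ (Qm - h (ei i) - h (ei j)) / 2 := by
      have u1 := (hD (ei i + ei j) 0 0).trans (hQ' _ _ _ (n2 i j) n0' n0')
      have u2 := (hD (ei i - ei j) 0 0).trans (hQ' _ _ _ (n3 i j) n0' n0')
      simp [hs] at u1 u2
      have q1 := s1 (ei j) (ei i); have q2 := s2 (ei j) (ei i); have q3 := s3 (ei j) (ei i); have q4 := s4 (ei j) (ei i)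
      simp only [hs] at q1 q2 q3 q4
      simp only [hh, hg1, hg2, hg3, hg4, hs, abs_le]
      constructor <;> linarith
    have b1 : |g1 i j - g2 i j + g3 i j - g4 i j| ≤ (Qm - h (ei i) - h (ei j)) / 2 := by
      have u1 := (hD (ei i) (ei j) 0).trans (hQ' _ _ _ (n1' i) (n1 j) n0')
      have u2 := (hD (ei i) (-ei j) 0).trans (hQ' _ _ _ (n1' i) (nn j) n0')
      simp [hs] at u1 u2
      have q1 := s1 (ei j) (ei i); have q2 := s2 (ei j) (ei i); have q3 := s3 (ei j) (ei i); have q4 := s4 (ei j) (ei i)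
      simp only [hs] at q1 q2 q3 q4
      simp only [hh, hg1, hg2, hg3, hg4, hs, abs_le]
      constructor <;> linarith
    have b2 : |g1 i j + g2 i j - g3 i j - g4 i j| ≤ (Qm - h (ei i) - h (ei j)) / 2 := by
      have u1 := (hD (ei i) 0 (ei j)).trans (hQ' _ _ _ (n1' i) n0' (n1 j))
      have u2 := (hD (ei i) 0 (-ei j)).trans (hQ' _ _ _ (n1' i) n0' (nn j))
      simp [hs] at u1 u2
      have q1 := s1 (ei j) (ei i); have q2 := s2 (ei j) (ei i); have q3 := s3 (ei j) (ei i); have q4 := s4 (ei j) (ei i)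
      simp only [hs] at q1 q2 q3 q4
      simp only [hh, hg1, hg2, hg3, hg4, hs, abs_le]
      constructor <;> linarith
    have b3 : |g1 i j + g2 i j + g3 i j + g4 i j| ≤ (Qm - h (ei i) - h (ei j)) / 2 := by
      have u1 := (hD 0 (ei i) (ei j)).trans (hQ' _ _ _ n0 (n1 i) (n1 j))
      have u2 := (hD 0 (ei i) (-ei j)).trans (hQ' _ _ _ n0 (n1 i) (nn j))
      simp [hs] at u1 u2
      have q1 := s1 (ei j) (ei i); have q2 := s2 (ei j) (ei i); have q3 := s3 (ei j) (ei i); have q4 := s4 (ei j) (ei i)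
      simp only [hs] at q1 q2 q3 q4
      simp only [hh, hg1, hg2, hg3, hg4, hs, abs_le]
      constructor <;> linarith
    have A1 := abs_le.1 (ha1 i j)
    have A2 := abs_le.1 (ha2 i j)
    have A3 := abs_le.1 (ha3 i j)
    have A4 := abs_le.1 (ha4 i j)
    have := lin4 (C0 := (a1 i j + a2 i j + a3 i j + a4 i j) / 4) (C1 := (a1 i j + a2 i j - a3 i j - a4 i j) / 4)
      (C2 := (a1 i j - a2 i j + a3 i j - a4 i j) / 4) (C3 := (a1 i j - a2 i j - a3 i j + a4 i j) / 4)
      (ε := 1 / (1000 * n ^ 2))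
      (by rw [abs_le]; constructor <;> linarith) (by rw [abs_le]; constructor <;> linarith)
      (by rw [abs_le]; constructor <;> linarith) (by rw [abs_le]; constructor <;> linarith) b0 b1 b2 b3
    refine le_trans (le_of_eq ?_) this
    ring
  set H := ∑ i, h (ei i) with hH
  have hHe : H = ∑ i, g1 i i - ∑ i, g2 i i - ∑ i, g3 i i + ∑ i, g4 i i := by
    simp only [hH, hh, hg1, hg2, hg3, hg4, Finset.sum_add_distrib, Finset.sum_sub_distrib]
  have hsum : ∑ i, ∑ j, (a1 i j * g1 i j - a2 i j * g2 i j - a3 i j * g3 i j + a4 i j * g4 i j)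
      ≤ ∑ i, ∑ j, 4 * (1 / (1000 * n ^ 2) * ((Qm - h (ei i) - h (ei j)) / 2)) :=
    Finset.sum_le_sum fun i _ => Finset.sum_le_sum fun j _ => hS i j
  have hn0 : (1:ℝ) ≤ n := by exact_mod_cast hn
  have hr : ∑ i : Fin n, ∑ j : Fin n, 4 * (1 / (1000 * (n:ℝ) ^ 2) * ((Qm - h (ei i) - h (ei j)) / 2)) =
      Qm / 500 - H / (250 * n) := by
    simp only [← Finset.mul_sum, ← Finset.sum_div, Finset.sum_sub_distrib, Finset.sum_const, Finset.card_univ, Fintype.card_fin, nsmul_eq_mul, ← hH]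
    field_simp
    ring
  rw [hr] at hsum
  simp only [Finset.sum_add_distrib, Finset.sum_sub_distrib] at hsum
  have proj : ∀ p : EE n, ‖p‖ = 1 → ∀ c, h p ≤ c → H ≤ c + n * (4 * MB) := by
    intro p hp c hc
    have e : ∑ i, h (ei i - p i • p) = H - h p := by
      have t1 := trace_proj w P1 p hp; have t2 := trace_proj w P2 p hp
      have t3 := trace_proj w P3 p hp; have t4 := trace_proj w P4 p hp
      simp only [hh, Finset.sum_add_distrib, Finset.sum_sub_distrib, t1, t2, t3, t4, hHe, hg1, hg2, hg3, hg4]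
      ring
    have : ∑ i, h (ei i - p i • p) ≤ ∑ i : Fin n, 4 * MB := Finset.sum_le_sum fun i _ => by
      refine (hX _).trans ((hQ _ _ _).trans ?_)
      have := norm_proj_le p hp i
      simp only [norm_zero]
      have e5 : (T1 + 2 * T2) * ((0:ℝ) ^ 2 / ‖y‖ ^ 2 + 0 ^ 2 / ‖z‖ ^ 2) = 0 := by simp
      rw [e5]
      have e4 := mul_le_mul_of_nonneg_left this (by positivity : 0 ≤ 4 * MB)
      linarith only [e4]
    simp at this
    linarith
  have unit : ∀ v : EE n, v ≠ 0 → ‖(‖v‖)⁻¹ • v‖ = 1 := fun v hv => by rw [norm_smul]; simp [hv]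
  have p1 := proj _ (unit y hy) _ ((hY _).trans hQy)
  have p2 := proj _ (unit z hz) _ ((hZ _).trans (by simpa [Qf_swap] using hQz))
  have L1 := abs_le.1 hL1; have L2 := abs_le.1 hL2; have L3 := abs_le.1 hL3; have L4 := abs_le.1 hL4
  have fin1 : -4 ≤ H * (1 - 1 / (250 * n)) + Qm / 500 := by
    have : H * (1 - 1 / (250 * n)) = H - H / (250 * n) := by ring
    rw [this]
    have e1 := hHe
    simp only [hg1, hg2, hg3, hg4] at e1 hsum
    linarith [L1.1, L2.2, L3.2, L4.1]
  have hθ : 1 / (250 * (n:ℝ)) ≤ 1/250 := by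
    apply div_le_div_of_nonneg_left <;> linarith
  have hθ0 : 0 ≤ 1 / (250 * (n:ℝ)) := by positivity
  set TW := (T1 + T2) * (Wy + Wz) with hTW
  have hTW1 : T1 * (Wy + Wz) ≤ TW := by rw [hTW]; gcongr; linarith
  have hTW0 : 0 ≤ TW := by positivity
  have hH2 : H ≤ -(7/128) * TW + 4 * n * MB := by rw [hTW]; linarith
  have hnM : 0 ≤ n * MB := by positivity
  have : H * (1 - 1 / (250 * n)) ≤ (-(7/128) * TW + 4 * n * MB) * (1 - 1 / (250 * n)) :=
    mul_le_mul_of_nonneg_right hH2 (by linarith)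
  have hQm' : Qm = 2 * TW + 16 * MB := by rw [hQm, hTW]; ring
  have k1 : TW * (1 / (250 * n)) ≤ TW * (1/250) := by gcongr
  have k2 : 0 ≤ n * MB * (1 / (250 * n)) := by positivity
  have k3 : (-(7/128) * TW + 4 * n * MB) * (1 - 1 / (250 * n)) =
    -(7/128) * TW + 4 * (n * MB) + 7/128 * (TW * (1 / (250 * n))) - 4 * (n * MB * (1 / (250 * n))) := by ring
  rw [k3] at this
  linarith only [this, k1, k2, hTW0, hTW1, hMB0, fin1, hQm']

end MAE

open Filter Topology Metric
namespace MAE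
variable {n : ℕ}

lemma sq_rpow_mul {s t : ℝ} (hs : 0 ≤ s) (ht : 0 ≤ t) (a : ℝ) : (s ^ 2) ^ a * (t ^ 2) ^ a = (s * t) ^ (2 * a) := by
  rw [← Real.mul_rpow (by positivity) (by positivity), ← mul_pow, ← Real.rpow_natCast, ← Real.rpow_mul (by positivity)]
  norm_num

noncomputable def Ph (w : EE n → ℝ) (x0 x y z : EE n) : ℝ :=
  w (x0 + x + y + z) - w (x0 + x + y - z) - w (x0 + x - y + z) + w (x0 + x - y - z)

lemma mem4 {r : ℝ} {x0 x y z : EE n} (hr : 0 < r) (hx : ‖x‖ ≤ r) (hy : ‖y‖ ≤ r) (hz : ‖z‖ ≤ r) :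
    x0 + x + y + z ∈ ball x0 (4*r) := by
  rw [mem_ball, dist_eq_norm, show x0 + x + y + z - x0 = x + y + z by abel]
  have := norm_add_le (x+y) z
  have := norm_add_le x y
  linarith

lemma Ph_le {w : EE n → ℝ} {x0 x y z : EE n} {r : ℝ} (hr : 0 < r)
    (hL : ∀ p ∈ ball x0 (4*r), ∀ q ∈ ball x0 (4*r), |w p - w q| ≤ ‖p - q‖)
    (hx : ‖x‖ ≤ r) (hy : ‖y‖ ≤ r) (hz : ‖z‖ ≤ r) : Ph w x0 x y z ≤ 4 * ‖y‖ ∧ Ph w x0 x y z ≤ 4 * ‖z‖ := by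
  have hy' : ‖-y‖ ≤ r := by rwa [norm_neg]
  have hz' : ‖-z‖ ≤ r := by rwa [norm_neg]
  have m1 := mem4 (x0 := x0) hr hx hy hz
  have m2 := mem4 (x0 := x0) hr hx hy hz'
  have m3 := mem4 (x0 := x0) hr hx hy' hz
  have m4 := mem4 (x0 := x0) hr hx hy' hz'
  simp only [← sub_eq_add_neg] at m1 m2 m3 m4
  have c := fun (v : EE n) => (norm_smul (2:ℝ) v)
  simp only [Real.norm_ofNat] at c
  have l13 := hL _ m1 _ m3
  have l24 := hL _ m4 _ m2
  have l12 := hL _ m1 _ m2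
  have l34 := hL _ m4 _ m3
  rw [show x0 + x + y + z - (x0 + x - y + z) = (2:ℝ) • y by module, c] at l13
  rw [show x0 + x - y - z - (x0 + x + y - z) = -((2:ℝ) • y) by module, norm_neg, c] at l24
  rw [show x0 + x + y + z - (x0 + x + y - z) = (2:ℝ) • z by module, c] at l12
  rw [show x0 + x - y - z - (x0 + x - y + z) = -((2:ℝ) • z) by module, norm_neg, c] at l34
  rw [abs_le] at *
  unfold Ph
  constructor <;> linarith

lemma doubling1 (hn : 1 ≤ n) {r : ℝ} (hr : 0 < r) : ∃ K : ℝ, 0 < K ∧ ∀ (x0 : EE n) (w : EE n → ℝ),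
    (∀ p ∈ ball x0 (4*r), ContDiffAt ℝ 2 w p) →
    (∀ p ∈ ball x0 (4*r), ∀ q ∈ ball x0 (4*r), |w p - w q| ≤ ‖p - q‖) →
    (∀ p ∈ ball x0 (4*r), ∃ a : Fin n → Fin n → ℝ, (∀ i j, |a i j| ≤ 1 / (1000 * n ^ 2)) ∧
      |∑ i, hs w p (ei i) (ei i) + ∑ i, ∑ j, a i j * hs w p (ei i) (ei j)| ≤ 1) →
    ∀ y : EE n, ‖y‖ ≤ r → w (x0 + (2:ℝ) • y) + w (x0 - (2:ℝ) • y) - 2 * w x0 ≤ K * ‖y‖ ^ (7/4 : ℝ) := by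
  set K : ℝ := 4 * r ^ (-(3/4) : ℝ) + 25 * r ^ (1/4 : ℝ) * (5 + (4 * n + 1) * (4 / r)) with hK
  have hr1 : 0 < r ^ (-(3/4) : ℝ) := by positivity
  have hr2 : 0 < r ^ (1/4 : ℝ) := by positivity
  have hK1 : 4 * r ^ (-(3/4) : ℝ) ≤ K := by rw [hK]; have : 0 ≤ 25 * r ^ (1/4 : ℝ) * (5 + (4 * n + 1) * (4 / r)) := by positivity
                                            linarith
  have hK2 : 25 * r ^ (1/4 : ℝ) * (5 + (4 * n + 1) * (4 / r)) ≤ K := by rw [hK]; linarith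
  have hK0 : 0 < K := by linarith
  refine ⟨K, hK0, fun x0 w hC hL hE => ?_⟩
  clear_value K
  set M : ℝ := 4 / r ^ 2 with hM
  have hM0 : 0 < M := by positivity
  set f : EE n × EE n × EE n → ℝ := fun p => Ph w x0 p.1 p.2.1 p.2.2 - psi K M p.1 p.2.1 p.2.2 with hf
  set S : Set (EE n × EE n × EE n) := closedBall 0 r ×ˢ closedBall 0 r ×ˢ closedBall 0 r with hS
  have hmem : ∀ p ∈ S, ‖p.1‖ ≤ r ∧ ‖p.2.1‖ ≤ r ∧ ‖p.2.2‖ ≤ r := fun p hp => by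
    simpa [hS] using hp
  have hSc : IsCompact S := (isCompact_closedBall _ _).prod ((isCompact_closedBall _ _).prod (isCompact_closedBall _ _))
  have hwc : ContinuousOn w (ball x0 (4*r)) := fun p hp => (hC p hp).continuousAt.continuousWithinAt
  have hfc : ContinuousOn f S := by
    refine ContinuousOn.sub ?_ ?_
    · refine ((ContinuousOn.sub ?_ ?_).sub ?_).add ?_
      · exact hwc.comp (by fun_prop) fun p hp => mem4 hr (hmem p hp).1 (hmem p hp).2.1 (hmem p hp).2.2
      · refine hwc.comp (by fun_prop) fun p hp => ?_
        rw [sub_eq_add_neg]; exact mem4 hr (hmem p hp).1 (hmem p hp).2.1 (by rw [norm_neg]; exact (hmem p hp).2.2)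
      · refine hwc.comp (by fun_prop) fun p hp => ?_
        rw [sub_eq_add_neg]; exact mem4 hr (hmem p hp).1 (by rw [norm_neg]; exact (hmem p hp).2.1) (hmem p hp).2.2
      · refine hwc.comp (by fun_prop) fun p hp => ?_
        simp only [sub_eq_add_neg]; exact mem4 hr (hmem p hp).1 (by rw [norm_neg]; exact (hmem p hp).2.1) (by rw [norm_neg]; exact (hmem p hp).2.2)
    · have c1 : ∀ a : ℝ, 0 ≤ a → Continuous fun p : EE n × EE n × EE n => (‖p.2.1‖ ^ 2) ^ a := fun a ha =>
        Continuous.rpow_const (by fun_prop) fun _ => Or.inr ha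
      have c2 : ∀ a : ℝ, 0 ≤ a → Continuous fun p : EE n × EE n × EE n => (‖p.2.2‖ ^ 2) ^ a := fun a ha =>
        Continuous.rpow_const (by fun_prop) fun _ => Or.inr ha
      have c3 : Continuous fun p : EE n × EE n × EE n => ‖p.1‖ ^ 2 := by fun_prop
      exact ((continuous_const.mul ((c1 _ (by norm_num)).mul (c2 _ (by norm_num)))).add
        (continuous_const.mul (c3.mul ((c1 _ (by norm_num)).mul (c2 _ (by norm_num)))))).continuousOn
  obtain ⟨⟨x, y, z⟩, hp, hmax⟩ := hSc.exists_isMaxOn ⟨(0,0,0), by simp [hS, hr.le]⟩ hfc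
  have hneg : f (x, y, z) ≤ 0 := by
    by_contra! hpos
    obtain ⟨hx, hy, hz⟩ := hmem _ hp
    simp only at hx hy hz
    have hpos' : psi K M x y z < Ph w x0 x y z := by simpa [hf] using hpos
    have hy0 : y ≠ 0 := by
      rintro rfl
      simp [psi, Ph] at hpos'
    have hz0 : z ≠ 0 := by
      rintro rfl
      simp [psi, Ph] at hpos'
    have ny : 0 < ‖y‖ := by positivity
    have nz : 0 < ‖z‖ := by positivity
    obtain ⟨pl1, pl2⟩ := Ph_le hr hL hx hy hz
    have eA := sq_rpow_mul ny.le nz.le (7/16)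
    have eB := sq_rpow_mul ny.le nz.le (1/4)
    norm_num at eA eB
    have hA0 : 0 < (‖y‖ * ‖z‖) ^ (7/8 : ℝ) := by positivity
    have hB0 : 0 < (‖y‖ * ‖z‖) ^ (1/2 : ℝ) := by positivity
    have hpsi : psi K M x y z = K * (‖y‖ * ‖z‖) ^ (7/8 : ℝ) + M * (‖x‖ ^ 2 * (‖y‖ * ‖z‖) ^ (1/2 : ℝ)) := by
      rw [psi, eA, eB]
    rw [hpsi] at hpos'
    have hx' : ‖x‖ < r := by
      by_contra! h
      have : ‖x‖ = r := le_antisymm hx h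
      rw [this] at hpos'
      have e : M * (r ^ 2 * (‖y‖ * ‖z‖) ^ (1/2 : ℝ)) = 4 * (‖y‖ * ‖z‖) ^ (1/2 : ℝ) := by rw [hM]; field_simp
      rw [e, ← Real.sqrt_eq_rpow] at hpos'
      have : min ‖y‖ ‖z‖ ≤ √(‖y‖ * ‖z‖) := by
        apply Real.le_sqrt_of_sq_le
        rw [sq]; exact mul_le_mul (min_le_left _ _) (min_le_right _ _) (by positivity) (by positivity)
      have h3 : Ph w x0 x y z ≤ 4 * min ‖y‖ ‖z‖ := by
        rcases min_choice ‖y‖ ‖z‖ with h | h <;> rw [h] <;> assumption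
      have : 0 < K * (‖y‖ * ‖z‖) ^ (7/8 : ℝ) := by positivity
      linarith
    have hbd : ∀ t : ℝ, 0 < t → t ≤ r → 4 * t ≤ K * (r * t) ^ (7/8 : ℝ) := by
      intro t ht htr
      have e1 : (r * t) ^ (7/8 : ℝ) = r ^ (7/8:ℝ) * (t * t ^ (-(1/8) : ℝ)) := by
        rw [Real.mul_rpow hr.le ht.le]
        congr 1
        nth_rewrite 2 [← Real.rpow_one t]
        rw [← Real.rpow_add ht]; norm_num
      have e2 : r ^ (-(1/8) : ℝ) ≤ t ^ (-(1/8) : ℝ) := Real.rpow_le_rpow_of_nonpos ht htr (by norm_num)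
      have e3 : r ^ (-(3/4) : ℝ) * (r ^ (7/8 : ℝ) * r ^ (-(1/8) : ℝ)) = 1 := by
        rw [← Real.rpow_add hr, ← Real.rpow_add hr]; norm_num
      calc 4 * t = (4 * r ^ (-(3/4) : ℝ)) * (r ^ (7/8 : ℝ) * (t * r ^ (-(1/8) : ℝ))) := by linear_combination (-4 * t) * e3
        _ ≤ K * (r ^ (7/8 : ℝ) * (t * t ^ (-(1/8) : ℝ))) := by gcongr
        _ = _ := by rw [e1]
    have hxB : 0 ≤ M * (‖x‖ ^ 2 * (‖y‖ * ‖z‖) ^ (1/2 : ℝ)) := by positivity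
    have hy' : ‖y‖ < r := by
      by_contra! h
      have : ‖y‖ = r := le_antisymm hy h
      have h2 := hbd ‖z‖ nz hz
      rw [this] at hpos' hxB
      linarith
    have hz' : ‖z‖ < r := by
      by_contra! h
      have : ‖z‖ = r := le_antisymm hz h
      have h2 := hbd ‖y‖ ny hy
      rw [mul_comm r] at h2
      rw [this] at hpos' hxB
      linarith
    have hyn : ‖-y‖ ≤ r := by rwa [norm_neg]
    have hzn : ‖-z‖ ≤ r := by rwa [norm_neg]
    have m1 := mem4 (x0 := x0) hr hx hy hz
    have m2 := mem4 (x0 := x0) hr hx hy hzn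
    have m3 := mem4 (x0 := x0) hr hx hyn hz
    have m4 := mem4 (x0 := x0) hr hx hyn hzn
    simp only [← sub_eq_add_neg] at m1 m2 m3 m4
    have hD : ∀ X Y Z : EE n, hs w (x0 + x + y + z) (X + Y + Z) (X + Y + Z) - hs w (x0 + x + y - z) (X + Y - Z) (X + Y - Z)
      - hs w (x0 + x - y + z) (X - Y + Z) (X - Y + Z) + hs w (x0 + x - y - z) (X - Y - Z) (X - Y - Z) ≤ Qf K M x y z X Y Z := by
      intro X Y Z
      have d := ((((D2_line (hC _ m1) (X + Y + Z)).sub (D2_line (hC _ m2) (X + Y - Z))).sub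
        (D2_line (hC _ m3) (X - Y + Z))).add (D2_line (hC _ m4) (X - Y - Z))).sub (psi_D2 K M x y z X Y Z hy0 hz0)
      have := d.nonpos_of_max ?_
      · linarith
      have hcl : ∀ v V : EE n, ‖v‖ < r → ∀ᶠ t in 𝓝 (0:ℝ), ‖v + t • V‖ ≤ r := by
        intro v V hv
        have : Continuous fun t : ℝ => ‖v + t • V‖ := by fun_prop
        have := this.continuousAt.eventually_lt (x₀ := (0:ℝ)) continuousAt_const (g := fun _ => r) (by simpa using hv)
        filter_upwards [this] with t ht using ht.le
      filter_upwards [hcl x X hx', hcl y Y hy', hcl z Z hz'] with t h1 h2 h3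
      have : f (x + t • X, y + t • Y, z + t • Z) ≤ f (x, y, z) :=
        hmax (show (x + t • X, y + t • Y, z + t • Z) ∈ S by simpa [hS] using ⟨h1, h2, h3⟩)
      simp only [hf, Ph] at this
      simp only [zero_smul, add_zero]
      rw [show x0 + x + y + z + t • (X + Y + Z) = x0 + (x + t • X) + (y + t • Y) + (z + t • Z) by module,
        show x0 + x + y - z + t • (X + Y - Z) = x0 + (x + t • X) + (y + t • Y) - (z + t • Z) by module,
        show x0 + x - y + z + t • (X - Y + Z) = x0 + (x + t • X) - (y + t • Y) + (z + t • Z) by module,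
        show x0 + x - y - z + t • (X - Y - Z) = x0 + (x + t • X) - (y + t • Y) - (z + t • Z) by module]
      exact this
    obtain ⟨a1, ha1, l1⟩ := hE _ m1
    obtain ⟨a2, ha2, l2⟩ := hE _ m2
    obtain ⟨a3, ha3, l3⟩ := hE _ m3
    obtain ⟨a4, ha4, l4⟩ := hE _ m4
    have core := dbl_core hn w _ _ _ _ x y z hK0.le hM0.le (hs_symm (hC _ m1)) (hs_symm (hC _ m2))
      (hs_symm (hC _ m3)) (hs_symm (hC _ m4)) hy0 hz0 hD a1 a2 a3 a4 ha1 ha2 ha3 ha4 l1 l2 l3 l4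
    rw [eA, eB] at core
    have hyz : ‖y‖ * ‖z‖ ≤ r ^ 2 := by rw [sq]; exact mul_le_mul hy hz nz.le hr.le
    have hB : (‖y‖ * ‖z‖) ^ (1/2 : ℝ) ≤ r := by
      rw [← Real.sqrt_eq_rpow]; exact Real.sqrt_le_iff.2 ⟨hr.le, hyz⟩
    have hW : 2 * (‖y‖ * ‖z‖)⁻¹ ≤ 1 / ‖y‖ ^ 2 + 1 / ‖z‖ ^ 2 := by
      have := two_mul_le_add_sq (‖y‖⁻¹) (‖z‖⁻¹)
      rw [mul_inv, one_div, one_div, ← inv_pow, ← inv_pow]; linarith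
    have hAW : r ^ (-(1/4) : ℝ) ≤ (‖y‖ * ‖z‖) ^ (7/8 : ℝ) * (‖y‖ * ‖z‖)⁻¹ := by
      have hyz0 : 0 < ‖y‖ * ‖z‖ := by positivity
      rw [← Real.rpow_neg_one, ← Real.rpow_add hyz0]
      calc r ^ (-(1/4) : ℝ) = (r ^ 2) ^ (7/8 + -1 : ℝ) := by
            rw [← Real.rpow_natCast, ← Real.rpow_mul hr.le]; norm_num
        _ ≤ _ := Real.rpow_le_rpow_of_nonpos hyz0 hyz (by norm_num)
    have e3 : r ^ (1/4 : ℝ) * r ^ (-(1/4) : ℝ) = 1 := by rw [← Real.rpow_add hr]; norm_num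
    have c1 : 5 + (4 * n + 1) * (4 / r) ≤ (1/50) * (K * (‖y‖ * ‖z‖) ^ (7/8 : ℝ) * (1 / ‖y‖ ^ 2 + 1 / ‖z‖ ^ 2)) := by
      calc 5 + (4 * n + 1) * (4 / r) = (1/50) * ((25 * r ^ (1/4 : ℝ) * (5 + (4 * n + 1) * (4 / r))) * (2 * r ^ (-(1/4) : ℝ))) := by
            linear_combination (-(5 + (4 * n + 1) * (4 / r))) * e3
        _ ≤ (1/50) * (K * (2 * ((‖y‖ * ‖z‖) ^ (7/8 : ℝ) * (‖y‖ * ‖z‖)⁻¹))) := by gcongr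
        _ = (1/50) * (K * (‖y‖ * ‖z‖) ^ (7/8 : ℝ) * (2 * (‖y‖ * ‖z‖)⁻¹)) := by ring
        _ ≤ _ := by gcongr
    have c2 : (4 * n + 1) * (M * (‖y‖ * ‖z‖) ^ (1/2 : ℝ)) ≤ (4 * n + 1) * (4 / r) := by
      calc (4 * (n:ℝ) + 1) * (M * (‖y‖ * ‖z‖) ^ (1/2 : ℝ)) ≤ (4 * n + 1) * (M * r) := by gcongr
        _ = _ := by rw [hM]; field_simp
    linarith
  intro v hv
  have := (hmax (show ((0:EE n), v, v) ∈ S by simpa [hS] using ⟨hr.le, hv⟩)).trans hneg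
  simp only [hf, Ph, psi] at this
  rw [sq_rpow_mul (norm_nonneg _) (norm_nonneg _), ← sq, ← Real.rpow_natCast, ← Real.rpow_mul (norm_nonneg _)] at this
  norm_num at this
  rw [show x0 + v + v = x0 + (2:ℝ) • v by module, show x0 - v - v = x0 - (2:ℝ) • v by module] at this
  norm_num
  linarith

lemma hs_neg (w : EE n → ℝ) (x p q : EE n) : hs (fun y => - w y) x p q = - hs w x p q := by
  unfold hs
  have : fderiv ℝ (fun y => - w y) = fun x => - fderiv ℝ w x := by ext1 x; rw [fderiv_fun_neg]
  rw [this, fderiv_fun_neg]; simp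

lemma hs_const_mul {w : EE n → ℝ} {x : EE n} (h : ContDiffAt ℝ 2 w x) (p q : EE n) (c : ℝ) : hs (fun y => c * w y) x p q = c * hs w x p q := by
  unfold hs
  have : fderiv ℝ (fun y => c * w y) = c • fderiv ℝ w := fderiv_const_smul_field c
  have h1 : DifferentiableAt ℝ (fderiv ℝ w) x :=
    (h.fderiv_right (m := 1) (by norm_num)).differentiableAt (by simp)
  rw [this, fderiv_const_smul h1]; simp

lemma doubling (hn : 1 ≤ n) {r : ℝ} (hr : 0 < r) : ∃ K : ℝ, 0 < K ∧ ∀ (x0 : EE n) (w : EE n → ℝ) (L : ℝ), 0 < L →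
    (∀ p ∈ ball x0 (4*r), ContDiffAt ℝ 2 w p) →
    (∀ p ∈ ball x0 (4*r), ∀ q ∈ ball x0 (4*r), |w p - w q| ≤ L * ‖p - q‖) →
    (∀ p ∈ ball x0 (4*r), ∃ a : Fin n → Fin n → ℝ, (∀ i j, |a i j| ≤ 1 / (1000 * n ^ 2)) ∧
      |∑ i, hs w p (ei i) (ei i) + ∑ i, ∑ j, a i j * hs w p (ei i) (ei j)| ≤ L) →
    ∀ y : EE n, ‖y‖ ≤ r → |w (x0 + (2:ℝ) • y) + w (x0 - (2:ℝ) • y) - 2 * w x0| ≤ K * L * ‖y‖ ^ (7/4 : ℝ) := by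
  obtain ⟨K, hK, h⟩ := doubling1 hn hr
  refine ⟨K, hK, fun x0 w L hL hC hLip hE y hy => ?_⟩
  have main : ∀ c : ℝ, |c| = L⁻¹ → c * w (x0 + (2:ℝ) • y) + c * w (x0 - (2:ℝ) • y) - 2 * (c * w x0) ≤ K * ‖y‖ ^ (7/4 : ℝ) := by
    intro c hc
    refine h x0 (fun y => c * w y) (fun p hp => contDiffAt_const.mul (hC p hp)) (fun p hp q hq => ?_) (fun p hp => ?_) y hy
    · rw [← mul_sub, abs_mul, hc]
      have := hLip p hp q hq
      calc L⁻¹ * |w p - w q| ≤ L⁻¹ * (L * ‖p - q‖) := by gcongr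
        _ = _ := by field_simp
    · obtain ⟨a, ha, hl⟩ := hE p hp
      refine ⟨a, ha, ?_⟩
      have e : ∑ i, hs (fun y => c * w y) p (ei i) (ei i) + ∑ i, ∑ j, a i j * hs (fun y => c * w y) p (ei i) (ei j)
        = c * (∑ i, hs w p (ei i) (ei i) + ∑ i, ∑ j, a i j * hs w p (ei i) (ei j)) := by
        simp only [hs_const_mul (hC p hp), mul_add, Finset.mul_sum]
        congr 1
        exact Finset.sum_congr rfl fun _ _ => Finset.sum_congr rfl fun _ _ => by ring
      rw [e, abs_mul, hc]
      calc _ ≤ L⁻¹ * L := by gcongr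
        _ = 1 := by field_simp
  have a1 := main L⁻¹ (abs_of_pos (by positivity))
  have a2 := main (-L⁻¹) (by rw [abs_neg, abs_of_pos (by positivity)])
  rw [abs_le]
  have e : ∀ t : ℝ, t = L * (L⁻¹ * t) := fun t => by field_simp
  constructor
  · rw [e (w (x0 + (2:ℝ) • y) + w (x0 - (2:ℝ) • y) - 2 * w x0)]
    have := mul_le_mul_of_nonneg_left a2 hL.le
    linarith
  · rw [e (w (x0 + (2:ℝ) • y) + w (x0 - (2:ℝ) • y) - 2 * w x0)]
    have := mul_le_mul_of_nonneg_left a1 hL.le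
    linarith

end MAE

open Filter Topology Metric
namespace MAE
variable {n : ℕ}

lemma hs_sub {f g : EE n → ℝ} {x : EE n} (hf : ContDiffAt ℝ 2 f x) (hg : ContDiffAt ℝ 2 g x) (p q : EE n) :
    hs (fun y => f y - g y) x p q = hs f x p q - hs g x p q := by
  have d : ∀ {f : EE n → ℝ}, ContDiffAt ℝ 2 f x → DifferentiableAt ℝ (fderiv ℝ f) x := fun h =>
    (h.fderiv_right (m := 1) (by norm_num)).differentiableAt (by simp)
  have e : ∀ {f : EE n → ℝ}, ContDiffAt ℝ 2 f x → ∀ᶠ y in 𝓝 x, DifferentiableAt ℝ f y := fun h => by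
    filter_upwards [h.eventually (by simp)] with y hy using hy.differentiableAt (by simp)
  have : fderiv ℝ (fun y => f y - g y) =ᶠ[𝓝 x] fun y => fderiv ℝ f y - fderiv ℝ g y := by
    filter_upwards [e hf, e hg] with y h1 h2 using fderiv_fun_sub h1 h2
  unfold hs
  rw [this.fderiv_eq, fderiv_fun_sub (d hf) (d hg)]; simp

lemma hs_comp_add (f : EE n → ℝ) (a x p q : EE n) : hs (fun y => f (y + a)) x p q = hs f (x + a) p q := by
  unfold hs
  have : fderiv ℝ (fun y => f (y + a)) = fun y => fderiv ℝ f (y + a) := by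
    ext1 y; rw [fderiv_comp_add_right]
  rw [this, fderiv_comp_add_right]

lemma contDiffAt_comp_add {f : EE n → ℝ} {a x : EE n} {k : WithTop ℕ∞} (h : ContDiffAt ℝ k f (x + a)) :
    ContDiffAt ℝ k (fun y => f (y + a)) x :=
  ContDiffAt.comp x (g := f) (f := fun y => y + a) h (by fun_prop)

lemma zd (hn : 1 ≤ n) {R : ℝ} (hR : 0 < R) : ∃ C : ℝ, 0 < C ∧ ∀ (x0 : EE n) (f : EE n → ℝ) (L : ℝ), 0 < L →
    (∀ p ∈ ball x0 R, ContDiffAt ℝ 2 f p) →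
    (∀ p ∈ ball x0 R, ‖fderiv ℝ f p‖ ≤ L) →
    (∀ p ∈ ball x0 R, ∃ a : Fin n → Fin n → ℝ, (∀ i j, |a i j| ≤ 1 / (1000 * n ^ 2)) ∧
      |∑ i, hs f p (ei i) (ei i) + ∑ i, ∑ j, a i j * hs f p (ei i) (ei j)| ≤ L) →
    ∀ x ∈ ball x0 (R/32), ∀ x' ∈ ball x0 (R/32), ∀ p,
      |fderiv ℝ f x' p - fderiv ℝ f x p| ≤ C * L * ‖x' - x‖ ^ (3/4 : ℝ) * ‖p‖ := by
  obtain ⟨K, hK, h⟩ := doubling hn (r := R/8) (by positivity)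
  have hCZ := CZ_pos (γ := 3/4) (by norm_num)
  refine ⟨6 * CZ (3/4) * K, by positivity, fun x0 f L hL hC hLip hE x hx x' hx' p => ?_⟩
  have hball : ∀ c ∈ ball x0 (R/2), ball c (4 * (R/8)) ⊆ ball x0 R := fun c hc => ball_subset_ball' (by
    rw [mem_ball] at hc; linarith)
  have key := zyg_holder (f := f) (x0 := x0) (R := R/8) (K := K * L) (γ := 3/4) (by norm_num) (by norm_num) (by positivity)
    (fun q hq => (hC q (ball_subset_ball (by linarith) hq)).continuousAt.continuousWithinAt) ?_
    (x := x) (x' := x') (by rwa [div_div, show (8:ℝ) * 4 = 32 by norm_num]) (by rwa [div_div, show (8:ℝ) * 4 = 32 by norm_num]) p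
  · refine key.trans (le_of_eq (by ring))
  intro q v hq hqv
  rw [mem_ball_iff_norm] at hq hqv
  have hv : ‖v‖ ≤ R/8 := by
    have : ‖(2:ℝ) • v‖ ≤ ‖q + (2:ℝ) • v - x0‖ + ‖q - x0‖ := by
      have h2 := norm_sub_le (q + (2:ℝ) • v - x0) (q - x0)
      rwa [show q + (2:ℝ) • v - x0 - (q - x0) = (2:ℝ) • v by abel] at h2
    rw [norm_smul, Real.norm_ofNat] at this
    linarith
  have hc : q + v ∈ ball x0 (R/2) := by
    rw [mem_ball_iff_norm, show q + v - x0 = (q - x0) + v by abel]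
    linarith [norm_add_le (q - x0) v]
  have := h (q + v) f L hL (fun p hp => hC p (hball _ hc hp)) (fun p hp p' hp' => ?_) (fun p hp => hE p (hball _ hc hp))
    ((2:ℝ)⁻¹ • v) (by rw [norm_smul]; norm_num; linarith)
  · rw [smul_smul, show (2:ℝ) * 2⁻¹ = 1 by norm_num, one_smul, show q + v + v = q + (2:ℝ) • v by module, add_sub_cancel_right] at this
    rw [show f (q + (2:ℝ) • v) - 2 * f (q + v) + f q = f (q + (2:ℝ) • v) + f q - 2 * f (q + v) by ring]
    refine this.trans ?_
    norm_num
    gcongr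
    rw [norm_smul]; norm_num
    linarith [norm_nonneg v]
  · have := (convex_ball x0 R).norm_image_sub_le_of_norm_fderiv_le (𝕜 := ℝ) (fun x hx => (hC x hx).differentiableAt (by simp)) hLip
      (hball _ hc hp') (hball _ hc hp)
    simpa using this

lemma bdd_D2 {w : EE n → ℝ} {x0 : EE n} {R : ℝ} (hC : ∀ p ∈ closedBall x0 R, ContDiffAt ℝ 2 w p) :
    ∃ B : ℝ, 0 < B ∧ ∀ p ∈ closedBall x0 R, ‖fderiv ℝ (fderiv ℝ w) p‖ ≤ B := by
  have : ContinuousOn (fun p => ‖fderiv ℝ (fderiv ℝ w) p‖) (closedBall x0 R) := fun p hp =>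
    (((hC p hp).fderiv_right (m := 1) (by norm_num)).fderiv_right (m := 0) (by norm_num)).continuousAt.norm.continuousWithinAt
  obtain ⟨B, hB⟩ := (isCompact_closedBall x0 R).exists_bound_of_continuousOn this
  exact ⟨max B 1, by positivity, fun p hp => (le_abs_self _).trans ((hB p hp).trans (le_max_left _ _))⟩

lemma diff_fd {w : EE n → ℝ} {p : EE n} (h : ContDiffAt ℝ 2 w p) : DifferentiableAt ℝ (fderiv ℝ w) p :=
  (h.fderiv_right (m := 1) (by norm_num)).differentiableAt (by simp)

lemma stepB (hn : 1 ≤ n) {w : EE n → ℝ} {x0 : EE n} {R C : ℝ} (hR : 0 < R)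
    (hC : ∀ p ∈ ball x0 (2*R), ContDiffAt ℝ 2 w p)
    (hE : ∀ p ∈ ball x0 R, ∀ h : EE n, ‖h‖ < R → ∃ a : Fin n → Fin n → ℝ, (∀ i j, |a i j| ≤ 1 / (1000 * n ^ 2)) ∧
      |∑ i, (hs w (p + h) (ei i) (ei i) - hs w p (ei i) (ei i)) +
        ∑ i, ∑ j, a i j * (hs w (p + h) (ei i) (ei j) - hs w p (ei i) (ei j))| ≤ C * ‖h‖) :
    ∃ ρ C' : ℝ, 0 < ρ ∧ 0 < C' ∧ ∀ x ∈ ball x0 ρ, ∀ x' ∈ ball x0 ρ, ∀ i j,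
      |pd i (pd j w) x' - pd i (pd j w) x| ≤ C' * ‖x' - x‖ ^ (3/4 : ℝ) := by
  obtain ⟨B, hB0, hB⟩ := bdd_D2 (w := w) (x0 := x0) (R := R) (fun p hp => hC p (closedBall_subset_ball (by linarith) hp))
  obtain ⟨K, hK, hz⟩ := zd hn (R := R/2) (by positivity)
  set L := B + |C| with hL
  have hL0 : 0 < L := by positivity
  refine ⟨R/64, K * L, by positivity, by positivity, fun x hx x' hx' i j => ?_⟩
  have main : ∀ h : EE n, ‖h‖ < R/2 → h ≠ 0 → |fderiv ℝ (fun y => w (y + h) - w y) x' (ei j) - fderiv ℝ (fun y => w (y + h) - w y) x (ei j)|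
      ≤ K * (L * ‖h‖) * ‖x' - x‖ ^ (3/4 : ℝ) * ‖(ei j : EE n)‖ := by
    intro h hh h0
    have hph : ∀ p ∈ ball x0 (R/2), p + h ∈ ball x0 R := fun p hp => by
      rw [mem_ball_iff_norm] at *
      rw [show p + h - x0 = (p - x0) + h by abel]
      linarith [norm_add_le (p - x0) h]
    have hp1 : ∀ p ∈ ball x0 (R/2), p ∈ ball x0 R := fun p hp => ball_subset_ball (by linarith) hp
    have hb2 : ∀ p ∈ ball x0 R, p ∈ ball x0 (2*R) := fun p hp => ball_subset_ball (by linarith) hp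
    have c1 : ∀ p ∈ ball x0 (R/2), ContDiffAt ℝ 2 (fun y => w (y + h)) p := fun p hp =>
      contDiffAt_comp_add (hC _ (hb2 _ (hph p hp)))
    have c2 : ∀ p ∈ ball x0 (R/2), ContDiffAt ℝ 2 w p := fun p hp => hC _ (hb2 _ (hp1 p hp))
    refine hz x0 _ (L * ‖h‖) (by positivity) (fun p hp => (c1 p hp).sub (c2 p hp)) (fun p hp => ?_) (fun p hp => ?_) x ?_ x' ?_ (ei j)
    · rw [fderiv_fun_sub ((c1 p hp).differentiableAt (by simp)) ((c2 p hp).differentiableAt (by simp)), fderiv_comp_add_right]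
      have := (convex_ball x0 R).norm_image_sub_le_of_norm_fderiv_le (𝕜 := ℝ) (f := fderiv ℝ w) (C := B)
        (fun x hx => diff_fd (hC x (hb2 x hx))) (fun x hx => hB x (ball_subset_closedBall hx)) (hp1 p hp) (hph p hp)
      refine this.trans ?_
      rw [add_sub_cancel_left]
      gcongr; rw [hL]; linarith [abs_nonneg C]
    · obtain ⟨a, ha, hl⟩ := hE p (hp1 p hp) h (by linarith)
      refine ⟨a, ha, ?_⟩
      simp only [hs_sub (c1 p hp) (c2 p hp), hs_comp_add]
      refine hl.trans ?_
      gcongr; rw [hL]; linarith [le_abs_self C]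
    · rwa [div_div, show (2:ℝ) * 32 = 64 by norm_num]
    · rwa [div_div, show (2:ℝ) * 32 = 64 by norm_num]
  have hx2 : ContDiffAt ℝ 2 w x := hC _ (ball_subset_ball (by linarith) hx)
  have hx2' : ContDiffAt ℝ 2 w x' := hC _ (ball_subset_ball (by linarith) hx')
  have hd : ∀ y, ContDiffAt ℝ 2 w y → HasDerivAt (fun t : ℝ => pd j w (y + t • ei i)) (pd i (pd j w) y) 0 := fun y hy => by
    have h1 := (differentiableAt_pd j hy).hasFDerivAt
    have h2 : HasDerivAt (fun t : ℝ => y + t • (ei i : EE n)) (ei i) 0 := by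
      simpa using ((hasDerivAt_id (0:ℝ)).smul_const (ei i : EE n)).const_add y
    have h3 : HasFDerivAt (pd j w) (fderiv ℝ (pd j w) y) (y + (0:ℝ) • (ei i : EE n)) := by simpa using h1
    exact h3.comp_hasDerivAt 0 h2
  have := ((hd x' hx2').sub (hd x hx2)).le_of_lip' (C := K * L * ‖x' - x‖ ^ (3/4 : ℝ)) (by positivity) ?_
  · simpa using this
  have : ∀ᶠ t : ℝ in 𝓝 0, |t| < R/2 := by
    have := (continuous_abs (G := ℝ)).continuousAt.eventually_lt (x₀ := (0:ℝ)) continuousAt_const (g := fun _ => R/2) (by simpa using by positivity)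
    exact this
  have ev : ∀ y, ContDiffAt ℝ 2 w y → ∀ᶠ t : ℝ in 𝓝 0, DifferentiableAt ℝ w (y + t • ei i) := fun y hy => by
    have h2 : Tendsto (fun t : ℝ => y + t • (ei i : EE n)) (𝓝 0) (𝓝 y) := by
      have : Continuous fun t : ℝ => y + t • (ei i : EE n) := by fun_prop
      simpa using this.tendsto 0
    filter_upwards [h2.eventually (hy.eventually (by simp))] with t ht using ht.differentiableAt (by simp)
  filter_upwards [this, ev x hx2, ev x' hx2'] with t ht e1 e2
  rcases eq_or_ne t 0 with rfl | ht0
  · simp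
  have hne : t • (ei i : EE n) ≠ 0 := by
    rw [← norm_ne_zero_iff, norm_smul, norm_ei]; simpa using ht0
  have m := main (t • ei i) (by rw [norm_smul, norm_ei]; simpa using ht) hne
  rw [fderiv_fun_sub ((differentiableAt_comp_add_right _).2 e2) (hx2'.differentiableAt (by simp)),
    fderiv_fun_sub ((differentiableAt_comp_add_right _).2 e1) (hx2.differentiableAt (by simp)),
    fderiv_comp_add_right, fderiv_comp_add_right, norm_smul, norm_ei] at m
  simp only [Pi.sub_apply, zero_smul, add_zero, sub_zero, Real.norm_eq_abs, pd] at m ⊢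
  calc _ = _ := by
        congr 1
        change _ = (fderiv ℝ w (x' + t • ei i) (ei j) - fderiv ℝ w x' (ei j)) - (fderiv ℝ w (x + t • ei i) (ei j) - fderiv ℝ w x (ei j))
        ring
    _ ≤ _ := m
    _ = _ := by rw [norm_ei]; ring

end MAE

open Filter Topology Metric
namespace MAE
variable {n : ℕ}

lemma norm_le_of_ei (T : EE n →L[ℝ] ℝ) {B : ℝ} (h : ∀ i, |T (ei i)| ≤ B) : ‖T‖ ≤ n * B := by
  rcases Nat.eq_zero_or_pos n with rfl | hn
  · have : T = 0 := by ext x; rw [Subsingleton.elim x 0]; simp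
    simp [this]
  have hB : 0 ≤ B := (abs_nonneg _).trans (h ⟨0, hn⟩)
  refine T.opNorm_le_bound (by positivity) fun x => ?_
  conv_lhs => rw [sum_ei x]
  rw [map_sum]
  refine (norm_sum_le _ _).trans ?_
  calc _ ≤ ∑ _i : Fin n, B * ‖x‖ := Finset.sum_le_sum fun i _ => by
        rw [map_smul, smul_eq_mul, norm_mul, mul_comm]
        exact mul_le_mul (h i) (PiLp.norm_apply_le x i) (norm_nonneg _) hB
    _ = _ := by simp; ring

lemma c1_of_holder {f : EE n → ℝ} {x0 : EE n} {R K γ : ℝ} (hγ : 0 < γ) (hd : ∀ x ∈ ball x0 R, DifferentiableAt ℝ f x)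
    (h : ∀ x ∈ ball x0 R, ∀ x' ∈ ball x0 R, ∀ p, |fderiv ℝ f x' p - fderiv ℝ f x p| ≤ K * ‖x' - x‖ ^ γ * ‖p‖) :
    ∀ x ∈ ball x0 R, ContDiffAt ℝ 1 f x := by
  have : ContDiffOn ℝ 1 f (ball x0 R) := by
    rw [show (1 : WithTop ℕ∞) = 0 + 1 by norm_num, contDiffOn_succ_iff_fderiv_of_isOpen isOpen_ball]
    refine ⟨fun x hx => (hd x hx).differentiableWithinAt, by simp, ?_⟩
    rw [contDiffOn_zero]
    intro x hx
    refine ContinuousAt.continuousWithinAt ?_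
    rw [ContinuousAt, tendsto_iff_norm_sub_tendsto_zero]
    have h1 : Tendsto (fun x' => |K| * ‖x' - x‖ ^ γ) (𝓝 x) (𝓝 0) := by
      have : Continuous fun x' : EE n => |K| * ‖x' - x‖ ^ γ :=
        continuous_const.mul (Continuous.rpow_const (by fun_prop) fun _ => Or.inr hγ.le)
      simpa [Real.zero_rpow hγ.ne'] using this.tendsto x
    refine tendsto_of_tendsto_of_tendsto_of_le_of_le' tendsto_const_nhds h1 (Eventually.of_forall fun _ => norm_nonneg _) ?_
    filter_upwards [isOpen_ball.mem_nhds hx] with x' hx'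
    refine ContinuousLinearMap.opNorm_le_bound _ (by positivity) fun p => ?_
    refine (h x hx x' hx' p).trans ?_
    gcongr; exact le_abs_self K
  exact fun x hx => (this x hx).contDiffAt (isOpen_ball.mem_nhds hx)

lemma pd_z {w : EE n → ℝ} {h p : EE n} (j : Fin n) (d0 : DifferentiableAt ℝ w p) (d1 : DifferentiableAt ℝ w (p + h))
    (d2 : DifferentiableAt ℝ w (p + -h)) : pd j (fun y => (w (y + h) - w y) - (w y - w (y + -h))) p =
      (pd j w (p + h) - pd j w p) - (pd j w p - pd j w (p + -h)) := by
  have d1 := (differentiableAt_comp_add_right (f := w) h).2 d1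
  have d2 := (differentiableAt_comp_add_right (f := w) (-h)).2 d2
  rw [pd_sub j (d1.fun_sub d0) (d0.fun_sub d2), pd_sub j d1 d0, pd_sub j d0 d2, pd_comp_add, pd_comp_add]

lemma stepA (hn : 1 ≤ n) {w : EE n → ℝ} {x0 : EE n} {R C : ℝ} (hR : 0 < R)
    (hC : ∀ p ∈ ball x0 (2*R), ContDiffAt ℝ 2 w p)
    (hH : ∀ x ∈ ball x0 (2*R), ∀ x' ∈ ball x0 (2*R), ∀ i j, |hs w x' (ei i) (ei j) - hs w x (ei i) (ei j)| ≤ C * ‖x' - x‖ ^ (3/4 : ℝ))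
    (hE : ∀ p ∈ ball x0 R, ∀ h : EE n, ‖h‖ < R → ∃ a : Fin n → Fin n → ℝ, (∀ i j, |a i j| ≤ 1 / (1000 * n ^ 2)) ∧
      |∑ i, ((hs w (p + h) (ei i) (ei i) - hs w p (ei i) (ei i)) - (hs w p (ei i) (ei i) - hs w (p + -h) (ei i) (ei i))) +
        ∑ i, ∑ j, a i j * ((hs w (p + h) (ei i) (ei j) - hs w p (ei i) (ei j)) - (hs w p (ei i) (ei j) - hs w (p + -h) (ei i) (ei j)))|
        ≤ C * ‖h‖ ^ (3/2 : ℝ)) :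
    ∃ ρ : ℝ, 0 < ρ ∧ ∀ x ∈ ball x0 ρ, ∀ i j, ContDiffAt ℝ 1 (pd i (pd j w)) x := by
  obtain ⟨K, hK, hz⟩ := zd hn (R := R/2) (by positivity)
  set C1 := n * (n * |C| * R ^ (1/4 : ℝ)) + |C| + 1 with hC1
  have hC10 : 0 < C1 := by positivity
  set z : EE n → EE n → ℝ := fun h y => (w (y + h) - w y) - (w y - w (y + -h)) with hzdef
  have hmem : ∀ {p h : EE n} {r s : ℝ}, p ∈ ball x0 r → ‖h‖ < s → p + h ∈ ball x0 (r + s) := fun {p h r s} hp hh => by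
    rw [mem_ball_iff_norm] at *
    rw [show p + h - x0 = (p - x0) + h by abel]
    linarith [norm_add_le (p - x0) h]
  have s1 : ∀ h : EE n, ‖h‖ < R/2 → h ≠ 0 → ∀ x ∈ ball x0 (R/64), ∀ x' ∈ ball x0 (R/64), ∀ j,
      |pd j (z h) x' - pd j (z h) x| ≤ K * (C1 * ‖h‖ ^ (3/2 : ℝ)) * ‖x' - x‖ ^ (3/4 : ℝ) := by
    intro h hh h0 x hx x' hx' j
    have hhn : ‖-h‖ < R/2 := by rwa [norm_neg]
    have c0 : ∀ p ∈ ball x0 (R/2), ContDiffAt ℝ 2 w p := fun p hp => hC _ (ball_subset_ball (by linarith) hp)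
    have c1 : ∀ k : EE n, ‖k‖ < R/2 → ∀ p ∈ ball x0 (R/2), ContDiffAt ℝ 2 (fun y => w (y + k)) p := fun k hk p hp =>
      contDiffAt_comp_add (hC _ (ball_subset_ball (by linarith) (hmem hp hk)))
    have cz : ∀ p ∈ ball x0 (R/2), ContDiffAt ℝ 2 (z h) p := fun p hp =>
      ((c1 h hh p hp).sub (c0 p hp)).sub ((c0 p hp).sub (c1 (-h) hhn p hp))
    have hhp : 0 < ‖h‖ := norm_pos_iff.2 h0
    have := hz x0 (z h) (C1 * ‖h‖ ^ (3/2 : ℝ)) (by positivity) cz (fun p hp => ?_) (fun p hp => ?_) x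
      (by rwa [div_div, show (2:ℝ) * 32 = 64 by norm_num]) x' (by rwa [div_div, show (2:ℝ) * 32 = 64 by norm_num]) (ei j)
    · rw [norm_ei, mul_one] at this; exact this
    · refine (norm_le_of_ei _ (B := n * |C| * R ^ (1/4 : ℝ) * ‖h‖ ^ (3/2 : ℝ)) fun i => ?_).trans (le_of_eq_of_le (by ring_nf) (mul_le_mul_of_nonneg_right (a := ‖h‖ ^ (3/2 : ℝ)) (b := n * (n * |C| * R ^ (1/4 : ℝ))) (c := C1) (by rw [hC1]; linarith [abs_nonneg C]) (by positivity)))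
      set φ : EE n → ℝ := fun y => pd i w (y + h) - pd i w y with hφ
      have dw : ∀ y ∈ ball x0 (2*R), DifferentiableAt ℝ (pd i w) y := fun y hy => differentiableAt_pd i (hC y hy)
      have m1 : ∀ y ∈ ball x0 R, y + h ∈ ball x0 (2*R) := fun y hy => ball_subset_ball (by linarith) (hmem hy hh)
      have m2 : ∀ y ∈ ball x0 R, y ∈ ball x0 (2*R) := fun y hy => ball_subset_ball (by linarith) hy
      have dw1 : ∀ y ∈ ball x0 R, DifferentiableAt ℝ (fun y => pd i w (y + h)) y := fun y hy =>
        (differentiableAt_comp_add_right _).2 (dw _ (m1 y hy))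
      have e : fderiv ℝ (z h) p (ei i) = φ p - φ (p + -h) := by
        change pd i (z h) p = _
        refine (pd_z i ((c0 p hp).differentiableAt (by simp)) ((hC _ (ball_subset_ball (by linarith) (hmem hp hh))).differentiableAt (by simp))
          ((hC _ (ball_subset_ball (by linarith) (hmem hp hhn))).differentiableAt (by simp))).trans ?_
        simp [hφ]
      rw [e]
      have mv := (convex_ball x0 R).norm_image_sub_le_of_norm_fderiv_le (𝕜 := ℝ) (f := φ) (C := n * (|C| * ‖h‖ ^ (3/4 : ℝ)))
        (fun y hy => (dw1 y hy).sub (dw y (m2 y hy))) (fun y hy => norm_le_of_ei _ fun k => ?_)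
        (ball_subset_ball (by linarith) (hmem hp hhn)) (ball_subset_ball (by linarith) hp)
      · rw [Real.norm_eq_abs] at mv
        refine mv.trans ?_
        rw [show p - (p + -h) = h by abel]
        have e1 : ‖h‖ ^ (3/4 : ℝ) * ‖h‖ = ‖h‖ ^ (1/4:ℝ) * ‖h‖ ^ (3/2:ℝ) := by
          rw [← Real.rpow_add hhp]; nth_rewrite 2 [← Real.rpow_one ‖h‖]; rw [← Real.rpow_add hhp]; norm_num
        calc _ = n * |C| * (‖h‖ ^ (1/4:ℝ) * ‖h‖ ^ (3/2:ℝ)) := by rw [← e1]; ring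
          _ ≤ n * |C| * (R ^ (1/4:ℝ) * ‖h‖ ^ (3/2:ℝ)) := by gcongr; linarith
          _ = _ := by ring
      · change |pd k φ y| ≤ _
        rw [hφ, pd_sub k (dw1 y hy) (dw y (m2 y hy)), pd_comp_add, pd_pd k i (hC _ (m1 y hy)), pd_pd k i (hC _ (m2 y hy))]
        refine (hH y (m2 y hy) (y + h) (m1 y hy) k i).trans ?_
        rw [add_sub_cancel_left]; gcongr; exact le_abs_self C
    · obtain ⟨a, ha, hl⟩ := hE p (ball_subset_ball (by linarith) hp) h (by linarith)
      refine ⟨a, ha, ?_⟩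
      have d0 := c0 p hp
      have d1 := c1 h hh p hp
      have d2 := c1 (-h) hhn p hp
      simp only [hzdef, hs_sub (f := fun y => w (y + h) - w y) (g := fun y => w y - w (y + -h)) (d1.sub d0) (d0.sub d2), hs_sub d1 d0, hs_sub d0 d2, hs_comp_add]
      refine hl.trans ?_
      gcongr; rw [hC1]; have : 0 ≤ n * (n * |C| * R ^ (1/4 : ℝ)) := by positivity
      linarith [le_abs_self C]
  have hZ2 := CZ_pos (γ := 1/2) (by norm_num)
  have hZ4 := CZ_pos (γ := 1/4) (by norm_num)
  set ρ := R / 1024 with hρ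
  have dj : ∀ j, ∀ y ∈ ball x0 (R/64), DifferentiableAt ℝ (pd j w) y := fun j y hy =>
    differentiableAt_pd j (hC y (ball_subset_ball (by linarith) hy))
  have s2 : ∀ y : EE n, ‖y‖ < 4 * ρ → ∀ i j, ∀ x ∈ ball x0 ρ, ∀ x' ∈ ball x0 ρ,
      |(pd i (pd j w) (x' + y) - pd i (pd j w) x') - (pd i (pd j w) (x + y) - pd i (pd j w) x)| ≤
        6 * CZ (1/2) * (K * C1 * ‖y‖ ^ (3/4 : ℝ)) * ‖x' - x‖ ^ (1/2 : ℝ) := by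
    intro y hy i j x hx x' hx'
    have mb : ∀ p ∈ ball x0 (4 * ρ), p + y ∈ ball x0 (R/64) := fun p hp => ball_subset_ball (by rw [hρ]; linarith) (hmem hp hy)
    have mb' : ∀ p ∈ ball x0 (4 * ρ), p ∈ ball x0 (R/64) := fun p hp => ball_subset_ball (by rw [hρ]; linarith) hp
    have dP : ∀ p ∈ ball x0 (4 * ρ), DifferentiableAt ℝ (fun q => pd j w (q + y)) p := fun p hp =>
      (differentiableAt_comp_add_right _).2 (dj j _ (mb p hp))
    have := zyg_holder (f := fun q => pd j w (q + y) - pd j w q) (x0 := x0) (R := 4 * ρ) (K := K * C1 * ‖y‖ ^ (3/4 : ℝ)) (γ := 1/2)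
      (by norm_num) (by norm_num) (by positivity)
      (fun q hq => ((dP q hq).sub (dj j q (mb' q hq))).continuousAt.continuousWithinAt) ?_ (x := x) (x' := x')
      (by rwa [mul_div_cancel_left₀ _ (by norm_num)]) (by rwa [mul_div_cancel_left₀ _ (by norm_num)]) (ei i)
    · have hx4 : x ∈ ball x0 (4 * ρ) := ball_subset_ball (by rw [hρ]; linarith) hx
      have hx4' : x' ∈ ball x0 (4 * ρ) := ball_subset_ball (by rw [hρ]; linarith) hx'
      change |pd i _ x' - pd i _ x| ≤ _ at this
      rw [pd_sub i (dP x hx4) (dj j x (mb' x hx4)), pd_sub i (dP x' hx4') (dj j x' (mb' x' hx4')), pd_comp_add, pd_comp_add, norm_ei, mul_one] at this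
      exact this
    · intro q h hq hq2
      rcases eq_or_ne h 0 with rfl | h0
      · simp only [smul_zero, add_zero, norm_zero]
        rw [Real.zero_rpow (by norm_num)]; ring_nf; simp
      have hqh : q + h ∈ ball x0 (4 * ρ) := by
        have := (convex_ball x0 (4*ρ)) hq hq2 (a := 1/2) (b := 1/2) (by norm_num) (by norm_num) (by norm_num)
        rwa [show (1/2 : ℝ) • q + (1/2:ℝ) • (q + (2:ℝ) • h) = q + h by module] at this
      have hh : ‖h‖ < R/2 := by
        rw [mem_ball_iff_norm] at hq hqh
        have := norm_sub_le (q + h - x0) (q - x0)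
        rw [show q + h - x0 - (q - x0) = h by abel] at this
        rw [hρ] at hq hqh; linarith
      have := s1 h hh h0 (q + h) (mb' _ hqh) (q + h + y) (mb _ hqh) j
      have ez : ∀ p ∈ ball x0 (R/64), pd j (z h) p = (pd j w (p + h) - pd j w p) - (pd j w p - pd j w (p + -h)) := fun p hp =>
        pd_z j ((hC p (ball_subset_ball (by linarith) hp)).differentiableAt (by simp))
          ((hC _ (ball_subset_ball (by linarith) (hmem hp hh))).differentiableAt (by simp))
          ((hC _ (ball_subset_ball (by linarith) (hmem (s := R/2) hp (by rwa [norm_neg])))).differentiableAt (by simp))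
      rw [ez _ (mb' _ hqh), ez _ (mb _ hqh), add_sub_cancel_left] at this
      rw [show q + h + y + h = q + (2:ℝ) • h + y by module, show q + h + y + -h = q + y by abel,
        show q + h + h = q + (2:ℝ) • h by module, show q + h + -h = q by abel] at this
      refine le_of_eq_of_le (congrArg _ ?_) (this.trans (le_of_eq ?_))
      · ring
      · rw [show (1 + 1/2 : ℝ) = 3/2 by norm_num]; ring
  have cw : ∀ i j, ∀ x ∈ ball x0 ρ, ContinuousAt (pd i (pd j w)) x := fun i j x hx => by
    have := hC x (ball_subset_ball (by rw [hρ]; linarith) hx)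
    exact (contDiffAt_pd (k := 0) i (contDiffAt_pd (k := 1) j (by exact_mod_cast this))).continuousAt
  have s3 : ∀ i j, ∀ x h : EE n, x ∈ ball x0 ρ → x + (2:ℝ) • h ∈ ball x0 ρ →
      |pd i (pd j w) (x + (2:ℝ) • h) - 2 * pd i (pd j w) (x + h) + pd i (pd j w) x| ≤
        (6 * CZ (1/2) * (K * C1)) * ‖h‖ ^ (1 + 1/4 : ℝ) := by
    intro i j x h hx hx2
    have hqh : x + h ∈ ball x0 ρ := by
      have := (convex_ball x0 ρ) hx hx2 (a := 1/2) (b := 1/2) (by norm_num) (by norm_num) (by norm_num)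
      rwa [show (1/2 : ℝ) • x + (1/2:ℝ) • (x + (2:ℝ) • h) = x + h by module] at this
    have hh : ‖h‖ < 4 * ρ := by
      rw [mem_ball_iff_norm] at hx hqh
      have := norm_sub_le (x + h - x0) (x - x0)
      rw [show x + h - x0 - (x - x0) = h by abel] at this
      linarith [norm_nonneg (x - x0)]
    have := s2 h hh i j x hx (x + h) hqh
    rw [add_sub_cancel_left, show x + h + h = x + (2:ℝ) • h by module] at this
    refine le_of_eq_of_le (congrArg _ (by ring)) (this.trans (le_of_eq ?_))
    rw [show (1 + 1/4 : ℝ) = 3/4 + 1/2 by norm_num, Real.rpow_add_of_nonneg (norm_nonneg h) (by norm_num) (by norm_num)]; ring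
  refine ⟨ρ / 4, by positivity, fun x hx i j => ?_⟩
  have cont : ContinuousOn (pd i (pd j w)) (ball x0 ρ) := fun x hx => (cw i j x hx).continuousWithinAt
  exact c1_of_holder (x0 := x0) (R := ρ/4) (γ := 1/4) (K := 6 * CZ (1/4) * (6 * CZ (1/2) * (K * C1))) (by norm_num)
    (fun y hy => (zyg (by norm_num) (by norm_num) (by positivity) cont (s3 i j) (ball_subset_ball (by rw [hρ]; linarith) hy)).1)
    (fun y hy y' hy' p => zyg_holder (by norm_num) (by norm_num) (by positivity) cont (s3 i j) hy hy' p) x hx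

end MAE

open Filter Topology Metric
namespace MAE
variable {n : ℕ}

def Cl (U : Set (EE n)) (P : (EE n → ℝ) → Prop) : ℕ → (EE n → ℝ) → Prop
  | 0, f => P f
  | k + 1, f => (∀ x ∈ U, DifferentiableAt ℝ f x) ∧ ∀ i, Cl U P k (pd i f)

structure Good (U : Set (EE n)) (P : (EE n → ℝ) → Prop) : Prop where
  cont : ∀ {f}, P f → ContinuousOn f U
  c1 : ∀ {f}, (∀ x ∈ U, ContDiffAt ℝ 1 f x) → P f
  congr : ∀ {f g}, (∀ x ∈ U, f x = g x) → P f → P g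
  add : ∀ {f g}, P f → P g → P (fun x => f x + g x)
  mul : ∀ {f g}, P f → P g → P (fun x => f x * g x)

variable {U : Set (EE n)} {P : (EE n → ℝ) → Prop}

lemma Cl.contDiffOn (hU : IsOpen U) (hP : Good U P) : ∀ {k : ℕ} {f : EE n → ℝ}, Cl U P k f → ContDiffOn ℝ k f U
  | 0, f, h => by simpa using hP.cont h
  | k + 1, f, h => by
    have := h.1
    rw [Nat.cast_add, Nat.cast_one, contDiffOn_succ_iff_fderiv_of_isOpen hU]
    refine ⟨fun x hx => (h.1 x hx).differentiableWithinAt, by simp, ?_⟩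
    have e : fderiv ℝ f = fun x => ∑ i, pd i f x • (EuclideanSpace.proj i : EE n →L[ℝ] ℝ) := by
      ext x p
      rw [fderiv_eq_sum]
      simp [mul_comm]
    rw [e]
    exact ContDiffOn.sum fun i _ => (Cl.contDiffOn hU hP (h.2 i)).smul contDiffOn_const

lemma Cl.contDiffAt (hU : IsOpen U) (hP : Good U P) {k : ℕ} {f : EE n → ℝ} (h : Cl U P k f) {x : EE n} (hx : x ∈ U) :
    ContDiffAt ℝ k f x := (h.contDiffOn hU hP x hx).contDiffAt (hU.mem_nhds hx)

lemma Cl.of_contDiff (hP : Good U P) : ∀ {k : ℕ} {f : EE n → ℝ}, (∀ x ∈ U, ContDiffAt ℝ (k + 1 : ℕ) f x) → Cl U P k f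
  | 0, f, h => hP.c1 (by simpa using h)
  | k + 1, f, h => ⟨fun x hx => (h x hx).differentiableAt (by norm_cast), fun i => Cl.of_contDiff hP fun x hx => contDiffAt_pd i (h x hx)⟩

lemma Cl.mono (hU : IsOpen U) (hP : Good U P) : ∀ {k : ℕ} {f : EE n → ℝ}, Cl U P (k + 1) f → Cl U P k f
  | 0, f, h => hP.c1 fun x hx => by exact_mod_cast Cl.contDiffAt (k := 1) hU hP h hx
  | k + 1, f, h => ⟨h.1, fun i => Cl.mono hU hP (h.2 i)⟩

lemma Cl.congr (hU : IsOpen U) (hP : Good U P) : ∀ {k : ℕ} {f g : EE n → ℝ}, (∀ x ∈ U, f x = g x) → Cl U P k f → Cl U P k g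
  | 0, f, g, e, h => hP.congr e h
  | k + 1, f, g, e, h => ⟨fun x hx => (h.1 x hx).congr_of_eventuallyEq
      (by filter_upwards [hU.mem_nhds hx] with y hy using (e y hy).symm), fun i => Cl.congr hU hP (pd_congr_on hU i e) (h.2 i)⟩

lemma Cl.add (hU : IsOpen U) (hP : Good U P) : ∀ {k : ℕ} {f g : EE n → ℝ}, Cl U P k f → Cl U P k g → Cl U P k (fun x => f x + g x)
  | 0, f, g, hf, hg => hP.add hf hg
  | k + 1, f, g, hf, hg => ⟨fun x hx => (hf.1 x hx).add (hg.1 x hx), fun i =>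
      Cl.congr hU hP (fun x hx => (pd_add i (hf.1 x hx) (hg.1 x hx)).symm) (Cl.add hU hP (hf.2 i) (hg.2 i))⟩

lemma Cl.mul (hU : IsOpen U) (hP : Good U P) : ∀ {k : ℕ} {f g : EE n → ℝ}, Cl U P k f → Cl U P k g → Cl U P k (fun x => f x * g x)
  | 0, f, g, hf, hg => hP.mul hf hg
  | k + 1, f, g, hf, hg => ⟨fun x hx => (hf.1 x hx).mul (hg.1 x hx), fun i =>
      Cl.congr hU hP (fun x hx => (pd_mul i (hf.1 x hx) (hg.1 x hx)).symm)
        (Cl.add hU hP (Cl.mul hU hP (Cl.mono hU hP hf) (hg.2 i)) (Cl.mul hU hP (Cl.mono hU hP hg) (hf.2 i)))⟩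

lemma Cl.const (hP : Good U P) {k : ℕ} (c : ℝ) : Cl U P k (fun _ => c) :=
  Cl.of_contDiff hP fun _ _ => contDiffAt_const

lemma Cl.sub (hU : IsOpen U) (hP : Good U P) {k : ℕ} {f g : EE n → ℝ} (hf : Cl U P k f) (hg : Cl U P k g) :
    Cl U P k (fun x => f x - g x) :=
  Cl.congr hU hP (fun x _ => by ring) (Cl.add hU hP hf (Cl.mul hU hP (Cl.const hP (-1)) hg))

lemma Cl.sum (hU : IsOpen U) (hP : Good U P) {k : ℕ} {ι : Type*} (s : Finset ι) {f : ι → EE n → ℝ} (hf : ∀ a, Cl U P k (f a)) :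
    Cl U P k (fun x => ∑ a ∈ s, f a x) := by
  classical
  induction s using Finset.induction_on with
  | empty => simpa using Cl.const hP 0
  | insert a s ha ih =>
    simp only [Finset.sum_insert ha]
    exact Cl.add hU hP (hf a) ih

lemma Cl.poly (hU : IsOpen U) (hP : Good U P) {k : ℕ} {σ : Type*} {f : σ → EE n → ℝ} (hf : ∀ a, Cl U P k (f a))
    (q : MvPolynomial σ ℝ) : Cl U P k (fun x => MvPolynomial.eval (fun s => f s x) q) := by
  induction q using MvPolynomial.induction_on with
  | C a => simpa using Cl.const hP a
  | add p q hp hq => simpa using Cl.add hU hP hp hq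
  | mul_X p s hp => simpa using Cl.mul hU hP hp (hf s)

def PC (U : Set (EE n)) (f : EE n → ℝ) : Prop := ContinuousOn f U
def P1 (U : Set (EE n)) (f : EE n → ℝ) : Prop := ∀ x ∈ U, ContDiffAt ℝ 1 f x
def HoldOn (f : EE n → ℝ) (x0 : EE n) (ρ C : ℝ) : Prop :=
  ∀ x ∈ ball x0 ρ, ∀ x' ∈ ball x0 ρ, |f x' - f x| ≤ C * ‖x' - x‖ ^ (3/4 : ℝ)
def PH (U : Set (EE n)) (f : EE n → ℝ) : Prop := ∀ x0 ∈ U, ∃ ρ > 0, ∃ C, HoldOn f x0 ρ C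

lemma good_PC : Good U (PC U) where
  cont h := h
  c1 h := fun x hx => (h x hx).continuousAt.continuousWithinAt
  congr e h := ContinuousOn.congr h fun x hx => (e x hx).symm
  add h k := ContinuousOn.add h k
  mul h k := ContinuousOn.mul h k

lemma good_P1 (hU : IsOpen U) : Good U (P1 U) where
  cont h := fun x hx => (h x hx).continuousAt.continuousWithinAt
  c1 h := h
  congr e h := fun x hx => (h x hx).congr_of_eventuallyEq (by filter_upwards [hU.mem_nhds hx] with y hy using (e y hy).symm)
  add h k := fun x hx => (h x hx).add (k x hx)
  mul h k := fun x hx => (h x hx).mul (k x hx)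

lemma HoldOn.mono {f : EE n → ℝ} {x0 : EE n} {ρ C ρ' C' : ℝ} (h : HoldOn f x0 ρ C) (h1 : ρ' ≤ ρ) (h2 : C ≤ C') :
    HoldOn f x0 ρ' C' := fun x hx x' hx' =>
  (h x (ball_subset_ball h1 hx) x' (ball_subset_ball h1 hx')).trans (by gcongr)

lemma unif {ι : Type*} [Finite ι] {S : ι → ℝ → ℝ → Prop} (mono : ∀ i ρ C ρ' C', 0 < ρ' → ρ' ≤ ρ → C ≤ C' → S i ρ C → S i ρ' C')
    (h : ∀ i, ∃ ρ > 0, ∃ C, S i ρ C) : ∃ ρ > 0, ∃ C > 0, ∀ i, S i ρ C := by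
  choose ρ hρ C hC using h
  obtain ⟨M, hM⟩ := Finite.exists_le C
  obtain ⟨N, hN⟩ := Finite.exists_le fun i => (ρ i)⁻¹
  have h0 : 0 < max N 1 := by positivity
  refine ⟨(max N 1)⁻¹, by positivity, max M 1, by positivity, fun i => mono i _ _ _ _ (by positivity) ?_ ((hM i).trans (le_max_left _ _)) (hC i)⟩
  rw [inv_le_comm₀ h0 (hρ i)]; exact (hN i).trans (le_max_left _ _)

def LipOn (f : EE n → ℝ) (x0 : EE n) (ρ C : ℝ) : Prop :=
  ∀ x ∈ ball x0 ρ, ∀ x' ∈ ball x0 ρ, |f x' - f x| ≤ C * ‖x' - x‖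

lemma LipOn.mono {f : EE n → ℝ} {x0 : EE n} {ρ C ρ' C' : ℝ} (h : LipOn f x0 ρ C) (h1 : ρ' ≤ ρ) (h2 : C ≤ C') :
    LipOn f x0 ρ' C' := fun x hx x' hx' =>
  (h x (ball_subset_ball h1 hx) x' (ball_subset_ball h1 hx')).trans (by gcongr)

lemma lip_c1 {f : EE n → ℝ} {x0 : EE n} (h : ContDiffAt ℝ 1 f x0) : ∃ ρ > 0, ∃ C, LipOn f x0 ρ C := by
  obtain ⟨K, t, ht, hK⟩ := h.exists_lipschitzOnWith
  obtain ⟨ρ, hρ, hb⟩ := Metric.mem_nhds_iff.1 ht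
  refine ⟨ρ, hρ, K, fun x hx x' hx' => ?_⟩
  simpa [Real.dist_eq, dist_eq_norm] using hK.dist_le_mul x' (hb hx') x (hb hx)

lemma norm_lt_of_ball {x x' x0 : EE n} {r : ℝ} (hx : x ∈ ball x0 r) (hx' : x' ∈ ball x0 r) : ‖x' - x‖ < 2 * r := by
  rw [mem_ball_iff_norm] at *
  have := norm_sub_le (x' - x0) (x - x0)
  rw [sub_sub_sub_cancel_right] at this
  linarith

lemma LipOn.hold {f : EE n → ℝ} {x0 : EE n} {ρ C : ℝ} (h : LipOn f x0 ρ C) : HoldOn f x0 (min ρ (1/2)) |C| := by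
  intro x hx x' hx'
  have hl := norm_lt_of_ball (ball_subset_ball (min_le_right _ _) hx) (ball_subset_ball (min_le_right _ _) hx')
  refine (h x (ball_subset_ball (min_le_left _ _) hx) x' (ball_subset_ball (min_le_left _ _) hx')).trans ?_
  have : ‖x' - x‖ ≤ ‖x' - x‖ ^ (3/4 : ℝ) := by
    conv_lhs => rw [← Real.rpow_one ‖x' - x‖]
    rcases (norm_nonneg (x' - x)).eq_or_lt with h0 | h0
    · rw [← h0, Real.zero_rpow (by norm_num), Real.zero_rpow (by norm_num)]
    · exact Real.rpow_le_rpow_of_exponent_ge h0 (by linarith) (by norm_num)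
  exact mul_le_mul (le_abs_self C) this (norm_nonneg _) (abs_nonneg C)

lemma bd_cont {f : EE n → ℝ} {x0 : EE n} (h : ContinuousAt f x0) : ∃ ρ > 0, ∃ C, ∀ x ∈ ball x0 ρ, |f x| ≤ C := by
  have := h.norm.eventually_lt (continuousAt_const (y := ‖f x0‖ + 1)) (by simp)
  obtain ⟨ρ, hρ, hb⟩ := Metric.eventually_nhds_iff_ball.1 this
  exact ⟨ρ, hρ, _, fun x hx => (hb x hx).le⟩

lemma PH.contAt {f : EE n → ℝ} (h : PH U f) {x0 : EE n} (hx : x0 ∈ U) : ContinuousAt f x0 := by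
  obtain ⟨ρ, hρ, C, hC⟩ := h x0 hx
  rw [ContinuousAt, tendsto_iff_norm_sub_tendsto_zero]
  have h1 : Tendsto (fun x' => C * ‖x' - x0‖ ^ (3/4:ℝ)) (𝓝 x0) (𝓝 0) := by
    have : Continuous fun x' : EE n => C * ‖x' - x0‖ ^ (3/4:ℝ) :=
      continuous_const.mul (Continuous.rpow_const (by fun_prop) fun _ => Or.inr (by norm_num))
    simpa [Real.zero_rpow] using this.tendsto x0
  refine tendsto_of_tendsto_of_tendsto_of_le_of_le' tendsto_const_nhds h1 (Eventually.of_forall fun _ => norm_nonneg _) ?_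
  filter_upwards [ball_mem_nhds x0 hρ] with x' hx' using hC x0 (mem_ball_self hρ) x' hx'

lemma good_PH (hU : IsOpen U) : Good U (PH U) where
  cont h := fun x hx => (PH.contAt h hx).continuousWithinAt
  c1 h := fun x hx => by
    obtain ⟨ρ, hρ, C, hC⟩ := lip_c1 (h x hx)
    exact ⟨_, by positivity, _, hC.hold⟩
  congr e h := fun x hx => by
    obtain ⟨ρ, hρ, C, hC⟩ := h x hx
    obtain ⟨r, hr, hb⟩ := Metric.isOpen_iff.1 hU x hx
    refine ⟨min ρ r, by positivity, C, fun y hy y' hy' => ?_⟩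
    rw [← e _ (hb (ball_subset_ball (min_le_right _ _) hy)), ← e _ (hb (ball_subset_ball (min_le_right _ _) hy'))]
    exact hC _ (ball_subset_ball (min_le_left _ _) hy) _ (ball_subset_ball (min_le_left _ _) hy')
  add {f g} h k := fun x hx => by
    obtain ⟨ρ, hρ, C, hC⟩ := h x hx
    obtain ⟨r, hr, D, hD⟩ := k x hx
    refine ⟨min ρ r, by positivity, C + D, fun y hy y' hy' => ?_⟩
    have h1 := hC _ (ball_subset_ball (min_le_left _ _) hy) _ (ball_subset_ball (min_le_left _ _) hy')
    have h2 := hD _ (ball_subset_ball (min_le_right _ _) hy) _ (ball_subset_ball (min_le_right _ _) hy')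
    rw [show f y' + g y' - (f y + g y) = (f y' - f y) + (g y' - g y) by ring, add_mul]
    exact (abs_add_le _ _).trans (add_le_add h1 h2)
  mul {f g} h k := fun x hx => by
    obtain ⟨ρ, hρ, C, hC⟩ := h x hx
    obtain ⟨r, hr, D, hD⟩ := k x hx
    obtain ⟨ρ', hρ', B, hB⟩ := bd_cont (PH.contAt h hx)
    obtain ⟨r', hr', B', hB'⟩ := bd_cont (PH.contAt k hx)
    refine ⟨min (min ρ r) (min ρ' r'), by positivity, B * D + B' * C, fun y hy y' hy' => ?_⟩
    have s1 : min (min ρ r) (min ρ' r') ≤ ρ := (min_le_left _ _).trans (min_le_left _ _)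
    have s2 : min (min ρ r) (min ρ' r') ≤ r := (min_le_left _ _).trans (min_le_right _ _)
    have s3 : min (min ρ r) (min ρ' r') ≤ ρ' := (min_le_right _ _).trans (min_le_left _ _)
    have s4 : min (min ρ r) (min ρ' r') ≤ r' := (min_le_right _ _).trans (min_le_right _ _)
    have h1 := hC _ (ball_subset_ball s1 hy) _ (ball_subset_ball s1 hy')
    have h2 := hD _ (ball_subset_ball s2 hy) _ (ball_subset_ball s2 hy')
    have h3 := hB _ (ball_subset_ball s3 hy')
    have h4 := hB' _ (ball_subset_ball s4 hy)
    rw [show f y' * g y' - f y * g y = f y' * (g y' - g y) + g y * (f y' - f y) by ring, add_mul, mul_assoc, mul_assoc]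
    refine (abs_add_le _ _).trans (add_le_add ?_ ?_) <;> rw [abs_mul]
    · exact mul_le_mul h3 h2 (abs_nonneg _) ((abs_nonneg _).trans h3)
    · exact mul_le_mul h4 h1 (abs_nonneg _) ((abs_nonneg _).trans h4)

end MAE

open Filter Topology Metric
namespace MAE
variable {n : ℕ} {U : Set (EE n)}

def dl (i j : Fin n) : ℝ := if i = j then 1 else 0

lemma sum_dl (c z : Fin n → Fin n → ℝ) : ∑ i, z i i + ∑ i, ∑ j, (c i j - dl i j) * z i j = ∑ i, ∑ j, c i j * z i j := by
  simp only [sub_mul, Finset.sum_sub_distrib, dl, ite_mul, one_mul, zero_mul, Finset.sum_ite_eq, Finset.mem_univ, if_true]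
  ring

noncomputable def qf (c : Fin n → Fin n → EE n → EE n → ℝ) (w : EE n → ℝ) (p p' : EE n) : ℝ :=
  ∑ i, ∑ j, c i j p p' * (pd i (pd j w) p' - pd i (pd j w) p)

lemma baseB (hn : 1 ≤ n) (hU : IsOpen U) {w : EE n → ℝ} (hw : ∀ x ∈ U, ContDiffAt ℝ 2 w x)
    (c : Fin n → Fin n → EE n → EE n → ℝ)
    (hl : ∀ x0 ∈ U, ∃ R > 0, ∃ C, ∀ p ∈ ball x0 R, ∀ p' ∈ ball x0 R,
      (∀ i j, |c i j p p' - dl i j| ≤ 1 / (1000 * n ^ 2)) ∧ |qf c w p p'| ≤ C * ‖p' - p‖) (i j : Fin n) :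
    PH U (pd i (pd j w)) := by
  intro x0 hx0
  obtain ⟨R, hR, C, h⟩ := hl x0 hx0
  obtain ⟨r, hr, hb⟩ := Metric.isOpen_iff.1 hU x0 hx0
  set ρ := min R r / 2 with hρ
  have hρ0 : 0 < ρ := by positivity
  have hb' : ∀ p ∈ ball x0 (2 * ρ), p ∈ ball x0 R ∧ ContDiffAt ℝ 2 w p := fun p hp => by
    rw [hρ, mul_div_cancel₀ _ (by norm_num)] at hp
    exact ⟨ball_subset_ball (min_le_left _ _) hp, hw p (hb (ball_subset_ball (min_le_right _ _) hp))⟩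
  have key := stepB hn (w := w) (x0 := x0) (R := ρ) (C := C) hρ0 (fun p hp => (hb' p hp).2) (fun p hp k hk => ?_)
  · obtain ⟨σ, C', hσ, _, hh⟩ := key
    exact ⟨σ, hσ, C', fun x hx x' hx' => hh x hx x' hx' i j⟩
  have hp2 : p ∈ ball x0 (2 * ρ) := ball_subset_ball (by linarith) hp
  have hp3 : p + k ∈ ball x0 (2 * ρ) := by
    rw [mem_ball_iff_norm] at *
    rw [show p + k - x0 = (p - x0) + k by abel]
    linarith [norm_add_le (p - x0) k]
  obtain ⟨h1, h2⟩ := h p (hb' p hp2).1 (p + k) (hb' _ hp3).1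
  refine ⟨fun i j => c i j p (p + k) - dl i j, h1, ?_⟩
  rw [add_sub_cancel_left] at h2
  rw [sum_dl (fun i j => c i j p (p + k)) (fun i j => hs w (p + k) (ei i) (ei j) - hs w p (ei i) (ei j))]
  simpa only [qf, pd_pd _ _ (hb' p hp2).2, pd_pd _ _ (hb' _ hp3).2] using h2

lemma baseA (hn : 1 ≤ n) (hU : IsOpen U) {w : EE n → ℝ} (hw : ∀ x ∈ U, ContDiffAt ℝ 2 w x)
    (hH : ∀ i j, PH U (pd i (pd j w)))
    (c : Fin n → Fin n → EE n → EE n → ℝ)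
    (hl : ∀ x0 ∈ U, ∃ R > 0, ∃ C, ∀ p h, p + -h ∈ ball x0 R → p ∈ ball x0 R → p + h ∈ ball x0 R →
      (∀ i j, |c i j p (p + h) - dl i j| ≤ 1 / (1000 * n ^ 2)) ∧ (∀ i j, |c i j p (p + h) - c i j (p + -h) p| ≤ C * ‖h‖ ^ (3/4 : ℝ)) ∧
        |qf c w p (p + h) - qf c w (p + -h) p| ≤ C * ‖h‖ ^ (3/2 : ℝ)) (i j : Fin n) :
    P1 U (pd i (pd j w)) := by
  intro x0 hx0
  obtain ⟨R, hR, C, h⟩ := hl x0 hx0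
  obtain ⟨r, hr, hb⟩ := Metric.isOpen_iff.1 hU x0 hx0
  obtain ⟨R', hR', D, hD, hHo⟩ := unif (ι := Fin n × Fin n) (S := fun s ρ C => HoldOn (pd s.1 (pd s.2 w)) x0 ρ C)
    (fun s ρ C ρ' C' _ h1 h2 h => h.mono h1 h2) (fun s => hH s.1 s.2 x0 hx0)
  set ρ := min (min R r) R' / 2 with hρ
  have hρ0 : 0 < ρ := by positivity
  have hb' : ∀ p ∈ ball x0 (2 * ρ), p ∈ ball x0 R ∧ ContDiffAt ℝ 2 w p ∧ p ∈ ball x0 R' := fun p hp => by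
    rw [hρ, mul_div_cancel₀ _ (by norm_num)] at hp
    exact ⟨ball_subset_ball ((min_le_left _ _).trans (min_le_left _ _)) hp,
      hw p (hb (ball_subset_ball ((min_le_left _ _).trans (min_le_right _ _)) hp)), ball_subset_ball (min_le_right _ _) hp⟩
  set C' := D + (|C| + n * (n * (|C| * D))) with hC'
  have hnn : 0 ≤ n * (n * (|C| * D)) := by positivity
  have key := stepA hn (w := w) (x0 := x0) (R := ρ) (C := C') hρ0 (fun p hp => (hb' p hp).2.1) (fun x hx x' hx' k l => ?_) (fun p hp k hk => ?_)
  · obtain ⟨σ, hσ, hh⟩ := key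
    exact hh x0 (mem_ball_self hσ) i j
  · rw [← pd_pd _ _ (hb' x hx).2.1, ← pd_pd _ _ (hb' x' hx').2.1]
    refine (hHo (k, l) x (hb' x hx).2.2 x' (hb' x' hx').2.2).trans ?_
    gcongr; rw [hC']; linarith [abs_nonneg C]
  have hp2 : p ∈ ball x0 (2 * ρ) := ball_subset_ball (by linarith) hp
  have hadd : ∀ k : EE n, ‖k‖ < ρ → p + k ∈ ball x0 (2 * ρ) := fun k hk => by
    rw [mem_ball_iff_norm] at *
    rw [show p + k - x0 = (p - x0) + k by abel]
    linarith [norm_add_le (p - x0) k]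
  have hp3 := hadd k hk
  have hp4 := hadd (-k) (by rwa [norm_neg])
  obtain ⟨h1, h2, h3⟩ := h p k (hb' _ hp4).1 (hb' p hp2).1 (hb' _ hp3).1
  refine ⟨fun i j => c i j p (p + k) - dl i j, h1, ?_⟩
  rw [sum_dl (fun i j => c i j p (p + k)) (fun i j => (hs w (p + k) (ei i) (ei j) - hs w p (ei i) (ei j)) - (hs w p (ei i) (ei j) - hs w (p + -k) (ei i) (ei j)))]
  simp only [← pd_pd _ _ (hb' p hp2).2.1, ← pd_pd _ _ (hb' _ hp3).2.1, ← pd_pd _ _ (hb' _ hp4).2.1]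
  set H : Fin n → Fin n → EE n → ℝ := fun i j => pd i (pd j w) with hHdef
  have e : ∑ i, ∑ j, c i j p (p + k) * ((H i j (p + k) - H i j p) - (H i j p - H i j (p + -k))) =
      (qf c w p (p + k) - qf c w (p + -k) p) - ∑ i, ∑ j, (c i j p (p + k) - c i j (p + -k) p) * (H i j p - H i j (p + -k)) := by
    simp only [qf, ← Finset.sum_sub_distrib]
    exact Finset.sum_congr rfl fun i _ => Finset.sum_congr rfl fun j _ => by ring
  rw [e]
  refine (abs_sub _ _).trans ?_
  have hs2 : |∑ i, ∑ j, (c i j p (p + k) - c i j (p + -k) p) * (H i j p - H i j (p + -k))| ≤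
      ∑ i : Fin n, ∑ j : Fin n, (|C| * D) * ‖k‖ ^ (3/2 : ℝ) := by
    refine (Finset.abs_sum_le_sum_abs _ _).trans (Finset.sum_le_sum fun i _ => (Finset.abs_sum_le_sum_abs _ _).trans (Finset.sum_le_sum fun j _ => ?_))
    rw [abs_mul]
    have t1 := hHo (i, j) (p + -k) (hb' _ hp4).2.2 p (hb' _ hp2).2.2
    rw [show p - (p + -k) = k by abel] at t1
    have t2 : |c i j p (p + k) - c i j (p + -k) p| ≤ |C| * ‖k‖ ^ (3/4 : ℝ) := (h2 i j).trans (by gcongr; exact le_abs_self C)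
    refine (mul_le_mul t2 t1 (abs_nonneg _) (by positivity)).trans (le_of_eq ?_)
    rw [show (3/2 : ℝ) = 3/4 + 3/4 by norm_num, Real.rpow_add_of_nonneg (norm_nonneg k) (by norm_num) (by norm_num)]; ring
  simp only [Finset.sum_const, Finset.card_univ, Fintype.card_fin, nsmul_eq_mul] at hs2
  have h3' : |qf c w p (p + k) - qf c w (p + -k) p| ≤ |C| * ‖k‖ ^ (3/2 : ℝ) := h3.trans (by gcongr; exact le_abs_self C)
  have : 0 ≤ D * ‖k‖ ^ (3/2 : ℝ) := by positivity
  rw [hC']; linarith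

lemma sd_c1h {f : EE n → ℝ} (hU : IsOpen U) (hd : ∀ x ∈ U, DifferentiableAt ℝ f x) (h : ∀ i, PH U (pd i f)) {x0 : EE n} (hx0 : x0 ∈ U) :
    ∃ R > 0, ∃ C, ∀ p h, p + -h ∈ ball x0 R → p ∈ ball x0 R → p + h ∈ ball x0 R →
      |(f (p + h) - f p) - (f p - f (p + -h))| ≤ C * ‖h‖ ^ (3/2 : ℝ) := by
  obtain ⟨R, hR, C, hC, hh⟩ := unif (S := fun i ρ C => HoldOn (pd i f) x0 ρ C) (fun s ρ C ρ' C' _ h1 h2 h => h.mono h1 h2) (fun i => h i x0 hx0)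
  obtain ⟨r, hr, hb⟩ := Metric.isOpen_iff.1 hU x0 hx0
  refine ⟨min (min R r) (1/2), by positivity, n * C, fun p h hm hp hpl => ?_⟩
  set ρ := min (min R r) (1/2) with hρ
  have hρR : ρ ≤ R := (min_le_left _ _).trans (min_le_left _ _)
  have hρr : ρ ≤ r := (min_le_left _ _).trans (min_le_right _ _)
  have hn1 : ‖h‖ ≤ 1 := by
    have := norm_lt_of_ball hp hpl
    rw [add_sub_cancel_left] at this
    linarith [min_le_right (min R r) (1/2)]
  have seg1 : ∀ y ∈ segment ℝ (p + -h) p, y ∈ ball x0 ρ := fun y hy => (convex_ball x0 ρ).segment_subset hm hp hy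
  have seg2 : ∀ y ∈ segment ℝ (p + -h) p, y + h ∈ ball x0 ρ := fun y hy => by
    refine (convex_ball x0 ρ).segment_subset hp hpl ?_
    obtain ⟨a, b, ha, hb, hab, rfl⟩ := hy
    refine ⟨a, b, ha, hb, hab, ?_⟩
    have : b = 1 - a := by linarith
    subst this; module
  have d1 : ∀ y ∈ segment ℝ (p + -h) p, DifferentiableAt ℝ (fun y => f (y + h)) y := fun y hy =>
    (differentiableAt_comp_add_right _).2 (hd _ (hb (ball_subset_ball hρr (seg2 y hy))))
  have d0 : ∀ y ∈ segment ℝ (p + -h) p, DifferentiableAt ℝ f y := fun y hy => hd _ (hb (ball_subset_ball hρr (seg1 y hy)))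
  have mv := (convex_segment (p + -h) p).norm_image_sub_le_of_norm_fderiv_le (𝕜 := ℝ) (f := fun y => f (y + h) - f y) (C := n * (C * ‖h‖ ^ (3/4 : ℝ)))
    (fun y hy => (d1 y hy).sub (d0 y hy)) (fun y hy => norm_le_of_ei _ fun k => ?_) (left_mem_segment ℝ _ _) (right_mem_segment ℝ _ _)
  · rw [show p - (p + -h) = h by abel, show p + -h + h = p by abel, Real.norm_eq_abs] at mv
    refine mv.trans ?_
    rw [mul_assoc, mul_assoc, mul_assoc]
    gcongr
    rcases eq_or_ne h 0 with rfl | h0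
    · simp
    have hp := norm_pos_iff.2 h0
    nth_rewrite 2 [← Real.rpow_one ‖h‖]
    rw [← Real.rpow_add hp]
    exact Real.rpow_le_rpow_of_exponent_ge hp hn1 (by norm_num)
  · change |pd k _ y| ≤ _
    rw [pd_sub k (d1 y hy) (d0 y hy), pd_comp_add]
    have := hh k y (ball_subset_ball hρR (seg1 y hy)) (y + h) (ball_subset_ball hρR (seg2 y hy))
    rwa [add_sub_cancel_left] at this

end MAE

open Filter Topology Metric
namespace MAE
variable {n : ℕ} {U : Set (EE n)}

lemma qf_lin {b : Fin n → Fin n → EE n → ℝ} {w F : EE n → ℝ} {p p' : EE n}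
    (h : ∑ i, ∑ j, b i j p * pd i (pd j w) p = F p) (h' : ∑ i, ∑ j, b i j p' * pd i (pd j w) p' = F p') :
    qf (fun i j _ q => b i j q) w p p' = F p' - F p - ∑ i, ∑ j, (b i j p' - b i j p) * pd i (pd j w) p := by
  rw [← h, ← h', qf]
  simp only [← Finset.sum_sub_distrib]
  exact Finset.sum_congr rfl fun i _ => Finset.sum_congr rfl fun j _ => by ring

lemma abs_dsum_le {z : Fin n → Fin n → ℝ} {B : ℝ} (h : ∀ i j, |z i j| ≤ B) : |∑ i, ∑ j, z i j| ≤ n * (n * B) := by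
  refine (Finset.abs_sum_le_sum_abs _ _).trans ((Finset.sum_le_sum fun i _ => (Finset.abs_sum_le_sum_abs _ _).trans (Finset.sum_le_sum fun j _ => h i j)).trans ?_)
  simp

lemma linB (hn : 1 ≤ n) (hU : IsOpen U) {b : Fin n → Fin n → EE n → ℝ} {w F : EE n → ℝ}
    (hs : ∀ x ∈ U, ∀ i j, |b i j x - dl i j| ≤ 1 / (1000 * n ^ 2))
    (hw : Cl U (PC U) 2 w) (hb : ∀ i j, Cl U (PC U) 1 (b i j)) (hF : Cl U (PC U) 1 F)
    (he : ∀ x ∈ U, ∑ i, ∑ j, b i j x * pd i (pd j w) x = F x) : Cl U (PH U) 2 w := by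
  refine ⟨hw.1, fun j => ⟨(hw.2 j).1, fun i => ?_⟩⟩
  refine baseB hn hU (fun x hx => by exact_mod_cast hw.contDiffAt hU good_PC hx) (fun i j _ q => b i j q) (fun x0 hx0 => ?_) i j
  obtain ⟨r, hr, hrU⟩ := Metric.isOpen_iff.1 hU x0 hx0
  obtain ⟨R1, hR1, C1, hC1, h1⟩ := unif (ι := Fin n × Fin n) (S := fun s ρ C => LipOn (b s.1 s.2) x0 ρ C)
    (fun s ρ C ρ' C' _ h1 h2 h => h.mono h1 h2) (fun s => lip_c1 (by exact_mod_cast (hb s.1 s.2).contDiffAt hU good_PC hx0))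
  obtain ⟨R2, hR2, C2, hC2, h2⟩ := unif (ι := Fin n × Fin n) (S := fun s ρ C => ∀ x ∈ ball x0 ρ, |pd s.1 (pd s.2 w) x| ≤ C)
    (fun s ρ C ρ' C' _ h1 h2 h => fun x hx => (h x (ball_subset_ball h1 hx)).trans h2)
    (fun s => bd_cont (((hw.2 s.2).2 s.1).continuousAt (hU.mem_nhds hx0)))
  obtain ⟨R3, hR3, C3, h3⟩ := lip_c1 (f := F) (x0 := x0) (by exact_mod_cast hF.contDiffAt hU good_PC hx0)
  refine ⟨min (min r R1) (min R2 R3), by positivity, C3 + n * (n * (C1 * C2)), fun p hp p' hp' => ?_⟩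
  have s1 : min (min r R1) (min R2 R3) ≤ r := (min_le_left _ _).trans (min_le_left _ _)
  have s2 : min (min r R1) (min R2 R3) ≤ R1 := (min_le_left _ _).trans (min_le_right _ _)
  have s3 : min (min r R1) (min R2 R3) ≤ R2 := (min_le_right _ _).trans (min_le_left _ _)
  have s4 : min (min r R1) (min R2 R3) ≤ R3 := (min_le_right _ _).trans (min_le_right _ _)
  refine ⟨hs p' (hrU (ball_subset_ball s1 hp')), ?_⟩
  rw [qf_lin (he p (hrU (ball_subset_ball s1 hp))) (he p' (hrU (ball_subset_ball s1 hp')))]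
  refine (abs_sub _ _).trans ?_
  have := abs_dsum_le (z := fun i j => (b i j p' - b i j p) * pd i (pd j w) p) (B := C1 * ‖p' - p‖ * C2) fun i j => by
    rw [abs_mul]
    exact mul_le_mul (h1 (i, j) p (ball_subset_ball s2 hp) p' (ball_subset_ball s2 hp')) (h2 (i, j) p (ball_subset_ball s3 hp)) (abs_nonneg _) (by positivity)
  have := h3 p (ball_subset_ball s4 hp) p' (ball_subset_ball s4 hp')
  linarith

lemma linA (hn : 1 ≤ n) (hU : IsOpen U) {b : Fin n → Fin n → EE n → ℝ} {w F : EE n → ℝ}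
    (hs : ∀ x ∈ U, ∀ i j, |b i j x - dl i j| ≤ 1 / (1000 * n ^ 2))
    (hw : Cl U (PH U) 2 w) (hb : ∀ i j, Cl U (PH U) 1 (b i j)) (hF : Cl U (PH U) 1 F)
    (he : ∀ x ∈ U, ∑ i, ∑ j, b i j x * pd i (pd j w) x = F x) : Cl U (P1 U) 2 w := by
  have gP := good_PH hU
  refine ⟨hw.1, fun j => ⟨(hw.2 j).1, fun i => ?_⟩⟩
  refine baseA hn hU (fun x hx => by exact_mod_cast hw.contDiffAt hU gP hx) (fun i j => (hw.2 j).2 i) (fun i j _ q => b i j q) (fun x0 hx0 => ?_) i j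
  obtain ⟨r, hr, hrU⟩ := Metric.isOpen_iff.1 hU x0 hx0
  obtain ⟨R1, hR1, C1, hC1, h1⟩ := unif (ι := Fin n × Fin n) (S := fun s ρ C => HoldOn (b s.1 s.2) x0 ρ C)
    (fun s ρ C ρ' C' _ h1 h2 h => h.mono h1 h2) (fun s => (hb s.1 s.2).mono hU gP x0 hx0)
  obtain ⟨R2, hR2, C2, hC2, h2⟩ := unif (ι := Fin n × Fin n) (S := fun s ρ C => (∀ x ∈ ball x0 ρ, |pd s.1 (pd s.2 w) x| ≤ C))
    (fun s ρ C ρ' C' _ h1 h2 h => fun x hx => (h x (ball_subset_ball h1 hx)).trans h2)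
    (fun s => bd_cont (PH.contAt ((hw.2 s.2).2 s.1) hx0))
  obtain ⟨R4, hR4, C4, hC4, h4⟩ := unif (ι := Fin n × Fin n) (S := fun s ρ C => HoldOn (pd s.1 (pd s.2 w)) x0 ρ C)
    (fun s ρ C ρ' C' _ h1 h2 h => h.mono h1 h2) (fun s => (hw.2 s.2).2 s.1 x0 hx0)
  obtain ⟨R5, hR5, C5, hC5, h5⟩ := unif (ι := Fin n × Fin n) (S := fun s ρ C => ∀ p h, p + -h ∈ ball x0 ρ → p ∈ ball x0 ρ → p + h ∈ ball x0 ρ →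
      |(b s.1 s.2 (p + h) - b s.1 s.2 p) - (b s.1 s.2 p - b s.1 s.2 (p + -h))| ≤ C * ‖h‖ ^ (3/2 : ℝ))
    (fun s ρ C ρ' C' _ h1 h2 hh => fun p h k1 k2 k3 =>
      (hh p h (ball_subset_ball h1 k1) (ball_subset_ball h1 k2) (ball_subset_ball h1 k3)).trans (by gcongr)) (fun s => sd_c1h hU (hb s.1 s.2).1 (hb s.1 s.2).2 hx0)
  obtain ⟨R3, hR3, C3, h3⟩ := sd_c1h hU hF.1 hF.2 hx0
  set ρ := min (min r R1) (min (min R2 R3) (min R4 R5)) with hρ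
  have s1 : ρ ≤ r := (min_le_left _ _).trans (min_le_left _ _)
  have s2 : ρ ≤ R1 := (min_le_left _ _).trans (min_le_right _ _)
  have s3 : ρ ≤ R2 := (min_le_right _ _).trans ((min_le_left _ _).trans (min_le_left _ _))
  have s4 : ρ ≤ R3 := (min_le_right _ _).trans ((min_le_left _ _).trans (min_le_right _ _))
  have s5 : ρ ≤ R4 := (min_le_right _ _).trans ((min_le_right _ _).trans (min_le_left _ _))
  have s6 : ρ ≤ R5 := (min_le_right _ _).trans ((min_le_right _ _).trans (min_le_right _ _))
  refine ⟨ρ, by positivity, C1 + (|C3| + n * (n * (C5 * C2 + C1 * C4))), fun p h hm hp hpl => ⟨hs _ (hrU (ball_subset_ball s1 hpl)), fun i j => ?_, ?_⟩⟩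
  · refine (h1 (i, j) p (ball_subset_ball s2 hp) (p + h) (ball_subset_ball s2 hpl)).trans ?_
    rw [add_sub_cancel_left]
    have : 0 ≤ |C3| + n * (n * (C5 * C2 + C1 * C4)) := by positivity
    gcongr; linarith
  have em := he _ (hrU (ball_subset_ball s1 hm))
  have e0 := he _ (hrU (ball_subset_ball s1 hp))
  rw [qf_lin e0 (he _ (hrU (ball_subset_ball s1 hpl))), qf_lin em e0]
  have e : F (p + h) - F p - ∑ i, ∑ j, (b i j (p + h) - b i j p) * pd i (pd j w) p -
      (F p - F (p + -h) - ∑ i, ∑ j, (b i j p - b i j (p + -h)) * pd i (pd j w) (p + -h)) =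
      ((F (p + h) - F p) - (F p - F (p + -h))) - ∑ i, ∑ j, (((b i j (p + h) - b i j p) - (b i j p - b i j (p + -h))) * pd i (pd j w) p
        + (b i j p - b i j (p + -h)) * (pd i (pd j w) p - pd i (pd j w) (p + -h))) := by
    have : ∀ A B C D E : ℝ, D - C = -E → A - C - (B - D) = (A - B) - E := fun A B C D E hh => by linarith
    refine this _ _ _ _ _ ?_
    simp only [← Finset.sum_sub_distrib, ← Finset.sum_neg_distrib]
    exact Finset.sum_congr rfl fun i _ => Finset.sum_congr rfl fun j _ => by ring
  rw [e]
  refine (abs_sub _ _).trans ?_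
  have t1 := abs_dsum_le (z := fun i j => ((b i j (p + h) - b i j p) - (b i j p - b i j (p + -h))) * pd i (pd j w) p
        + (b i j p - b i j (p + -h)) * (pd i (pd j w) p - pd i (pd j w) (p + -h))) (B := (C5 * C2 + C1 * C4) * ‖h‖ ^ (3/2 : ℝ)) fun i j => by
    have k1 := h5 (i, j) p h (ball_subset_ball s6 hm) (ball_subset_ball s6 hp) (ball_subset_ball s6 hpl)
    have k2 := h2 (i, j) p (ball_subset_ball s3 hp)
    have k3 := h1 (i, j) (p + -h) (ball_subset_ball s2 hm) p (ball_subset_ball s2 hp)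
    have k4 := h4 (i, j) (p + -h) (ball_subset_ball s5 hm) p (ball_subset_ball s5 hp)
    rw [show p - (p + -h) = h by abel] at k3 k4
    have hq : ‖h‖ ^ (3/2 : ℝ) = ‖h‖ ^ (3/4 : ℝ) * ‖h‖ ^ (3/4 : ℝ) := by
      rw [← Real.rpow_add_of_nonneg (norm_nonneg h) (by norm_num) (by norm_num)]; norm_num
    refine (abs_add_le _ _).trans ?_
    rw [abs_mul, abs_mul, add_mul]
    refine add_le_add ?_ ?_
    · exact (mul_le_mul k1 k2 (abs_nonneg _) (by positivity)).trans (le_of_eq (by ring))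
    · exact (mul_le_mul k3 k4 (abs_nonneg _) (by positivity)).trans (le_of_eq (by rw [hq]; ring))
  have t2 := h3 p h (ball_subset_ball s4 hm) (ball_subset_ball s4 hp) (ball_subset_ball s4 hpl)
  have t3 : C3 * ‖h‖ ^ (3/2 : ℝ) ≤ |C3| * ‖h‖ ^ (3/2 : ℝ) := by gcongr; exact le_abs_self _
  have t4 : 0 ≤ C1 * ‖h‖ ^ (3/2 : ℝ) := by positivity
  linarith

lemma lin_induct (hU : IsOpen U) {P Q : (EE n → ℝ) → Prop} (hP : Good U P) {b : Fin n → Fin n → EE n → ℝ}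
    (base : ∀ w F : EE n → ℝ, Cl U P 2 w → (∀ i j, Cl U P 1 (b i j)) → Cl U P 1 F →
      (∀ x ∈ U, ∑ i, ∑ j, b i j x * pd i (pd j w) x = F x) → Cl U Q 2 w) :
    ∀ (k : ℕ) (w F : EE n → ℝ), Cl U P (k + 2) w → (∀ i j, Cl U P (k + 1) (b i j)) → Cl U P (k + 1) F →
      (∀ x ∈ U, ∑ i, ∑ j, b i j x * pd i (pd j w) x = F x) → Cl U Q (k + 2) w
  | 0, w, F, hw, hb, hF, he => base w F hw hb hF he
  | k + 1, w, F, hw, hb, hF, he => by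
    refine ⟨hw.1, fun l => ?_⟩
    have hH : ∀ i j, Cl U P (k + 1) (pd i (pd j w)) := fun i j => (hw.2 j).2 i
    refine lin_induct hU hP base k (pd l w) (fun x => pd l F x - ∑ i, ∑ j, pd l (b i j) x * pd i (pd j w) x) (hw.2 l)
      (fun i j => (hb i j).mono hU hP) ?_ ?_
    · exact Cl.sub hU hP (hF.2 l) (Cl.sum hU hP _ fun i => Cl.sum hU hP _ fun j => Cl.mul hU hP ((hb i j).2 l) (hH i j))
    · intro x hx
      have e1 := pd_congr_on hU l he x hx
      have hdb : ∀ i j, DifferentiableAt ℝ (b i j) x := fun i j => (hb i j).1 x hx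
      have hdH : ∀ i j, DifferentiableAt ℝ (pd i (pd j w)) x := fun i j => (hH i j).1 x hx
      rw [pd_sum _ l fun i _ => DifferentiableAt.fun_sum fun j _ => (hdb i j).fun_mul (hdH i j)] at e1
      have e2 : ∀ i, pd l (fun y => ∑ j, b i j y * pd i (pd j w) y) x = ∑ j, (b i j x * pd l (pd i (pd j w)) x + pd i (pd j w) x * pd l (b i j) x) := fun i => by
        rw [pd_sum _ l fun j _ => (hdb i j).fun_mul (hdH i j)]
        exact Finset.sum_congr rfl fun j _ => pd_mul l (hdb i j) (hdH i j)
      simp only [e2] at e1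
      have hc : ∀ i j, pd l (pd i (pd j w)) x = pd i (pd j (pd l w)) x := fun i j => by
        have c2 : ∀ j, ∀ y ∈ U, ContDiffAt ℝ 2 (pd j w) y := fun j y hy =>
          ((hw.2 j).contDiffAt hU hP hy).of_le (by norm_cast; omega)
        have c3 : ∀ y ∈ U, ContDiffAt ℝ 2 w y := fun y hy => (hw.contDiffAt hU hP hy).of_le (by norm_cast; omega)
        rw [pd_comm l i (c2 j x hx)]
        exact pd_congr_on hU i (fun y hy => pd_comm l j (c3 y hy)) x hx
      simp only [hc] at e1
      rw [← e1, ← Finset.sum_sub_distrib]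
      refine Finset.sum_congr rfl fun i _ => ?_
      rw [← Finset.sum_sub_distrib]
      exact Finset.sum_congr rfl fun j _ => by ring

end MAE

open Filter Topology Metric
namespace MAE
variable {n : ℕ} {U : Set (EE n)}

lemma hadamard {σ : Type*} [Fintype σ] [DecidableEq σ] (q : MvPolynomial σ ℝ) : ∃ c : σ → MvPolynomial (σ ⊕ σ) ℝ, ∀ X Y : σ → ℝ,
    MvPolynomial.eval Y q - MvPolynomial.eval X q = ∑ s, MvPolynomial.eval (Sum.elim X Y) (c s) * (Y s - X s) := by
  induction q using MvPolynomial.induction_on with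
  | C a => exact ⟨0, by simp⟩
  | add p q hp hq =>
    obtain ⟨c, hc⟩ := hp
    obtain ⟨d, hd⟩ := hq
    refine ⟨fun s => c s + d s, fun X Y => ?_⟩
    simp only [map_add, add_mul, Finset.sum_add_distrib, ← hc, ← hd]; ring
  | mul_X p t hp =>
    obtain ⟨c, hc⟩ := hp
    refine ⟨fun s => c s * MvPolynomial.X (Sum.inr t) + if s = t then MvPolynomial.rename Sum.inl p else 0, fun X Y => ?_⟩
    have : ∀ s, MvPolynomial.eval (Sum.elim X Y) (c s * MvPolynomial.X (Sum.inr t) + if s = t then MvPolynomial.rename Sum.inl p else 0) * (Y s - X s)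
       = MvPolynomial.eval (Sum.elim X Y) (c s) * (Y s - X s) * Y t + if s = t then MvPolynomial.eval X p * (Y s - X s) else 0 := fun s => by
      split_ifs with h
      · simp [MvPolynomial.eval_rename, add_mul]; ring
      · simp; ring
    simp only [this, Finset.sum_add_distrib, ← Finset.sum_mul, ← hc, Finset.sum_ite_eq', Finset.mem_univ, if_true, map_mul, MvPolynomial.eval_X]
    ring

noncomputable def detP (n : ℕ) : MvPolynomial (Fin n × Fin n) ℝ :=
  (Matrix.of fun i j => MvPolynomial.C (dl i j) + MvPolynomial.X (i, j)).det

lemma dl_eq : (Matrix.of fun i j : Fin n => dl i j) = (1 : Matrix (Fin n) (Fin n) ℝ) := by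
  ext i j; simp [dl, Matrix.one_apply]

lemma eval_detP (X : Fin n × Fin n → ℝ) : MvPolynomial.eval X (detP n) = (1 + Matrix.of fun i j => X (i, j)).det := by
  rw [detP, RingHom.map_det, ← dl_eq]
  congr 1
  ext i j
  simp

lemma had_zero (c : Fin n × Fin n → MvPolynomial ((Fin n × Fin n) ⊕ (Fin n × Fin n)) ℝ)
    (hc : ∀ X Y, MvPolynomial.eval Y (detP n) - MvPolynomial.eval X (detP n) = ∑ s, MvPolynomial.eval (Sum.elim X Y) (c s) * (Y s - X s))
    (i j : Fin n) : MvPolynomial.eval 0 (c (i, j)) = dl i j := by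
  set M : Matrix (Fin n) (Fin n) ℝ := Matrix.single i j 1 with hM
  set q := (Matrix.det (1 + (Polynomial.X : Polynomial ℝ) • M.map Polynomial.C)).divX.divX with hq
  have h1 : ∀ t : ℝ, t ≠ 0 → MvPolynomial.eval (Sum.elim 0 (Pi.single (i, j) t)) (c (i, j)) = dl i j + q.eval t * t := by
    intro t ht
    have := hc 0 (Pi.single (i, j) t)
    have e1 : (1 + Matrix.of fun k l => (Pi.single (i, j) t : Fin n × Fin n → ℝ) (k, l)) = 1 + t • M := by
      congr 1
      ext k l
      simp [hM, Matrix.single_apply, Pi.single_apply, Prod.ext_iff, eq_comm]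
    have e0 : (1 + Matrix.of fun k l => (0 : Fin n × Fin n → ℝ) (k, l)) = 1 := by ext k l; simp
    rw [eval_detP, eval_detP, e1, e0, Matrix.det_one, Matrix.det_one_add_smul, ← hq, Finset.sum_eq_single (i, j)] at this
    · have tr : M.trace = dl i j := by
        by_cases h : i = j
        · subst h; simp [hM, dl]
        · simp [hM, dl, h]
      rw [tr] at this
      simp only [Pi.single_eq_same, Pi.zero_apply, sub_zero] at this
      have h2 : t * (MvPolynomial.eval (Sum.elim 0 (Pi.single (i, j) t)) (c (i, j)) - (dl i j + q.eval t * t)) = 0 := by linarith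
      rcases mul_eq_zero.1 h2 with h3 | h3
      · exact absurd h3 ht
      · linarith
    · intro s _ hs; simp [hs]
    · simp
  have c1 : Continuous fun t : ℝ => MvPolynomial.eval (Sum.elim 0 (Pi.single (i, j) t)) (c (i, j)) := by
    refine (MvPolynomial.continuous_eval (c (i, j))).comp (continuous_pi fun s => ?_)
    rcases s with s | s
    · exact continuous_const
    · exact (continuous_apply s).comp (continuous_single (A := fun _ => ℝ) (i, j))
  have c2 : Continuous fun t : ℝ => dl i j + q.eval t * t := by fun_prop
  have := tendsto_nhds_unique (((c1.tendsto 0).mono_left (nhdsWithin_le_nhds (s := {0}ᶜ))).congr' (by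
    filter_upwards [self_mem_nhdsWithin] with t ht using h1 t ht)) ((c2.tendsto 0).mono_left nhdsWithin_le_nhds)
  simp only [Pi.single_zero, mul_zero, add_zero] at this
  rw [← this]; congr 1
  congr 1
  ext s; rcases s <;> rfl

lemma polyLip {τ : Type*} (q : MvPolynomial τ ℝ) : ∃ C, 0 ≤ C ∧ (∀ z : τ → ℝ, (∀ t, |z t| ≤ 1) → |MvPolynomial.eval z q| ≤ C) ∧
    ∀ (z z' : τ → ℝ) (η : ℝ), (∀ t, |z t| ≤ 1) → (∀ t, |z' t| ≤ 1) → 0 ≤ η → (∀ t, |z' t - z t| ≤ η) →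
      |MvPolynomial.eval z' q - MvPolynomial.eval z q| ≤ C * η := by
  induction q using MvPolynomial.induction_on with
  | C a => exact ⟨|a|, abs_nonneg _, by simp, fun z z' η _ _ h _ => by simp; positivity⟩
  | add p q hp hq =>
    obtain ⟨A, hA, hA1, hA2⟩ := hp
    obtain ⟨B, hB, hB1, hB2⟩ := hq
    refine ⟨A + B, by positivity, fun z hz => ?_, fun z z' η hz hz' h0 h => ?_⟩
    · rw [map_add]; exact (abs_add_le _ _).trans (add_le_add (hA1 z hz) (hB1 z hz))
    · rw [map_add, map_add, add_sub_add_comm, add_mul]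
      exact (abs_add_le _ _).trans (add_le_add (hA2 z z' η hz hz' h0 h) (hB2 z z' η hz hz' h0 h))
  | mul_X p s hp =>
    obtain ⟨A, hA, hA1, hA2⟩ := hp
    refine ⟨A + A, by positivity, fun z hz => ?_, fun z z' η hz hz' h0 h => ?_⟩
    · rw [map_mul, MvPolynomial.eval_X, abs_mul]
      have := mul_le_mul (hA1 z hz) (hz s) (abs_nonneg _) hA
      linarith
    · simp only [map_mul, MvPolynomial.eval_X]
      rw [show MvPolynomial.eval z' p * z' s - MvPolynomial.eval z p * z s = (MvPolynomial.eval z' p - MvPolynomial.eval z p) * z' s + MvPolynomial.eval z p * (z' s - z s) by ring, add_mul]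
      refine (abs_add_le _ _).trans (add_le_add ?_ ?_) <;> rw [abs_mul]
      · have := mul_le_mul (hA2 z z' η hz hz' h0 h) (hz' s) (abs_nonneg _) (by positivity)
        linarith
      · exact mul_le_mul (hA1 z hz) (h s) (abs_nonneg _) hA

lemma Cl.P1_PC : ∀ {k : ℕ} {f : EE n → ℝ}, Cl U (P1 U) k f → Cl U (PC U) (k + 1) f
  | 0, f, h => ⟨fun x hx => (h x hx).differentiableAt (by simp), fun i x hx =>
      (contDiffAt_pd (k := 0) i (by exact_mod_cast h x hx)).continuousAt.continuousWithinAt⟩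
  | k + 1, f, h => ⟨h.1, fun i => Cl.P1_PC (h.2 i)⟩

theorem reg (hn : 1 ≤ n) {m : ℕ} (hm : 2 ≤ m) : ∃ δ > 0, δ ≤ 1 ∧ ∀ (U : Set (EE n)) (v G : EE n → ℝ), IsOpen U →
    (∀ x ∈ U, ContDiffAt ℝ 2 v x) → (∀ x ∈ U, ∀ i j, |pd i (pd j v) x| ≤ δ) →
    (∀ x ∈ U, (1 + Matrix.of fun i j => pd i (pd j v) x).det = G x) → (∀ x ∈ U, ContDiffAt ℝ m G x) →
    ∀ x ∈ U, ContDiffAt ℝ (m + 1 : ℕ) v x := by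
  obtain ⟨c, hc⟩ := hadamard (detP n)
  have h0 := had_zero c hc
  have hev : ∀ᶠ z in 𝓝 (0 : (Fin n × Fin n) ⊕ (Fin n × Fin n) → ℝ), ∀ s : Fin n × Fin n, |MvPolynomial.eval z (c s) - dl s.1 s.2| < 1 / (1000 * n ^ 2) := by
    refine eventually_all.2 fun s => ?_
    have : Continuous fun z => |MvPolynomial.eval z (c s) - dl s.1 s.2| := ((MvPolynomial.continuous_eval (c s)).sub continuous_const).abs
    refine this.continuousAt.eventually_lt continuousAt_const ?_
    rw [h0 s.1 s.2, sub_self, abs_zero]; positivity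
  obtain ⟨δ, hδ, hb⟩ := Metric.eventually_nhds_iff_ball.1 hev
  refine ⟨min (δ/2) 1, by positivity, min_le_right _ _, fun U v G hU hv hvδ hdet hG => ?_⟩
  set X : EE n → Fin n × Fin n → ℝ := fun x s => pd s.1 (pd s.2 v) x with hX
  have hX1 : ∀ x ∈ U, ∀ s, |X x s| ≤ 1 := fun x hx s => (hvδ x hx _ _).trans (min_le_right _ _)
  have hsm : ∀ x ∈ U, ∀ y ∈ U, ∀ i j, |MvPolynomial.eval (Sum.elim (X x) (X y)) (c (i, j)) - dl i j| ≤ 1 / (1000 * n ^ 2) := fun x hx y hy i j => by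
    refine (hb _ ?_ (i, j)).le
    rw [mem_ball_zero_iff]
    refine ((pi_norm_le_iff_of_nonneg (by positivity)).2 fun s => ?_).trans_lt (half_lt_self hδ)
    rcases s with s | s
    · exact (hvδ x hx _ _).trans (min_le_left _ _)
    · exact (hvδ y hy _ _).trans (min_le_left _ _)
  have hG' : ∀ x ∈ U, MvPolynomial.eval (X x) (detP n) = G x := fun x hx => by rw [eval_detP, ← hdet x hx]
  set cc : Fin n → Fin n → EE n → EE n → ℝ := fun i j p p' => MvPolynomial.eval (Sum.elim (X p) (X p')) (c (i, j)) with hcc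
  have hqf : ∀ p ∈ U, ∀ p' ∈ U, qf cc v p p' = G p' - G p := fun p hp p' hp' => by
    rw [← hG' p hp, ← hG' p' hp', hc, Fintype.sum_prod_type]; rfl
  have hG1 : ∀ x ∈ U, ContDiffAt ℝ 1 G x := fun x hx => (hG x hx).of_le (by norm_cast; omega)
  have hH : ∀ i j, PH U (pd i (pd j v)) := baseB hn hU hv cc fun x0 hx0 => by
    obtain ⟨r, hr, hrU⟩ := Metric.isOpen_iff.1 hU x0 hx0
    obtain ⟨R, hR, C, h⟩ := lip_c1 (hG1 x0 hx0)
    refine ⟨min r R, lt_min hr hR, C, fun p hp p' hp' => ?_⟩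
    have u1 := hrU (ball_subset_ball (min_le_left _ _) hp)
    have u2 := hrU (ball_subset_ball (min_le_left _ _) hp')
    refine ⟨hsm p u1 p' u2, ?_⟩
    rw [hqf p u1 p' u2]
    exact h p (ball_subset_ball (min_le_right _ _) hp) p' (ball_subset_ball (min_le_right _ _) hp')
  have hGH : Cl U (PH U) 1 G := Cl.of_contDiff (good_PH hU) fun x hx => (hG x hx).of_le (by norm_cast)
  have hP1 : ∀ i j, P1 U (pd i (pd j v)) := baseA hn hU hv hH cc fun x0 hx0 => by
    obtain ⟨r, hr, hrU⟩ := Metric.isOpen_iff.1 hU x0 hx0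
    obtain ⟨R3, hR3, C3, h3⟩ := sd_c1h hU hGH.1 hGH.2 hx0
    obtain ⟨R4, hR4, C4, hC4, h4⟩ := unif (ι := Fin n × Fin n) (S := fun s ρ C => HoldOn (pd s.1 (pd s.2 v)) x0 ρ C)
      (fun s ρ C ρ' C' _ h1 h2 h => h.mono h1 h2) (fun s => hH s.1 s.2 x0 hx0)
    choose L hL0 _ hL using fun s => polyLip (c s)
    obtain ⟨M, hM⟩ := Finite.exists_le L
    refine ⟨min (min r R3) R4, by positivity, max C3 (M * C4), fun p h hm hp hpl => ?_⟩
    have s1 : min (min r R3) R4 ≤ r := (min_le_left _ _).trans (min_le_left _ _)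
    have s2 : min (min r R3) R4 ≤ R3 := (min_le_left _ _).trans (min_le_right _ _)
    have s3 : min (min r R3) R4 ≤ R4 := min_le_right _ _
    have um := hrU (ball_subset_ball s1 hm)
    have u0 := hrU (ball_subset_ball s1 hp)
    have up := hrU (ball_subset_ball s1 hpl)
    refine ⟨hsm p u0 _ up, fun i j => ?_, ?_⟩
    · refine (hL (i, j) (Sum.elim (X (p + -h)) (X p)) (Sum.elim (X p) (X (p + h))) (C4 * ‖h‖ ^ (3/4 : ℝ)) ?_ ?_ (by positivity) ?_).trans ?_
      · rintro (s | s); exacts [hX1 _ um s, hX1 _ u0 s]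
      · rintro (s | s); exacts [hX1 _ u0 s, hX1 _ up s]
      · rintro (s | s)
        · have := h4 s (p + -h) (ball_subset_ball s3 hm) p (ball_subset_ball s3 hp)
          rwa [show p - (p + -h) = h by abel] at this
        · have := h4 s p (ball_subset_ball s3 hp) (p + h) (ball_subset_ball s3 hpl)
          rwa [add_sub_cancel_left] at this
      · rw [← mul_assoc]
        gcongr
        exact (mul_le_mul_of_nonneg_right (hM (i, j)) hC4.le).trans (le_max_right _ _)
    · rw [hqf _ u0 _ up, hqf _ um _ u0]
      refine (h3 p h (ball_subset_ball s2 hm) (ball_subset_ball s2 hp) (ball_subset_ball s2 hpl)).trans ?_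
      gcongr; exact le_max_left _ _
  have hC3 : Cl U (PC U) 3 v := Cl.P1_PC ⟨fun x hx => (hv x hx).differentiableAt (by simp), fun j => ⟨fun x hx => differentiableAt_pd j (hv x hx), fun i => hP1 i j⟩⟩
  have gC : Good U (PC U) := good_PC
  have gH := good_PH hU
  set b : Fin n → Fin n → EE n → ℝ := fun i j x => MvPolynomial.eval (Sum.elim (X x) (X x)) (c (i, j)) with hbdef
  have heq : ∀ e, ∀ x ∈ U, ∑ i, ∑ j, b i j x * pd i (pd j (pd e v)) x = pd e G x := by
    intro e x hx
    have hdX : ∀ s : Fin n × Fin n, DifferentiableAt ℝ (fun y => X y s) x := fun s => (hP1 s.1 s.2 x hx).differentiableAt (by simp)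
    have hC1 : ∀ s, DifferentiableAt ℝ (fun y => MvPolynomial.eval (Sum.elim (X x) (X y)) (c s)) x := fun s => by
      have := Cl.poly (k := 0) hU (good_P1 hU) (f := fun t y => Sum.elim (X x) (X y) t) (fun t => ?_) (c s)
      · exact ContDiffAt.differentiableAt (this x hx) (by simp)
      · rcases t with t | t
        · exact Cl.const (k := 0) (good_P1 hU) (X x t)
        · exact hP1 t.1 t.2
    have e1 : ∀ y ∈ U, G y = G x + ∑ s, MvPolynomial.eval (Sum.elim (X x) (X y)) (c s) * (X y s - X x s) := fun y hy => by
      rw [← hc, hG' y hy, hG' x hx]; ring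
    have hd2 : ∀ s ∈ (Finset.univ : Finset (Fin n × Fin n)), DifferentiableAt ℝ (fun y => MvPolynomial.eval (Sum.elim (X x) (X y)) (c s) * (X y s - X x s)) x :=
      fun s _ => (hC1 s).fun_mul ((hdX s).fun_sub (differentiableAt_const _))
    rw [pd_congr_on hU e e1 x hx, pd_add e (differentiableAt_const _) (DifferentiableAt.fun_sum hd2), pd_const, zero_add, pd_sum _ e hd2, Fintype.sum_prod_type]
    refine Finset.sum_congr rfl fun i _ => Finset.sum_congr rfl fun j _ => ?_
    rw [pd_mul e (hC1 _) ((hdX _).fun_sub (differentiableAt_const _)), sub_self, zero_mul, add_zero, pd_sub e (hdX _) (differentiableAt_const _), pd_const, sub_zero]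
    congr 1
    have c2 : ContDiffAt ℝ 2 (pd j v) x := by exact_mod_cast (hC3.2 j).contDiffAt hU gC hx
    change _ = pd e (pd i (pd j v)) x
    rw [pd_comm e i c2]
    exact (pd_congr_on hU i (fun y hy => pd_comm e j (hv y hy)) x hx).symm
  have hbs : ∀ x ∈ U, ∀ i j, |b i j x - dl i j| ≤ 1 / (1000 * n ^ 2) := fun x hx i j => hsm x hx x hx i j
  have hbcl : ∀ {P : (EE n → ℝ) → Prop} (k : ℕ), Good U P → Cl U P (k + 2) v → ∀ i j, Cl U P k (b i j) := fun k hP h i j =>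
    Cl.poly hU hP (f := fun t y => Sum.elim (X y) (X y) t) (by rintro (t | t) <;> exact (h.2 t.2).2 t.1) (c (i, j))
  have hind : ∀ j, j + 3 ≤ m + 1 → Cl U (PC U) (j + 3) v := by
    intro j
    induction j with
    | zero => exact fun _ => hC3
    | succ j ih =>
      intro hj
      have hk := ih (by omega)
      have hF : ∀ e, ∀ x ∈ U, ContDiffAt ℝ (j + 1 + 1 : ℕ) (pd e G) x := fun e x hx => contDiffAt_pd e ((hG x hx).of_le (by norm_cast; omega))
      have s1 : Cl U (PH U) (j + 3) v := ⟨hk.1, fun e => lin_induct hU gC (b := b) (fun w F h1 h2 h3 h4 => linB hn hU hbs h1 h2 h3 h4) j (pd e v) (pd e G)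
        (hk.2 e) (hbcl (j + 1) gC hk) (Cl.of_contDiff gC (hF e)) (heq e)⟩
      have s2 : Cl U (P1 U) (j + 3) v := ⟨hk.1, fun e => lin_induct hU gH (b := b) (fun w F h1 h2 h3 h4 => linA hn hU hbs h1 h2 h3 h4) j (pd e v) (pd e G)
        (s1.2 e) (hbcl (j + 1) gH s1) (Cl.of_contDiff gH (hF e)) (heq e)⟩
      exact s2.P1_PC
  obtain ⟨j, rfl⟩ : ∃ j, m = j + 2 := ⟨m - 2, by omega⟩
  exact fun x hx => (hind j (by omega)).contDiffAt hU gC hx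

end MAE

open Filter Topology Metric

namespace MAE
open MeasureTheory
variable {n : ℕ}

def Dec (p : ℝ) (F : EE n → ℝ) : Prop := ∃ C, 0 ≤ C ∧ ∀ x, |F x| ≤ C * (1 + ‖x‖) ^ p

lemma Dec.mul {p q : ℝ} {F G : EE n → ℝ} (hF : Dec p F) (hG : Dec q G) :
    Dec (p + q) (fun x => F x * G x) := by
  obtain ⟨C, hC, h⟩ := hF
  obtain ⟨D, hD, h'⟩ := hG
  refine ⟨C * D, by positivity, fun x => ?_⟩
  rw [abs_mul, Real.rpow_add (by positivity)]
  calc _ ≤ (C * (1 + ‖x‖) ^ p) * (D * (1 + ‖x‖) ^ q) :=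
        mul_le_mul (h x) (h' x) (abs_nonneg _) (by positivity)
    _ = _ := by ring

lemma Dec.mono {p q : ℝ} {F : EE n → ℝ} (hF : Dec p F) (h : p ≤ q) : Dec q F := by
  obtain ⟨C, hC, h1⟩ := hF
  refine ⟨C, hC, fun x => (h1 x).trans ?_⟩
  gcongr
  linarith [norm_nonneg x]

lemma Dec.add {p : ℝ} {F G : EE n → ℝ} (hF : Dec p F) (hG : Dec p G) :
    Dec p (fun x => F x + G x) := by
  obtain ⟨C, hC, h⟩ := hF
  obtain ⟨D, hD, h'⟩ := hG
  refine ⟨C + D, by positivity, fun x => (abs_add_le _ _).trans ?_⟩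
  rw [add_mul]; exact add_le_add (h x) (h' x)

lemma Dec.const_mul {p : ℝ} {F : EE n → ℝ} (hF : Dec p F) (c : ℝ) : Dec p (fun x => c * F x) := by
  obtain ⟨C, hC, h⟩ := hF
  refine ⟨|c| * C, by positivity, fun x => ?_⟩
  rw [abs_mul, mul_assoc]; exact mul_le_mul_of_nonneg_left (h x) (abs_nonneg _)

lemma Dec.sum {ι : Type*} (s : Finset ι) {p : ℝ} {F : ι → EE n → ℝ} (hF : ∀ i ∈ s, Dec p (F i)) :
    Dec p (fun x => ∑ i ∈ s, F i x) := by
  classical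
  induction s using Finset.induction_on with
  | empty => exact ⟨0, le_rfl, fun x => by simp⟩
  | insert a s ha ih =>
    simp only [Finset.sum_insert ha]
    exact (hF a (by simp)).add (ih fun i hi => hF i (by simp [hi]))

lemma Dec.integrable {p : ℝ} {F : EE n → ℝ} (hF : Dec p F) (hc : Continuous F) (hp : p < -n) :
    Integrable F := by
  obtain ⟨C, hC, h⟩ := hF
  have := (integrable_one_add_norm (E := EE n) (μ := volume) (r := -p) (by simp; linarith)).const_mul C
  refine this.mono' hc.aestronglyMeasurable (Eventually.of_forall fun x => ?_)
  simpa using h x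

lemma Dec.comp_add {p : ℝ} {F : EE n → ℝ} (hF : Dec p F) (hp : p ≤ 0) (a : EE n) :
    Dec p (fun x => F (x + a)) := by
  obtain ⟨C, hC, h⟩ := hF
  refine ⟨C * (1 + ‖a‖) ^ (-p), by positivity, fun x => (h _).trans ?_⟩
  rw [mul_assoc]
  refine mul_le_mul_of_nonneg_left ?_ hC
  have h1 : 1 + ‖x‖ ≤ (1 + ‖a‖) * (1 + ‖x + a‖) := by
    have := norm_sub_le (x + a) a
    simp only [add_sub_cancel_right] at this
    nlinarith [norm_nonneg a, norm_nonneg (x + a)]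
  have h2 : (1 + ‖x‖) / (1 + ‖a‖) ≤ 1 + ‖x + a‖ := by rw [div_le_iff₀ (by positivity)]; linarith
  calc _ ≤ ((1 + ‖x‖) / (1 + ‖a‖)) ^ p := Real.rpow_le_rpow_of_nonpos (by positivity) h2 hp
    _ = _ := by
      rw [Real.div_rpow (by positivity) (by positivity), Real.rpow_neg (by positivity)]; field_simp

lemma dec_of_ev {p R C : ℝ} {F : EE n → ℝ} (hc : Continuous F)
    (h : ∀ x, R ≤ ‖x‖ → |F x| ≤ C * ‖x‖ ^ p) : Dec p F := by
  have hcont : Continuous (fun x => |F x| / (1 + ‖x‖) ^ p) := by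
    refine hc.abs.div ?_ (fun x => (by positivity))
    exact (continuous_const.add continuous_norm).rpow_const (fun x => Or.inl (show 1 + ‖x‖ ≠ 0 by positivity))
  obtain ⟨M, hM⟩ := (isCompact_closedBall (0 : EE n) (max R 1)).bddAbove_image hcont.continuousOn
  refine ⟨max M 0 + |C| * 2 ^ |p|, by positivity, fun x => ?_⟩
  have hp0 : 0 < (1 + ‖x‖) ^ p := by positivity
  rw [add_mul]
  rcases le_total ‖x‖ (max R 1) with hx | hx
  · have := hM ⟨x, by simpa using hx, rfl⟩
    simp only at this
    rw [div_le_iff₀ hp0] at this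
    have h1 : M * (1 + ‖x‖) ^ p ≤ max M 0 * (1 + ‖x‖) ^ p := by gcongr; exact le_max_left _ _
    have : 0 ≤ |C| * 2 ^ |p| * (1 + ‖x‖) ^ p := by positivity
    linarith
  · have h1x : 1 ≤ ‖x‖ := (le_max_right _ _).trans hx
    have h1 : ‖x‖ ^ p ≤ 2 ^ |p| * (1 + ‖x‖) ^ p := by
      rcases le_total 0 p with hp | hp
      · rw [abs_of_nonneg hp]
        have : ‖x‖ ^ p ≤ (1 + ‖x‖) ^ p := by gcongr; linarith
        have h2 : (1:ℝ) ≤ 2 ^ p := Real.one_le_rpow (by norm_num) hp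
        nlinarith
      · rw [abs_of_nonpos hp, Real.rpow_neg (by norm_num), ← div_eq_inv_mul,
          ← Real.div_rpow (by positivity) (by positivity)]
        exact Real.rpow_le_rpow_of_nonpos (by positivity) (by linarith) hp
    have h2 := h x ((le_max_left _ _).trans hx)
    have h3 : C * ‖x‖ ^ p ≤ |C| * (2 ^ |p| * (1 + ‖x‖) ^ p) :=
      mul_le_mul (le_abs_self _) h1 (by positivity) (abs_nonneg _)
    have : 0 ≤ max M 0 * (1 + ‖x‖) ^ p := by positivity
    linarith

lemma dec_coord (i : Fin n) : Dec 1 (fun y : EE n => y i) := by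
  refine ⟨1, by norm_num, fun x => ?_⟩
  have := EuclideanSpace.norm_eq x ▸ PiLp.norm_apply_le x i
  simp only [Real.rpow_one, one_mul]
  have h2 := PiLp.norm_apply_le x i
  rw [Real.norm_eq_abs] at h2
  linarith

lemma dec_rho {ε : ℝ} (hε : 0 < ε) {s : ℝ} (hs : 0 ≤ s) :
    Dec (-2 * s) (fun y : EE n => (ε ^ 2 + ‖y‖ ^ 2) ^ (-s)) := by
  refine ⟨(ε ^ 2 / (2 * (1 + ε ^ 2))) ^ (-s), by positivity, fun x => ?_⟩
  rw [abs_of_nonneg (by positivity)]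
  have : (1 + ‖x‖) ^ (-2 * s) = ((1 + ‖x‖) ^ 2) ^ (-s) := by
    rw [← Real.rpow_natCast, ← Real.rpow_mul (by positivity)]; congr 1; push_cast; ring
  rw [this, ← Real.mul_rpow (by positivity) (by positivity)]
  refine Real.rpow_le_rpow_of_nonpos (by positivity) ?_ (by linarith)
  rw [div_mul_eq_mul_div, div_le_iff₀ (by positivity)]
  have h1 : (1 + ‖x‖) ^ 2 ≤ 2 * (1 + ‖x‖ ^ 2) := by nlinarith [sq_nonneg (1 - ‖x‖)]
  have h2 : ε ^ 2 * (1 + ‖x‖) ^ 2 ≤ ε ^ 2 * (2 * (1 + ‖x‖ ^ 2)) := by gcongr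
  nlinarith [sq_nonneg (ε * ε), sq_nonneg ‖x‖]

lemma contDiff_rho {ε : ℝ} (hε : 0 < ε) (s : ℝ) (k : ℕ∞) :
    ContDiff ℝ k (fun y : EE n => (ε ^ 2 + ‖y‖ ^ 2) ^ s) := by
  refine ContDiff.rpow_const_of_ne ?_ (fun x => by positivity)
  exact contDiff_const.add (contDiff_norm_sq ℝ)

lemma pd_normsq (i : Fin n) (x : EE n) (c : ℝ) : pd i (fun y : EE n => c + ‖y‖ ^ 2) x = 2 * x i := by
  have h : HasFDerivAt (fun y : EE n => c + ‖y‖ ^ 2) (2 • innerSL ℝ x) x :=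
    (hasStrictFDerivAt_norm_sq x).hasFDerivAt.const_add c
  simp [pd, h.fderiv, ei, EuclideanSpace.inner_single_right]

lemma pd_coord (i j : Fin n) (x : EE n) : pd i (fun y : EE n => y j) x = dl i j := by
  have h : HasFDerivAt (fun y : EE n => y j) (EuclideanSpace.proj j : EE n →L[ℝ] ℝ) x :=
    (EuclideanSpace.proj j : EE n →L[ℝ] ℝ).hasFDerivAt
  rw [pd, h.fderiv]
  simp [ei_apply, dl, eq_comm]

lemma pd_rpow (i : Fin n) {f : EE n → ℝ} {x : EE n} (hf : DifferentiableAt ℝ f x) (h0 : f x ≠ 0) (s : ℝ) :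
    pd i (fun y => f y ^ s) x = s * f x ^ (s - 1) * pd i f x := by
  have := hf.hasFDerivAt.rpow_const (p := s) (Or.inl h0)
  simp [pd, this.fderiv]

lemma diff_coord (j : Fin n) (x : EE n) : DifferentiableAt ℝ (fun y : EE n => y j) x :=
  (EuclideanSpace.proj j : EE n →L[ℝ] ℝ).differentiableAt

lemma norm_sq_sum (x : EE n) : ‖x‖ ^ 2 = ∑ i, x i ^ 2 := by
  simp [EuclideanSpace.norm_sq_eq]

lemma pd_rho {ε : ℝ} (hε : 0 < ε) (s : ℝ) (i : Fin n) (x : EE n) :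
    pd i (fun y : EE n => (ε ^ 2 + ‖y‖ ^ 2) ^ s) x = 2 * s * (x i * (ε ^ 2 + ‖x‖ ^ 2) ^ (s - 1)) := by
  rw [pd_rpow i (by
    exact (contDiff_const.add (contDiff_norm_sq ℝ)).differentiable (n := 1) (by norm_num) x) (by positivity),
    pd_normsq]
  ring

lemma pd2_rho {ε : ℝ} (hε : 0 < ε) (s : ℝ) (i : Fin n) (x : EE n) :
    pd i (pd i (fun y : EE n => (ε ^ 2 + ‖y‖ ^ 2) ^ s)) x =
      2 * s * (2 * (s - 1) * (x i ^ 2 * (ε ^ 2 + ‖x‖ ^ 2) ^ (s - 2)) + (ε ^ 2 + ‖x‖ ^ 2) ^ (s - 1)) := by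
  have : pd i (fun y : EE n => (ε ^ 2 + ‖y‖ ^ 2) ^ s) =
      fun x => 2 * s * (x i * (ε ^ 2 + ‖x‖ ^ 2) ^ (s - 1)) := funext fun x => pd_rho hε s i x
  have hd : DifferentiableAt ℝ (fun y : EE n => (ε ^ 2 + ‖y‖ ^ 2) ^ (s - 1)) x :=
    (contDiff_rho hε (s-1) 1).differentiable (by norm_num) x
  rw [this, pd_const_mul _ _ ((diff_coord i x).fun_mul hd), pd_mul _ (diff_coord i x) hd, pd_rho hε,
    pd_coord, show s - 1 - 1 = s - 2 by ring]
  simp only [dl, if_true]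
  ring

lemma continuous_pd {f : EE n → ℝ} (i : Fin n) (hf : ContDiff ℝ 1 f) : Continuous (pd i f) :=
  (hf.continuous_fderiv (by norm_num)).clm_apply continuous_const

lemma contDiff_pd {f : EE n → ℝ} (i : Fin n) (hf : ContDiff ℝ 2 f) : ContDiff ℝ 1 (pd i f) :=
  contDiff_iff_contDiffAt.2 fun x => contDiffAt_pd i (k := 1) (by exact_mod_cast hf.contDiffAt)

lemma green_s (hn : 3 ≤ n) {v : EE n → ℝ} (hv : ContDiff ℝ 2 v) (h0 : Dec (2 - n) v)
    (h1 : ∀ i, Dec (1 - n) (pd i v)) (h2 : ∀ i, Dec (-n) (pd i (pd i v))) {ε : ℝ} (hε : 0 < ε) {s : ℝ}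
    (hs : ((n:ℝ) - 2) / 2 < s) :
    ∫ y, (ε ^ 2 + ‖y‖ ^ 2) ^ (-s) * lap v y =
      ∫ y, (2 * s * (2 * s + 2 - n) * (ε ^ 2 + ‖y‖ ^ 2) ^ (-s - 1)
        - 4 * s * (s + 1) * ε ^ 2 * (ε ^ 2 + ‖y‖ ^ 2) ^ (-s - 2)) * v y := by
  have hn' : (3:ℝ) ≤ n := by exact_mod_cast hn
  have hs0 : 0 < s := by linarith
  set φ : EE n → ℝ := fun y => (ε ^ 2 + ‖y‖ ^ 2) ^ (-s) with hφ
  have cφ : ContDiff ℝ 2 φ := contDiff_rho hε (-s) 2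
  have dφ : Dec (-2 * s) φ := dec_rho hε hs0.le
  have dφ1 : ∀ i, Dec (-2 * s - 1) (pd i φ) := fun i => by
    have := ((dec_coord i).mul (dec_rho (n := n) hε (s := s + 1) (by linarith))).const_mul (2 * -s)
    refine (show Dec (1 + -2 * (s + 1)) (pd i φ) from ?_).mono (by linarith)
    convert this using 2 with x
    rw [pd_rho hε, show -(s + 1) = -s - 1 by ring]
  have dφ2 : ∀ i, Dec (-2 * s - 2) (pd i (pd i φ)) := fun i => by
    have e1 := ((((dec_coord i).mul (dec_coord i)).mul
      (dec_rho (n := n) hε (s := s + 2) (by linarith))).const_mul (2 * (-s - 1))).mono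
      (show 1 + 1 + -2 * (s + 2) ≤ -2 * s - 2 by linarith)
    have e2 := (dec_rho (n := n) hε (s := s + 1) (by linarith)).mono
      (show -2 * (s + 1) ≤ -2 * s - 2 by linarith)
    have := (e1.add e2).const_mul (2 * -s)
    convert this using 2 with x
    rw [pd2_rho hε, show -(s + 1) = -s - 1 by ring, show -(s + 2) = -s - 2 by ring]
    ring
  have c0 := hv.continuous
  have c1 : ∀ i, Continuous (pd i v) := fun i => (contDiff_pd i hv).continuous
  have c2 : ∀ i, Continuous (pd i (pd i v)) := fun i => continuous_pd i (contDiff_pd i hv)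
  have k0 := cφ.continuous
  have k1 : ∀ i, Continuous (pd i φ) := fun i => (contDiff_pd i cφ).continuous
  have k2 : ∀ i, Continuous (pd i (pd i φ)) := fun i => continuous_pd i (contDiff_pd i cφ)
  have I0 : ∀ i, Integrable (fun y => φ y * pd i (pd i v) y) := fun i =>
    (dφ.mul (h2 i)).integrable (k0.mul (c2 i)) (by linarith)
  have I1 : ∀ i, Integrable (fun y => pd i φ y * pd i v y) := fun i =>
    ((dφ1 i).mul (h1 i)).integrable ((k1 i).mul (c1 i)) (by linarith)
  have I2 : ∀ i, Integrable (fun y => pd i (pd i φ) y * v y) := fun i =>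
    ((dφ2 i).mul h0).integrable ((k2 i).mul c0) (by linarith)
  have I3 : ∀ i, Integrable (fun y => φ y * pd i v y) := fun i =>
    (dφ.mul (h1 i)).integrable (k0.mul (c1 i)) (by linarith)
  have I4 : ∀ i, Integrable (fun y => pd i φ y * v y) := fun i =>
    ((dφ1 i).mul h0).integrable ((k1 i).mul c0) (by linarith)
  have key : ∀ i, ∫ y, φ y * pd i (pd i v) y = ∫ y, pd i (pd i φ) y * v y := fun i => by
    have e1 : ∫ y, φ y * pd i (pd i v) y = - ∫ y, pd i φ y * pd i v y :=
      integral_mul_fderiv_eq_neg_fderiv_mul_of_integrable (I1 i) (I0 i) (I3 i)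
        (fun x _ => cφ.differentiable (by norm_num) x)
        (fun x _ => (contDiff_pd i hv).differentiable (by norm_num) x)
    have e2 : ∫ y, pd i φ y * pd i v y = - ∫ y, pd i (pd i φ) y * v y :=
      integral_mul_fderiv_eq_neg_fderiv_mul_of_integrable (I2 i) (I1 i) (I4 i)
        (fun x _ => (contDiff_pd i cφ).differentiable (by norm_num) x)
        (fun x _ => hv.differentiable (by norm_num) x)
    rw [e1, e2, neg_neg]
  simp only [lap, Finset.mul_sum]
  rw [integral_finsetSum _ fun i _ => I0 i, Finset.sum_congr rfl fun i _ => key i,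
    ← integral_finsetSum _ fun i _ => I2 i]
  congr 1
  ext y
  rw [← Finset.sum_mul]
  congr 1
  simp only [hφ, pd2_rho hε]
  rw [← Finset.mul_sum, Finset.sum_add_distrib, ← Finset.mul_sum, ← Finset.sum_mul, ← norm_sq_sum]
  simp only [Finset.sum_const, Finset.card_univ, Fintype.card_fin, nsmul_eq_mul]
  have : (ε ^ 2 + ‖y‖ ^ 2) ^ (-s - 1) = (ε ^ 2 + ‖y‖ ^ 2) ^ (-s - 2) * (ε ^ 2 + ‖y‖ ^ 2) := by
    rw [← Real.rpow_add_one (by positivity)]; congr 1; ring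
  rw [this]; ring

end MAE

open Filter Topology Metric

namespace MAE
open MeasureTheory
variable {n : ℕ}

lemma int_sing (hn : 3 ≤ n) {μ : ℝ} (hμ : (n:ℝ) < μ) {h : EE n → ℝ} (hc : Continuous h)
    (hd : Dec (-μ) h) : Integrable (fun y : EE n => ‖y‖ ^ ((2:ℝ) - n) * |h y|) := by
  have hn' : (3:ℝ) ≤ n := by exact_mod_cast hn
  have : Nontrivial (EE n) := by
    have : Nonempty (Fin n) := ⟨⟨0, by omega⟩⟩
    infer_instance
  obtain ⟨C, hC, h1⟩ := hd
  have key : Integrable (fun y : EE n => (fun r : ℝ => r ^ ((2:ℝ) - n) * (1 + r) ^ (-μ)) ‖y‖) := by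
    rw [integrable_fun_norm_addHaar volume (f := fun r : ℝ => r ^ ((2:ℝ) - n) * (1 + r) ^ (-μ))]
    have h2 : Integrable (fun r : ℝ => (1 + ‖r‖) ^ (-(μ - 1))) :=
      integrable_one_add_norm (by simp; linarith)
    refine (h2.integrableOn (s := Set.Ioi 0)).mono' ?_ ?_
    · exact (by fun_prop : Measurable _).aestronglyMeasurable
    · refine (ae_restrict_iff' measurableSet_Ioi).2 (Eventually.of_forall fun r hr => ?_)
      have hr : 0 < r := hr
      simp only [finrank_euclideanSpace, Fintype.card_fin, smul_eq_mul, Real.norm_eq_abs]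
      rw [abs_of_nonneg (by positivity), abs_of_pos hr, ← mul_assoc, ← Real.rpow_natCast,
        ← Real.rpow_add hr, Nat.cast_sub (by omega),
        show ((n:ℝ) - (1:ℕ) + (2 - n)) = 1 by push_cast; ring, Real.rpow_one,
        show -(μ - 1) = 1 + -μ by ring, Real.rpow_add (by positivity), Real.rpow_one]
      gcongr; linarith
  refine (key.const_mul C).mono' ?_ (Eventually.of_forall fun y => ?_)
  · exact (Measurable.aestronglyMeasurable (by fun_prop)).mul hc.abs.aestronglyMeasurable
  · rw [Real.norm_eq_abs, abs_of_nonneg (by positivity)]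
    calc _ ≤ ‖y‖ ^ ((2:ℝ) - n) * (C * (1 + ‖y‖) ^ (-μ)) := by gcongr; exact h1 y
      _ = _ := by ring

lemma rpow_sandwich {ρ a s : ℝ} (hρ : 0 < ρ) (h1 : a ≤ s) (h2 : s ≤ a + 1) :
    ρ ^ (-s) ≤ ρ ^ (-a) + ρ ^ (-(a + 1)) := by
  rcases le_total 1 ρ with h | h
  · have := Real.rpow_le_rpow_of_exponent_le h (neg_le_neg h1)
    have : 0 < ρ ^ (-(a + 1)) := by positivity
    linarith
  · have := Real.rpow_le_rpow_of_exponent_ge hρ h (neg_le_neg h2)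
    have : 0 < ρ ^ (-a) := by positivity
    linarith

lemma tendsto_s {ε : ℝ} (hε : 0 < ε) {a : ℝ} (ha : 0 ≤ a) {p : ℝ} {F : EE n → ℝ} (hF : Continuous F)
    (hd : Dec p F) (hp : -2 * a + p < -n) :
    Tendsto (fun s => ∫ y, (ε ^ 2 + ‖y‖ ^ 2) ^ (-s) * F y) (𝓝[>] a)
      (𝓝 (∫ y, (ε ^ 2 + ‖y‖ ^ 2) ^ (-a) * F y)) := by
  have hc : ∀ s : ℝ, Continuous fun y : EE n => (ε ^ 2 + ‖y‖ ^ 2) ^ s := fun s =>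
    (contDiff_rho hε s 0).continuous
  refine tendsto_integral_filter_of_dominated_convergence
    (fun y => ((ε ^ 2 + ‖y‖ ^ 2) ^ (-a) + (ε ^ 2 + ‖y‖ ^ 2) ^ (-(a + 1))) * |F y|)
    (Eventually.of_forall fun s => ((hc _).mul hF).aestronglyMeasurable) ?_ ?_ ?_
  · filter_upwards [Ioo_mem_nhdsGT (show a < a + 1 by linarith)] with s hs
    refine Eventually.of_forall fun y => ?_
    rw [norm_mul, Real.norm_eq_abs, abs_of_nonneg (by positivity), Real.norm_eq_abs]
    gcongr
    exact rpow_sandwich (by positivity) hs.1.le hs.2.le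
  · have hd' : Dec p (fun y => |F y|) := by
      obtain ⟨C, hC, h⟩ := hd; exact ⟨C, hC, fun x => by simpa using h x⟩
    have := (((dec_rho (n := n) hε ha).add ((dec_rho (n := n) hε (s := a + 1) (by linarith)).mono
      (by linarith))).mul hd')
    exact this.integrable (((hc _).add (hc _)).mul hF.abs) hp
  · refine Eventually.of_forall fun y => Tendsto.mul_const _ ?_
    have : ContinuousAt (fun s : ℝ => (ε ^ 2 + ‖y‖ ^ 2) ^ (-s)) a :=
      (Real.continuousAt_const_rpow (by positivity)).comp continuous_neg.continuousAt
    exact this.tendsto.mono_left nhdsWithin_le_nhds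

lemma dec_lap {v : EE n → ℝ} (h2 : ∀ i, Dec (-n) (pd i (pd i v))) : Dec (-n) (lap v) :=
  Dec.sum _ fun i _ => h2 i

lemma continuous_lap {v : EE n → ℝ} (hv : ContDiff ℝ 2 v) : Continuous (lap v) :=
  continuous_finsetSum _ fun i _ => continuous_pd i (contDiff_pd i hv)

lemma green_eps (hn : 3 ≤ n) {v : EE n → ℝ} (hv : ContDiff ℝ 2 v) (h0 : Dec (2 - n) v)
    (h1 : ∀ i, Dec (1 - n) (pd i v)) (h2 : ∀ i, Dec (-n) (pd i (pd i v))) {ε : ℝ} (hε : 0 < ε) :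
    ∫ y, (ε ^ 2 + ‖y‖ ^ 2) ^ (-(((n:ℝ) - 2) / 2)) * lap v y =
      - (n * (n - 2)) * ε ^ 2 * ∫ y, (ε ^ 2 + ‖y‖ ^ 2) ^ (-(n / 2 + 1 : ℝ)) * v y := by
  have hn' : (3:ℝ) ≤ n := by exact_mod_cast hn
  set a : ℝ := ((n:ℝ) - 2) / 2 with ha
  have hpos : 0 < a := by rw [ha]; linarith
  have L := tendsto_s hε hpos.le (continuous_lap hv) (dec_lap h2) (by linarith)
  have R1 := tendsto_s (a := a + 1) hε (by linarith) hv.continuous h0 (by linarith)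
  have R2 := tendsto_s (a := a + 2) hε (by linarith) hv.continuous h0 (by linarith)
  have sh : ∀ b : ℝ, Tendsto (fun s : ℝ => s + b) (𝓝[>] a) (𝓝[>] (a + b)) := fun b => by
    refine tendsto_nhdsWithin_iff.2 ⟨?_, ?_⟩
    · exact ((continuous_add_const b).tendsto a).mono_left nhdsWithin_le_nhds
    · filter_upwards [self_mem_nhdsWithin] with s hs
      simpa using hs
  have R1' := R1.comp (sh 1)
  have R2' := R2.comp (sh 2)
  have id : Tendsto (fun s : ℝ => s) (𝓝[>] a) (𝓝 a) := tendsto_id.mono_left nhdsWithin_le_nhds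
  have R := (((id.const_mul 2).mul (((id.const_mul 2).add_const 2).sub_const (n:ℝ))).mul R1').sub
    ((((id.const_mul 4).mul (id.add_const 1)).mul_const (ε ^ 2)).mul R2')
  refine (tendsto_nhds_unique L (R.congr' ?_)).trans ?_
  · filter_upwards [self_mem_nhdsWithin] with s hs
    have hs : a < s := hs
    have J : ∀ t : ℝ, a + 1 ≤ t → Integrable (fun y : EE n => (ε ^ 2 + ‖y‖ ^ 2) ^ (-t) * v y) := fun t ht =>
      ((dec_rho hε (by linarith)).mul h0).integrable
        ((contDiff_rho hε _ 0).continuous.mul hv.continuous) (by linarith)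
    rw [green_s hn hv h0 h1 h2 hε hs]
    have : ∀ y : EE n, (2 * s * (2 * s + 2 - n) * (ε ^ 2 + ‖y‖ ^ 2) ^ (-s - 1)
        - 4 * s * (s + 1) * ε ^ 2 * (ε ^ 2 + ‖y‖ ^ 2) ^ (-s - 2)) * v y =
        2 * s * (2 * s + 2 - n) * ((ε ^ 2 + ‖y‖ ^ 2) ^ (-(s + 1)) * v y)
        - 4 * s * (s + 1) * ε ^ 2 * ((ε ^ 2 + ‖y‖ ^ 2) ^ (-(s + 2)) * v y) := fun y => by
      rw [show -(s + 1) = -s - 1 by ring, show -(s + 2) = -s - 2 by ring]; ring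
    simp only [this]
    rw [integral_sub ((J (s + 1) (by linarith)).const_mul _) ((J (s + 2) (by linarith)).const_mul _),
      integral_const_mul, integral_const_mul]
    rfl
  rw [show a + 2 = (n:ℝ) / 2 + 1 by rw [ha]; ring, show 2 * a + 2 - n = 0 by rw [ha]; ring]
  simp only [ha]; ring

noncomputable def kap (n : ℕ) : ℝ := n * (n - 2) * ∫ z : EE n, (1 + ‖z‖ ^ 2) ^ (-(n / 2 + 1 : ℝ))

lemma int_kap : Integrable (fun z : EE n => (1 + ‖z‖ ^ 2) ^ (-((n:ℝ) / 2 + 1))) := by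
  have h := (dec_rho (n := n) one_pos (s := (n:ℝ) / 2 + 1) (by positivity)).integrable
    ((contDiff_rho one_pos _ 0).continuous) (by linarith)
  simpa using h

lemma kap_pos (hn : 3 ≤ n) : 0 < kap n := by
  have hn' : (3:ℝ) ≤ n := by exact_mod_cast hn
  refine mul_pos (by nlinarith) ?_
  rw [integral_pos_iff_support_of_nonneg (fun _ => by positivity) int_kap]
  have : Function.support (fun z : EE n => (1 + ‖z‖ ^ 2) ^ (-((n:ℝ) / 2 + 1))) = Set.univ :=
    Set.eq_univ_of_forall fun z => (Real.rpow_pos_of_pos (by positivity) _).ne'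
  rw [this]; exact isOpen_univ.measure_pos volume ⟨0, trivial⟩

lemma green0 (hn : 3 ≤ n) {v : EE n → ℝ} (hv : ContDiff ℝ 2 v) (h0 : Dec (2 - n) v)
    (h1 : ∀ i, Dec (1 - n) (pd i v)) (h2 : ∀ i, Dec (-n) (pd i (pd i v))) {μ : ℝ} (hμ : (n:ℝ) < μ)
    (hg : Dec (-μ) (lap v)) :
    ∫ y, ‖y‖ ^ ((2:ℝ) - n) * lap v y = - kap n * v 0 := by
  have hn' : (3:ℝ) ≤ n := by exact_mod_cast hn
  have seq : Tendsto (fun k : ℕ => (1:ℝ) / (k + 1)) atTop (𝓝 0) := tendsto_one_div_add_atTop_nhds_zero_nat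
  have L : Tendsto (fun k : ℕ => ∫ y, (((1:ℝ) / (k + 1)) ^ 2 + ‖y‖ ^ 2) ^ (-(((n:ℝ) - 2) / 2)) * lap v y)
      atTop (𝓝 (∫ y, ‖y‖ ^ ((2:ℝ) - n) * lap v y)) := by
    refine tendsto_integral_of_dominated_convergence (fun y => ‖y‖ ^ ((2:ℝ) - n) * |lap v y|)
      (fun k => ((contDiff_rho (by positivity) _ 0).continuous.mul (continuous_lap hv)).aestronglyMeasurable)
      (int_sing hn hμ (continuous_lap hv) hg) (fun k => ?_) ?_
    all_goals
      have : ∀ᵐ y : EE n, y ≠ 0 := by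
        have : Nontrivial (EE n) := by
          have : Nonempty (Fin n) := ⟨⟨0, by omega⟩⟩
          infer_instance
        simp [ae_iff]
      filter_upwards [this] with y hy
      have hy : 0 < ‖y‖ := norm_pos_iff.2 hy
      have e : ‖y‖ ^ ((2:ℝ) - n) = (0 ^ 2 + ‖y‖ ^ 2) ^ (-(((n:ℝ) - 2) / 2)) := by
        rw [zero_pow two_ne_zero, zero_add, ← Real.rpow_natCast, ← Real.rpow_mul hy.le]; congr 1; push_cast; ring
      rw [e]
    · rw [norm_mul, Real.norm_eq_abs, Real.norm_eq_abs, abs_of_nonneg (by positivity)]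
      gcongr ?_ * _
      refine Real.rpow_le_rpow_of_nonpos (by positivity) ?_ (by linarith)
      gcongr; positivity
    · refine Tendsto.mul_const _ (Tendsto.rpow_const ((seq.pow 2).add_const _) (Or.inl (by positivity)))
  have R : Tendsto (fun k : ℕ => - (n * ((n:ℝ) - 2)) *
      ∫ z : EE n, (1 + ‖z‖ ^ 2) ^ (-(n / 2 + 1 : ℝ)) * v (((1:ℝ) / (k + 1)) • z)) atTop
      (𝓝 (- (n * ((n:ℝ) - 2)) * ∫ z : EE n, (1 + ‖z‖ ^ 2) ^ (-(n / 2 + 1 : ℝ)) * v 0)) := by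
    refine Tendsto.const_mul _ ?_
    obtain ⟨C, hC, h⟩ := h0
    refine tendsto_integral_of_dominated_convergence (fun z => (1 + ‖z‖ ^ 2) ^ (-(n / 2 + 1 : ℝ)) * C)
      (fun k => ?_) (int_kap.mul_const C) (fun k => Eventually.of_forall fun z => ?_)
      (Eventually.of_forall fun z => ?_)
    · exact int_kap.aestronglyMeasurable.mul (hv.continuous.comp (continuous_const_smul _)).aestronglyMeasurable
    · rw [norm_mul, Real.norm_eq_abs, Real.norm_eq_abs, abs_of_nonneg (by positivity)]
      gcongr
      refine (h _).trans (mul_le_of_le_one_right hC ?_)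
      exact Real.rpow_le_one_of_one_le_of_nonpos (by linarith [norm_nonneg (((1:ℝ) / (k + 1)) • z)]) (by linarith)
    · refine Tendsto.const_mul _ ((hv.continuous.tendsto 0).comp ?_)
      simpa using seq.smul_const z
  have e : ∀ k : ℕ, ∫ y, (((1:ℝ) / (k + 1)) ^ 2 + ‖y‖ ^ 2) ^ (-(((n:ℝ) - 2) / 2)) * lap v y =
      - (n * ((n:ℝ) - 2)) * ∫ z : EE n, (1 + ‖z‖ ^ 2) ^ (-(n / 2 + 1 : ℝ)) * v (((1:ℝ) / (k + 1)) • z) := by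
    intro k
    set ε : ℝ := 1 / (k + 1) with hε
    have hε0 : 0 < ε := by positivity
    rw [green_eps hn hv h0 h1 h2 hε0, mul_assoc]
    congr 1
    have := Measure.integral_comp_smul (volume : Measure (EE n))
      (fun y => (ε ^ 2 + ‖y‖ ^ 2) ^ (-(n / 2 + 1 : ℝ)) * v y) ε
    simp only [finrank_euclideanSpace, Fintype.card_fin, smul_eq_mul] at this
    rw [abs_of_pos (by positivity), eq_inv_mul_iff_mul_eq₀ (by positivity), ← integral_const_mul] at this
    rw [← this, ← integral_const_mul]
    congr 1
    ext z
    rw [norm_smul, Real.norm_eq_abs, abs_of_pos hε0, show ε ^ 2 + (ε * ‖z‖) ^ 2 = ε ^ 2 * (1 + ‖z‖ ^ 2) by ring,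
      Real.mul_rpow (by positivity) (by positivity), ← Real.rpow_natCast ε 2, ← Real.rpow_mul hε0.le]
    have : ε ^ ((2:ℕ):ℝ) * ε ^ (n:ℝ) * ε ^ (((2:ℕ):ℝ) * -((n:ℝ) / 2 + 1)) = 1 := by
      rw [← Real.rpow_add hε0, ← Real.rpow_add hε0]
      convert Real.rpow_zero ε using 2
      push_cast; ring
    rw [← Real.rpow_natCast ε n]
    linear_combination ((1 + ‖z‖ ^ 2) ^ (-((n:ℝ) / 2 + 1)) * v (ε • z)) * this
  simp only [e] at L
  rw [tendsto_nhds_unique L R, integral_mul_const, kap]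
  ring

theorem green (hn : 3 ≤ n) {v : EE n → ℝ} (hv : ContDiff ℝ 2 v) (h0 : Dec (2 - n) v)
    (h1 : ∀ i, Dec (1 - n) (pd i v)) (h2 : ∀ i, Dec (-n) (pd i (pd i v))) {μ : ℝ} (hμ : (n:ℝ) < μ)
    (hg : Dec (-μ) (lap v)) (x : EE n) :
    ∫ y, ‖x - y‖ ^ ((2:ℝ) - n) * lap v y = - kap n * v x := by
  have hn' : (3:ℝ) ≤ n := by exact_mod_cast hn
  have e1 : ∀ i, pd i (fun y => v (y + x)) = fun y => pd i v (y + x) := fun i =>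
    funext fun y => pd_comp_add i v x y
  have e2 : ∀ i, pd i (pd i (fun y => v (y + x))) = fun y => pd i (pd i v) (y + x) := fun i => by
    rw [e1]; exact funext fun y => pd_comp_add i (pd i v) x y
  have e3 : lap (fun y => v (y + x)) = fun y => lap v (y + x) := by
    ext y; simp only [lap, e2]
  have := green0 hn (v := fun y => v (y + x)) (hv.comp (contDiff_id.add contDiff_const))
    (h0.comp_add (by linarith) x)
    (fun i => by rw [e1]; exact (h1 i).comp_add (by linarith) x)
    (fun i => by rw [e2]; exact (h2 i).comp_add (by linarith) x) hμ
    (by rw [e3]; exact hg.comp_add (by linarith) x)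
  rw [e3, zero_add] at this
  rw [← this, ← integral_add_right_eq_self (fun y => ‖x - y‖ ^ ((2:ℝ) - n) * lap v y) x]
  congr 1
  ext y
  rw [show x - (y + x) = - y by abel, norm_neg]

end MAE

open Filter Topology Metric

namespace MAE
open MvPolynomial (pderiv X C)
variable {n : ℕ}

def Hp (k : ℕ) (p : MvPolynomial (Fin n) ℝ) : Prop :=
  p.IsHomogeneous k ∧ ∑ i, pderiv i (pderiv i p) = 0

noncomputable def r2 (n : ℕ) : MvPolynomial (Fin n) ℝ := ∑ j, X j * X j

noncomputable def TT (c : ℝ) (i : Fin n) (p : MvPolynomial (Fin n) ℝ) : MvPolynomial (Fin n) ℝ :=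
  r2 n * pderiv i p + C c * (X i * p)

noncomputable def cc (n k : ℕ) : ℝ := 2 - n - 2 * k

lemma pderiv_comm' (i j : Fin n) (p : MvPolynomial (Fin n) ℝ) :
    pderiv i (pderiv j p) = pderiv j (pderiv i p) := by
  have h : ⁅pderiv (R := ℝ) i, pderiv j⁆ = (0 : Derivation ℝ (MvPolynomial (Fin n) ℝ) (MvPolynomial (Fin n) ℝ)) := by
    apply MvPolynomial.derivation_ext
    intro k
    simp [Derivation.commutator_apply, MvPolynomial.pderiv_X, Pi.single_apply, apply_ite]
  have := congrArg (fun D => D p) h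
  simpa [Derivation.commutator_apply, sub_eq_zero] using this

lemma pderiv_r2 (i : Fin n) : pderiv i (r2 n) = 2 * X i := by
  simp only [r2, map_sum, MvPolynomial.pderiv_mul, MvPolynomial.pderiv_X, Pi.single_apply]
  simp [Finset.sum_add_distrib]; ring

lemma pd_TT (c : ℝ) (i j : Fin n) (p : MvPolynomial (Fin n) ℝ) :
    pderiv j (TT c i p) = r2 n * pderiv j (pderiv i p) + 2 * X j * pderiv i p
      + C c * (X i * pderiv j p + C (dl i j) * p) := by
  simp only [TT, map_add, MvPolynomial.pderiv_mul, pderiv_r2, MvPolynomial.pderiv_X, MvPolynomial.pderiv_C,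
    Pi.single_apply, dl]
  split_ifs <;> simp_all <;> ring

lemma sum_r2 (q : MvPolynomial (Fin n) ℝ) : ∑ j : Fin n, X j * (X j * q) = r2 n * q := by
  rw [r2, Finset.sum_mul]; exact Finset.sum_congr rfl fun j _ => by ring

lemma sum_Cdl (i : Fin n) (q : Fin n → MvPolynomial (Fin n) ℝ) : ∑ j, C (dl i j) * q j = q i := by
  simp [dl, apply_ite, ite_mul]

lemma Hp.euler {k : ℕ} {p : MvPolynomial (Fin n) ℝ} (h : Hp k p) : ∑ j, X j * pderiv j p = C (k:ℝ) * p := by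
  have := h.1.sum_X_mul_pderiv
  rw [this]; simp

lemma Hp.euler' {k : ℕ} {p : MvPolynomial (Fin n) ℝ} (h : Hp k p) (i : Fin n) :
    ∑ j, X j * pderiv j (pderiv i p) = C (k - 1 : ℝ) * pderiv i p := by
  have := congrArg (pderiv i) h.euler
  simp only [map_sum, MvPolynomial.pderiv_mul, MvPolynomial.pderiv_X, MvPolynomial.pderiv_C,
    Pi.single_apply, Finset.sum_add_distrib, ite_mul, zero_mul, one_mul, zero_add] at this
  simp only [Finset.sum_ite_eq', Finset.mem_univ, if_true] at this
  simp only [pderiv_comm' _ i, map_sub, map_one]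
  linear_combination this

lemma Hp.TT {k : ℕ} {p : MvPolynomial (Fin n) ℝ} (h : Hp k p) (i : Fin n) :
    Hp (k + 1) (TT (cc n k) i p) := by
  refine ⟨?_, ?_⟩
  · have hr : (r2 n).IsHomogeneous 2 := MvPolynomial.IsHomogeneous.sum _ _ _ fun j _ =>
      (MvPolynomial.isHomogeneous_X ℝ j).mul (MvPolynomial.isHomogeneous_X ℝ j)
    have e2 : (C (cc n k) * (X i * p)).IsHomogeneous (k + 1) := by
      have := ((MvPolynomial.isHomogeneous_C (Fin n) (cc n k)).mul ((MvPolynomial.isHomogeneous_X ℝ i).mul h.1))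
      convert this using 1; ring
    refine MvPolynomial.IsHomogeneous.add ?_ e2
    rcases Nat.eq_zero_or_pos k with rfl | hk
    · have : p = C (p.coeff 0) := by
        apply MvPolynomial.totalDegree_eq_zero_iff_eq_C.1
        exact Nat.le_zero.1 h.1.totalDegree_le
      rw [this]; simp [MvPolynomial.isHomogeneous_zero]
    · have := hr.mul (h.1.pderiv (i := i))
      convert this using 1; omega
  · have e : ∀ j, pderiv j (pderiv j (MAE.TT (cc n k) i p)) = r2 n * pderiv i (pderiv j (pderiv j p))
        + 4 * (X j * pderiv j (pderiv i p)) + 2 * pderiv i p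
        + C (cc n k) * (X i * pderiv j (pderiv j p)) + 2 * C (cc n k) * (C (dl i j) * pderiv j p) := fun j => by
      rw [pd_TT]
      simp only [map_add, MvPolynomial.pderiv_mul, pderiv_r2, MvPolynomial.pderiv_X_self, MvPolynomial.pderiv_X, MvPolynomial.pderiv_C]
      have e1 : pderiv j (2 : MvPolynomial (Fin n) ℝ) = 0 := by
        rw [show (2 : MvPolynomial (Fin n) ℝ) = C 2 from (map_ofNat C 2).symm]; exact MvPolynomial.pderiv_C
      rw [e1, pderiv_comm' j i (p), pderiv_comm' j i (pderiv j p)]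
      simp only [Pi.single_apply, dl]
      split_ifs <;> simp_all <;> ring
    simp only [e, Finset.sum_add_distrib, ← Finset.mul_sum, ← map_sum, h.2, h.euler', sum_Cdl]
    simp only [map_zero, mul_zero, Finset.sum_const, Finset.card_univ, Fintype.card_fin, nsmul_eq_mul, cc, map_sub,
      map_mul, map_natCast, map_ofNat, map_one, MvPolynomial.pderiv_mul, Derivation.map_natCast, zero_mul, zero_add]
    ring

lemma Hp.TTTT {k : ℕ} {p : MvPolynomial (Fin n) ℝ} (h : Hp k p) :
    ∑ i, MAE.TT (cc n (k + 1)) i (MAE.TT (cc n k) i p) = 0 := by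
  have e : ∀ i, MAE.TT (cc n (k + 1)) i (MAE.TT (cc n k) i p) = r2 n * (r2 n * pderiv i (pderiv i p))
      + (2 + C (cc n k) + C (cc n (k + 1))) * r2 n * (X i * pderiv i p) + C (cc n k) * r2 n * p
      + C (cc n k) * C (cc n (k+1)) * (X i * (X i * p)) := fun i => by
    conv_lhs => rw [MAE.TT, pd_TT]
    simp only [dl, if_true, MAE.TT, map_one]
    ring
  simp only [e, Finset.sum_add_distrib, ← Finset.mul_sum, h.2, h.euler, sum_r2]
  simp only [mul_zero, Finset.sum_const, Finset.card_univ, Fintype.card_fin, nsmul_eq_mul, cc, map_sub,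
      map_mul, map_natCast, map_ofNat, map_one, Nat.cast_add, Nat.cast_one, map_add]
  ring

lemma Hp.add {k : ℕ} {p q : MvPolynomial (Fin n) ℝ} (h : Hp k p) (h' : Hp k q) : Hp k (p + q) :=
  ⟨h.1.add h'.1, by simp only [map_add, Finset.sum_add_distrib, h.2, h'.2, add_zero]⟩

lemma Hp.C_mul {k : ℕ} {p : MvPolynomial (Fin n) ℝ} (h : Hp k p) (c : ℝ) : Hp k (C c * p) :=
  ⟨by simpa using (MvPolynomial.isHomogeneous_C (Fin n) c).mul h.1, by
    simp only [MvPolynomial.pderiv_C_mul, ← Finset.mul_sum, h.2, mul_zero]⟩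

lemma Hp.sum {ι : Type*} (s : Finset ι) {k : ℕ} {p : ι → MvPolynomial (Fin n) ℝ} (h : ∀ a, Hp k (p a)) :
    Hp k (∑ a ∈ s, p a) := by
  classical
  induction s using Finset.induction_on with
  | empty => exact ⟨by simp [MvPolynomial.isHomogeneous_zero], by simp⟩
  | insert a s ha ih => rw [Finset.sum_insert ha]; exact (h a).add ih

noncomputable def pv (p : MvPolynomial (Fin n) ℝ) (x : EE n) : ℝ := MvPolynomial.eval (fun i => x i) p

lemma contDiff_pv (p : MvPolynomial (Fin n) ℝ) {k : WithTop ℕ∞} : ContDiff ℝ k (pv p) := by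
  induction p using MvPolynomial.induction_on with
  | C a =>
    have : pv (C a) = fun _ : EE n => a := by ext; simp [pv]
    rw [this]; exact contDiff_const
  | add p q hp hq =>
    have : pv (p + q) = fun x => pv p x + pv q x := by ext; simp [pv]
    rw [this]; exact hp.add hq
  | mul_X p i hp =>
    have : pv (p * X i) = fun x => pv p x * x i := by ext x; simp [pv]
    rw [this]
    exact hp.mul (EuclideanSpace.proj i : EE n →L[ℝ] ℝ).contDiff

lemma pd_pv (p : MvPolynomial (Fin n) ℝ) (i : Fin n) (x : EE n) : pd i (pv p) x = pv (pderiv i p) x := by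
  have hd : ∀ p : MvPolynomial (Fin n) ℝ, DifferentiableAt ℝ (pv p) x := fun p =>
    (contDiff_pv p (k := 1)).differentiable (by norm_num) x
  induction p using MvPolynomial.induction_on with
  | C a =>
    have : pv (C a) = fun _ : EE n => a := by ext; simp [pv]
    rw [this, pd_const]; simp [pv]
  | add p q hp hq =>
    have : pv (p + q) = fun x => pv p x + pv q x := by ext; simp [pv]
    rw [this, pd_add _ (hd p) (hd q), hp, hq]; simp [pv]
  | mul_X p j hp =>
    have : pv (p * X j) = fun x => pv p x * x j := by ext x; simp [pv]
    rw [this, pd_mul _ (hd p) (diff_coord j x), hp, pd_coord]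
    simp only [MvPolynomial.pderiv_mul, pv, map_add, map_mul, MvPolynomial.eval_X, MvPolynomial.pderiv_X, Pi.single_apply, dl]
    by_cases hij : i = j
    · subst hij; simp; ring
    · simp [hij, Ne.symm hij]; ring

lemma pv_bound {k : ℕ} {p : MvPolynomial (Fin n) ℝ} (h : p.IsHomogeneous k) :
    ∃ B, 0 ≤ B ∧ ∀ x : EE n, |pv p x| ≤ B * ‖x‖ ^ k := by
  refine ⟨∑ d ∈ p.support, |p.coeff d|, by positivity, fun x => ?_⟩
  rw [pv, MvPolynomial.eval_eq', Finset.sum_mul]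
  refine (Finset.abs_sum_le_sum_abs _ _).trans (Finset.sum_le_sum fun d hd => ?_)
  rw [abs_mul, Finset.abs_prod]
  refine mul_le_mul_of_nonneg_left ?_ (abs_nonneg _)
  have hk : ∑ i, d i = k := by
    have := h (MvPolynomial.mem_support_iff.1 hd)
    simpa [Finsupp.weight_apply, Finsupp.sum_fintype] using this
  rw [← hk, ← Finset.prod_pow_eq_pow_sum]
  refine Finset.prod_le_prod (fun _ _ => abs_nonneg _) fun i _ => ?_
  rw [abs_pow]
  exact pow_le_pow_left₀ (abs_nonneg _) (by simpa using PiLp.norm_apply_le x i) _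

lemma contDiffAt_nrm {x : EE n} (hx : x ≠ 0) (s : ℝ) {k : WithTop ℕ∞} :
    ContDiffAt ℝ k (fun y : EE n => ‖y‖ ^ s) x :=
  (contDiffAt_norm ℝ hx).rpow_const_of_ne (norm_ne_zero_iff.2 hx)

lemma pd_nrm (i : Fin n) {x : EE n} (hx : x ≠ 0) (s : ℝ) :
    pd i (fun y : EE n => ‖y‖ ^ s) x = s * x i * ‖x‖ ^ (s - 2) := by
  have e : (fun y : EE n => ‖y‖ ^ s) = fun y => (0 + ‖y‖ ^ 2) ^ (s / 2) := by
    ext y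
    rw [zero_add, ← Real.rpow_natCast, ← Real.rpow_mul (norm_nonneg _)]; congr 1; push_cast; ring
  have hx' := norm_pos_iff.2 hx
  rw [e, pd_rpow i (by
    exact (contDiff_const.add (contDiff_norm_sq ℝ)).differentiable (n := 1) (by norm_num) x) (by positivity),
    pd_normsq, zero_add, ← Real.rpow_natCast, ← Real.rpow_mul (norm_nonneg _),
    show ((2:ℕ):ℝ) * (s / 2 - 1) = s - 2 by push_cast; ring]
  ring

noncomputable def KK (k : ℕ) (p : MvPolynomial (Fin n) ℝ) (x : EE n) : ℝ := pv p x * ‖x‖ ^ cc n k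

lemma contDiffAt_KK (k : ℕ) (p : MvPolynomial (Fin n) ℝ) {x : EE n} (hx : x ≠ 0) {j : WithTop ℕ∞} :
    ContDiffAt ℝ j (KK k p) x := (contDiff_pv p).contDiffAt.mul (contDiffAt_nrm hx _)

lemma pd_KK (k : ℕ) (p : MvPolynomial (Fin n) ℝ) (i : Fin n) {x : EE n} (hx : x ≠ 0) :
    pd i (KK k p) x = KK (k + 1) (TT (cc n k) i p) x := by
  have hx' := norm_pos_iff.2 hx
  unfold KK
  rw [pd_mul _ ((contDiff_pv p (k := 1)).differentiable (by norm_num) x)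
    ((contDiffAt_nrm hx _ (k := 1)).differentiableAt (by norm_num)), pd_nrm i hx, pd_pv]
  have e1 : cc n (k + 1) = cc n k - 2 := by simp [cc]; ring
  have e2 : ‖x‖ ^ cc n k = ‖x‖ ^ (cc n k - 2) * ‖x‖ ^ 2 := by
    rw [← Real.rpow_natCast ‖x‖ 2, ← Real.rpow_add hx']; congr 1; push_cast; ring
  rw [e1, e2]
  simp only [pv, TT, r2, map_add, map_mul, map_sum, MvPolynomial.eval_X, MvPolynomial.eval_C]
  rw [norm_sq_sum]
  simp only [pow_two]
  ring

lemma lap_KK {k : ℕ} {p : MvPolynomial (Fin n) ℝ} (h : Hp k p) {x : EE n} (hx : x ≠ 0) :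
    lap (KK k p) x = 0 := by
  have : ∀ i, pd i (pd i (KK k p)) x = KK (k + 1 + 1) (TT (cc n (k+1)) i (TT (cc n k) i p)) x := fun i => by
    rw [← pd_KK _ _ _ hx]
    refine pd_congr i ?_
    filter_upwards [isOpen_ne.mem_nhds hx] with y hy using pd_KK k p i hy
  simp only [lap, this, KK, ← Finset.sum_mul]
  have e := congrArg (fun q => pv q x) h.TTTT
  simp only [pv, map_sum, map_zero] at e ⊢
  rw [e, zero_mul]

noncomputable def ZZ (y : EE n) : ℕ → MvPolynomial (Fin n) ℝ
  | 0 => 1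
  | k + 1 => ∑ i, C (y i) * TT (cc n k) i (ZZ y k)

lemma ZZ_fam (k : ℕ) : ∃ (ι : Type) (_ : Fintype ι) (c : ι → EE n → ℝ) (q : ι → MvPolynomial (Fin n) ℝ),
    (∀ a, Continuous (c a)) ∧ (∀ a y, |c a y| ≤ ‖y‖ ^ k) ∧ (∀ a, Hp k (q a)) ∧
    ∀ y, ZZ y k = ∑ a, C (c a y) * q a := by
  induction k with
  | zero =>
    refine ⟨Unit, inferInstance, fun _ _ => 1, fun _ => 1, fun _ => continuous_const, fun _ _ => by simp,
      fun _ => ⟨MvPolynomial.isHomogeneous_one _ _, by simp⟩, fun y => by simp [ZZ]⟩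
  | succ k ih =>
    obtain ⟨ι, _, c, q, h1, h2, h3, h4⟩ := ih
    refine ⟨Fin n × ι, inferInstance, fun a y => y a.1 * c a.2 y, fun a => TT (cc n k) a.1 (q a.2),
      fun a => (EuclideanSpace.proj a.1 : EE n →L[ℝ] ℝ).continuous.mul (h1 _), fun a y => ?_,
      fun a => (h3 _).TT _, fun y => ?_⟩
    · rw [abs_mul, pow_succ']
      exact mul_le_mul (by simpa using PiLp.norm_apply_le y a.1) (h2 _ _) (abs_nonneg _) (norm_nonneg _)
    · rw [ZZ, Fintype.sum_prod_type, h4]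
      refine Finset.sum_congr rfl fun i _ => ?_
      simp only [TT, map_sum, MvPolynomial.pderiv_C_mul, Finset.mul_sum, map_mul]
      rw [← Finset.sum_add_distrib, Finset.mul_sum]
      refine Finset.sum_congr rfl fun a _ => ?_
      ring

lemma deriv_KK (k : ℕ) (x y : EE n) {s : ℝ} (h : x - s • y ≠ 0) :
    HasDerivAt (fun t : ℝ => (-1) ^ k * KK k (ZZ y k) (x - t • y))
      ((-1) ^ (k + 1) * KK (k + 1) (ZZ y (k + 1)) (x - s • y)) s := by
  have h1 : HasDerivAt (fun t : ℝ => x - t • y) (-y) s := by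
    simpa using ((hasDerivAt_id s).smul_const y).const_sub x
  have h2 := ((contDiffAt_KK k (ZZ y k) h (j := 1)).differentiableAt (by norm_num)).hasFDerivAt
  have h3 := (h2.comp_hasDerivAt s h1).const_mul ((-1:ℝ) ^ k)
  refine h3.congr_deriv ?_
  rw [map_neg, fderiv_eq_sum, pow_succ]
  simp only [pd_KK _ _ _ h, KK, ZZ, pv, map_sum, map_mul, MvPolynomial.eval_C, Finset.sum_mul, Finset.mul_sum,
    mul_assoc, mul_neg, neg_mul, one_mul]
  rw [Finset.sum_neg_distrib]

lemma taylor_seq (N : ℕ) : ∀ (φ : ℕ → ℝ → ℝ) (M : ℝ), (∀ k, ∀ s ∈ Set.Icc (0:ℝ) 1, HasDerivAt (φ k) (φ (k + 1) s) s) →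
    (∀ s ∈ Set.Icc (0:ℝ) 1, |φ (N + 1) s| ≤ M) → ∀ t ∈ Set.Icc (0:ℝ) 1,
    |φ 0 t - ∑ k ∈ Finset.range (N + 1), t ^ k / k.factorial * φ k 0| ≤ M := by
  induction N with
  | zero =>
    intro φ M h1 h2 t ht
    have := norm_image_sub_le_of_norm_deriv_le_segment' (fun x hx => (h1 0 x hx).hasDerivWithinAt)
      (fun x hx => h2 x ⟨hx.1, hx.2.le⟩) t ht
    simp only [zero_add, Finset.range_one, Finset.sum_singleton, pow_zero, Nat.factorial_zero, Nat.cast_one, div_one, one_mul]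
    rw [Real.norm_eq_abs] at this
    have hM := (abs_nonneg _).trans (h2 t ht)
    nlinarith [ht.1, ht.2]
  | succ N ih =>
    intro φ M h1 h2 t ht
    have key := ih (fun k => φ (k + 1)) M (fun k s hs => h1 (k + 1) s hs) h2
    have hder : ∀ s ∈ Set.Icc (0:ℝ) 1, HasDerivAt (fun s => φ 0 s - ∑ k ∈ Finset.range (N + 1 + 1), s ^ k / k.factorial * φ k 0)
        (φ 1 s - ∑ k ∈ Finset.range (N + 1), s ^ k / k.factorial * φ (k + 1) 0) s := fun s hs => by
      refine (h1 0 s hs).sub ?_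
      have e : (fun s => ∑ k ∈ Finset.range (N + 1 + 1), s ^ k / k.factorial * φ k 0) =
          fun s : ℝ => ∑ k ∈ Finset.range (N + 1), s ^ (k + 1) / (k + 1).factorial * φ (k + 1) 0 + φ 0 0 := by
        ext s; rw [Finset.sum_range_succ']; simp
      rw [e]
      refine HasDerivAt.add_const _ (HasDerivAt.fun_sum fun k _ => ?_)
      have := (((hasDerivAt_pow (k + 1) s).div_const ((k + 1).factorial : ℝ)).mul_const (φ (k + 1) 0))
      refine this.congr_deriv ?_
      rw [Nat.factorial_succ]; push_cast
      have : (k.factorial : ℝ) ≠ 0 := by positivity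
      field_simp
    have := norm_image_sub_le_of_norm_deriv_le_segment' (fun x hx => (hder x hx).hasDerivWithinAt)
      (fun x hx => key x ⟨hx.1, hx.2.le⟩) t ht
    rw [Real.norm_eq_abs] at this
    have e0 : φ 0 0 - ∑ k ∈ Finset.range (N + 1 + 1), (0:ℝ) ^ k / k.factorial * φ k 0 = 0 := by
      rw [Finset.sum_range_succ']; simp
    rw [e0, sub_zero] at this
    have hM := (abs_nonneg _).trans (h2 t ht)
    nlinarith [ht.1, ht.2]

end MAE

open Filter Topology Metric

namespace MAE
open MeasureTheory
open MvPolynomial (C)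
variable {n : ℕ}

lemma KK_bound (k : ℕ) : ∃ B, 0 ≤ B ∧ ∀ x y : EE n, x ≠ 0 →
    |KK k (ZZ y k) x| ≤ B * ‖y‖ ^ k * ‖x‖ ^ ((2:ℝ) - n - k) := by
  obtain ⟨ι, _, c, q, -, h2, h3, h4⟩ := ZZ_fam (n := n) k
  choose B hB0 hB using fun a => pv_bound (h3 a).1
  refine ⟨∑ a, B a, Finset.sum_nonneg fun a _ => hB0 a, fun x y hx => ?_⟩
  have hx' := norm_pos_iff.2 hx
  have e : ‖x‖ ^ ((2:ℝ) - n - k) = ‖x‖ ^ k * ‖x‖ ^ cc n k := by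
    rw [← Real.rpow_natCast, ← Real.rpow_add hx']; congr 1; simp [cc]; ring
  rw [KK, abs_mul, abs_of_pos (Real.rpow_pos_of_pos hx' (cc n k)), e, ← mul_assoc]
  refine mul_le_mul_of_nonneg_right ?_ (by positivity)
  simp only [h4, pv, map_sum, map_mul, MvPolynomial.eval_C]
  rw [Finset.sum_mul, Finset.sum_mul]
  refine (Finset.abs_sum_le_sum_abs _ _).trans (Finset.sum_le_sum fun a _ => ?_)
  rw [abs_mul]
  calc _ ≤ ‖y‖ ^ k * (B a * ‖x‖ ^ k) := mul_le_mul (h2 a y) (hB a x) (abs_nonneg _) (by positivity)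
    _ = _ := by ring

noncomputable def Rm (N : ℕ) (x y : EE n) : ℝ := ‖x - y‖ ^ ((2:ℝ) - n) -
  ∑ k ∈ Finset.range (N + 1), (-1) ^ k / k.factorial * KK k (ZZ y k) x

lemma KK_zero (x y : EE n) : KK 0 (ZZ y 0) x = ‖x‖ ^ ((2:ℝ) - n) := by
  simp [KK, ZZ, pv, cc]

lemma rem_A (hn : 3 ≤ n) (N : ℕ) : ∃ B, 0 ≤ B ∧ ∀ x y : EE n, x ≠ 0 → ‖y‖ ≤ ‖x‖ / 2 →
    |Rm N x y| ≤ B * ‖y‖ ^ (N + 1) * ‖x‖ ^ ((1:ℝ) - n - N) := by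
  obtain ⟨B, hB0, hB⟩ := KK_bound (n := n) (N + 1)
  have hn' : (3:ℝ) ≤ n := by exact_mod_cast hn
  refine ⟨B * (2⁻¹) ^ ((1:ℝ) - n - N), by positivity, fun x y hx hy => ?_⟩
  have hx' := norm_pos_iff.2 hx
  have hz : ∀ s ∈ Set.Icc (0:ℝ) 1, ‖x‖ / 2 ≤ ‖x - s • y‖ := fun s hs => by
    have h1 := norm_sub_norm_le x (s • y)
    rw [norm_smul, Real.norm_eq_abs, abs_of_nonneg hs.1] at h1
    have := mul_le_of_le_one_left (norm_nonneg y) hs.2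
    linarith
  have hz0 : ∀ s ∈ Set.Icc (0:ℝ) 1, x - s • y ≠ 0 := fun s hs => by
    have := hz s hs
    rw [← norm_pos_iff]; linarith
  have := taylor_seq N (fun k t => (-1) ^ k * KK k (ZZ y k) (x - t • y))
    (B * ‖y‖ ^ (N + 1) * (‖x‖ / 2) ^ ((1:ℝ) - n - N)) (fun k s hs => deriv_KK k x y (hz0 s hs)) (fun s hs => ?_)
    1 (by simp)
  · simp only [pow_zero, one_mul, one_smul, zero_smul, sub_zero, one_pow, KK_zero] at this
    rw [div_eq_inv_mul ‖x‖ 2, Real.mul_rpow (by positivity) (by positivity)] at this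
    unfold Rm
    convert this using 1
    · congr 2
      refine Finset.sum_congr rfl fun k _ => ?_
      ring
    · ring
  · rw [abs_mul, abs_pow, abs_neg, abs_one, one_pow, one_mul]
    refine (hB _ _ (hz0 s hs)).trans ?_
    rw [show (2:ℝ) - n - ((N + 1 : ℕ) : ℝ) = 1 - n - N by push_cast; ring]
    refine mul_le_mul_of_nonneg_left ?_ (by positivity)
    exact Real.rpow_le_rpow_of_nonpos (by positivity) (hz s hs) (by have : (0:ℝ) ≤ N := by positivity
                                                                    linarith)

lemma rem_B (N : ℕ) : ∃ B, 0 ≤ B ∧ ∀ x y : EE n, x ≠ 0 → ‖x‖ / 2 ≤ ‖y‖ →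
    |Rm N x y| ≤ ‖x - y‖ ^ ((2:ℝ) - n) + B * ‖y‖ ^ N * ‖x‖ ^ ((2:ℝ) - n - N) := by
  choose B hB0 hB using fun k => KK_bound (n := n) k
  refine ⟨∑ k ∈ Finset.range (N + 1), B k * 2 ^ N, Finset.sum_nonneg fun k _ => mul_nonneg (hB0 k) (by positivity),
    fun x y hx hy => ?_⟩
  have hx' := norm_pos_iff.2 hx
  refine (abs_sub _ _).trans (add_le_add (abs_of_nonneg (by positivity)).le ?_)
  rw [Finset.sum_mul, Finset.sum_mul]
  refine (Finset.abs_sum_le_sum_abs _ _).trans (Finset.sum_le_sum fun k hk => ?_)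
  have hkN : k ≤ N := Nat.lt_succ_iff.1 (Finset.mem_range.1 hk)
  rw [abs_mul, abs_div, abs_pow, abs_neg, abs_one, one_pow, Nat.abs_cast]
  have h1 : (1:ℝ) / k.factorial ≤ 1 := by
    rw [div_le_one (by positivity)]; exact_mod_cast Nat.succ_le_of_lt (Nat.factorial_pos k)
  refine (mul_le_of_le_one_left (abs_nonneg _) h1).trans ((hB k x y hx).trans ?_)
  have e : ‖x‖ ^ ((2:ℝ) - n - k) = ‖x‖ ^ (N - k) * ‖x‖ ^ ((2:ℝ) - n - N) := by
    rw [← Real.rpow_natCast, ← Real.rpow_add hx', Nat.cast_sub hkN]; congr 1; ring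
  rw [e, ← mul_assoc]
  refine mul_le_mul_of_nonneg_right ?_ (by positivity)
  rw [mul_assoc, mul_assoc]
  refine mul_le_mul_of_nonneg_left ?_ (hB0 k)
  calc ‖y‖ ^ k * ‖x‖ ^ (N - k) ≤ (2 * ‖y‖) ^ k * (2 * ‖y‖) ^ (N - k) := by
        gcongr <;> linarith [norm_nonneg y]
    _ = 2 ^ N * ‖y‖ ^ N := by rw [← pow_add, Nat.add_sub_cancel' hkN, mul_pow]

noncomputable def cn (n : ℕ) : ℝ := n * (volume : Measure (EE n)).real (ball 0 1)

lemma rad (hn : 3 ≤ n) {s : Set ℝ} (hs : MeasurableSet s) (hs0 : s ⊆ Set.Ioi 0) {h : ℝ → ℝ}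
    (hi : IntegrableOn h s) :
    Integrable (fun y : EE n => s.indicator (fun r => r ^ ((1:ℝ) - n) * h r) ‖y‖) ∧
    ∫ y : EE n, s.indicator (fun r => r ^ ((1:ℝ) - n) * h r) ‖y‖ = cn n * ∫ r in s, h r := by
  have : Nontrivial (EE n) := by
    have : Nonempty (Fin n) := ⟨⟨0, by omega⟩⟩
    infer_instance
  have e : ∀ r : ℝ, r ^ (n - 1) • s.indicator (fun r => r ^ ((1:ℝ) - n) * h r) r = s.indicator h r := fun r => by
    by_cases hr : r ∈ s
    · have hr0 : 0 < r := hs0 hr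
      rw [Set.indicator_of_mem hr, Set.indicator_of_mem hr, smul_eq_mul, ← mul_assoc, ← Real.rpow_natCast,
        ← Real.rpow_add hr0, Nat.cast_sub (by omega)]
      simp
    · simp [hr]
  constructor
  · rw [integrable_fun_norm_addHaar volume (f := s.indicator (fun r => r ^ ((1:ℝ) - n) * h r))]
    simp only [finrank_euclideanSpace, Fintype.card_fin, e]
    exact ((integrable_indicator_iff hs).2 hi).integrableOn
  · rw [integral_fun_norm_addHaar volume]
    simp only [finrank_euclideanSpace, Fintype.card_fin, e]
    rw [setIntegral_indicator hs, Set.inter_eq_self_of_subset_right hs0]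
    simp [cn, mul_assoc]

lemma cn_nonneg : 0 ≤ cn n := by unfold cn; positivity

lemma rem_int (hn : 3 ≤ n) {μ : ℝ} (hμ : (n:ℝ) < μ) {g : EE n → ℝ} (hd : Dec (-μ) g) (N : ℕ)
    (hN : N < μ - n) {h H : ℝ → ℝ} (h1 : ∀ r, 0 < r → r ^ (N + 1) * (1 + r) ^ (-μ) ≤ r ^ ((1:ℝ) - n) * h r)
    (h2 : ∀ R, 1 ≤ R → IntegrableOn h (Set.Ioc 0 R) ∧ ∫ r in Set.Ioc 0 R, h r ≤ H R) :
    ∃ K, 0 ≤ K ∧ ∀ x : EE n, 2 ≤ ‖x‖ →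
      |∫ y, Rm N x y * g y| ≤ K * (‖x‖ ^ ((1:ℝ) - n - N) * H (‖x‖ / 2) + ‖x‖ ^ (2 - μ)) := by
  have hn' : (3:ℝ) ≤ n := by exact_mod_cast hn
  obtain ⟨A, hA0, hA⟩ := rem_A (n := n) hn N
  obtain ⟨B, hB0, hB⟩ := rem_B (n := n) N
  obtain ⟨D, hD0, hD⟩ := hd
  have hN0 : (0:ℝ) ≤ N := by positivity
  set q : ℝ := N + n - μ with hq
  have hq0 : q < 0 := by linarith
  refine ⟨cn n * (D * A + D * 2 ^ μ / 2 + D * (2 ^ N + B) * 2 ^ (-q) / (-q)), ?_, fun x hx => ?_⟩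
  · have := cn_nonneg (n := n)
    have : 0 ≤ D * (2 ^ N + B) * 2 ^ (-q) / (-q) := div_nonneg (by positivity) (by linarith)
    positivity
  set R := ‖x‖ with hR
  have hR0 : 0 < R := by linarith
  have hx0 : x ≠ 0 := norm_pos_iff.1 hR0
  obtain ⟨i1, j1⟩ := rad hn (s := Set.Ioc 0 (R/2)) measurableSet_Ioc (fun r hr => hr.1) (h2 (R/2) (by linarith)).1
  have hint2 : IntegrableOn (fun r : ℝ => r) (Set.Ioc 0 R) :=
    (intervalIntegrable_iff_integrableOn_Ioc_of_le hR0.le).1 (continuous_id.intervalIntegrable _ _)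
  obtain ⟨i2, j2⟩ := rad hn (s := Set.Ioc 0 R) measurableSet_Ioc (fun r hr => hr.1) hint2
  have i2' := i2.comp_sub_left x
  have j2' := (integral_sub_left_eq_self (fun y : EE n => (Set.Ioc 0 R).indicator (fun r => r ^ ((1:ℝ) - n) * r) ‖y‖)
    volume x).trans j2
  obtain ⟨i3, j3⟩ := rad hn (s := Set.Ioi (R/2)) measurableSet_Ioi (fun r hr => lt_trans (show (0:ℝ) < R / 2 by positivity) hr)
    (integrableOn_Ioi_rpow_of_lt (show q - 1 < -1 by linarith) (show 0 < R / 2 by positivity))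
  have hbd := norm_integral_le_of_norm_le
    (((i1.const_mul (D * A * R ^ ((1:ℝ) - n - N))).add (i2'.const_mul (D * (R / 2) ^ (-μ)))).add
    (i3.const_mul (D * (2 ^ N + B) * R ^ ((2:ℝ) - n - N)))) (f := fun y => Rm N x y * g y) ?_
  · refine hbd.trans ?_
    simp only [Pi.add_apply]
    have ii := (i1.const_mul (D * A * R ^ ((1:ℝ) - n - N))).add (i2'.const_mul (D * (R / 2) ^ (-μ)))
    simp only [Pi.add_def] at ii
    rw [integral_add ii (i3.const_mul _),
      integral_add (i1.const_mul _) (i2'.const_mul _), integral_const_mul, integral_const_mul, integral_const_mul,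
      j1, j2', j3, ← intervalIntegral.integral_of_le hR0.le, integral_id,
      integral_Ioi_rpow_of_lt (show q - 1 < -1 by linarith) (show 0 < R / 2 by positivity)]
    have hH := (h2 (R/2) (by linarith)).2
    have t1 : D * A * R ^ ((1:ℝ) - n - N) * (cn n * ∫ r in Set.Ioc 0 (R/2), h r) ≤
        cn n * (D * A) * (R ^ ((1:ℝ) - n - N) * H (R / 2)) := by
      have := mul_le_mul_of_nonneg_left hH (show 0 ≤ cn n * (D * A) * R ^ ((1:ℝ) - n - N) from
        mul_nonneg (mul_nonneg cn_nonneg (by positivity)) (by positivity))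
      linarith only [this]
    have t2 : D * (R / 2) ^ (-μ) * (cn n * ((R ^ 2 - 0 ^ 2) / 2)) = cn n * (D * 2 ^ μ / 2) * R ^ (2 - μ) := by
      rw [div_eq_mul_inv R 2, Real.mul_rpow hR0.le (by norm_num), Real.inv_rpow (by norm_num), ← Real.rpow_neg (by norm_num),
        neg_neg, sub_eq_add_neg 2 μ, Real.rpow_add hR0]
      norm_num; ring
    have t3 : D * (2 ^ N + B) * R ^ ((2:ℝ) - n - N) * (cn n * (-(R / 2) ^ (q - 1 + 1) / (q - 1 + 1))) =
        cn n * (D * (2 ^ N + B) * 2 ^ (-q) / (-q)) * R ^ (2 - μ) := by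
      have : R ^ (2 - μ) = R ^ ((2:ℝ) - n - N) * R ^ q := by
        rw [← Real.rpow_add hR0]; congr 1; rw [hq]; ring
      rw [this, sub_add_cancel, div_eq_mul_inv R 2, Real.mul_rpow hR0.le (by norm_num), Real.inv_rpow (by norm_num),
        ← Real.rpow_neg (by norm_num)]
      have := hq0.ne
      field_simp
    have hHn : 0 ≤ H (R/2) := by
      refine le_trans (setIntegral_nonneg measurableSet_Ioc fun r hr => ?_) hH
      have h0 := h1 r hr.1
      have hr0 : 0 < r := hr.1
      have : 0 ≤ r ^ ((1:ℝ) - n) * h r := le_trans (by positivity) h0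
      exact nonneg_of_mul_nonneg_right this (by positivity)
    have p1 : 0 ≤ cn n * (D * A) * R ^ (2 - μ) := mul_nonneg (mul_nonneg cn_nonneg (by positivity)) (by positivity)
    have p2 : 0 ≤ cn n * (D * 2 ^ μ / 2 + D * (2 ^ N + B) * 2 ^ (-q) / (-q)) * (R ^ ((1:ℝ) - n - N) * H (R / 2)) := by
      have : 0 ≤ D * (2 ^ N + B) * 2 ^ (-q) / (-q) := div_nonneg (by positivity) (by linarith)
      exact mul_nonneg (mul_nonneg cn_nonneg (by positivity)) (by positivity)
    linarith only [t1, t2, t3, p1, p2]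
  · have : ∀ᵐ y : EE n, y ≠ 0 := by
      have : Nontrivial (EE n) := by
        have : Nonempty (Fin n) := ⟨⟨0, by omega⟩⟩
        infer_instance
      simp [ae_iff]
    filter_upwards [this] with y hy
    have hy0 : 0 < ‖y‖ := norm_pos_iff.2 hy
    rw [Real.norm_eq_abs, abs_mul]
    simp only [Pi.add_apply]
    have n2 : 0 ≤ D * (R / 2) ^ (-μ) * (Set.Ioc 0 R).indicator (fun r => r ^ ((1:ℝ) - n) * r) ‖x - y‖ :=
      mul_nonneg (by positivity) (Set.indicator_nonneg (fun r hr => mul_nonneg (Real.rpow_nonneg hr.1.le _) hr.1.le) _)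
    rcases le_or_gt ‖y‖ (R / 2) with hc | hc
    · have e3 : (Set.Ioi (R/2)).indicator (fun r => r ^ ((1:ℝ) - n) * r ^ (q - 1)) ‖y‖ = 0 :=
        Set.indicator_of_notMem (by simpa using hc) _
      rw [e3, Set.indicator_of_mem (show ‖y‖ ∈ Set.Ioc 0 (R/2) from ⟨hy0, hc⟩), mul_zero, add_zero]
      refine le_trans ?_ (le_add_of_nonneg_right n2)
      calc |Rm N x y| * |g y| ≤ (A * ‖y‖ ^ (N + 1) * R ^ ((1:ℝ) - n - N)) * (D * (1 + ‖y‖) ^ (-μ)) :=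
            mul_le_mul (hA x y hx0 hc) (hD y) (abs_nonneg _) (by positivity)
        _ = D * A * R ^ ((1:ℝ) - n - N) * (‖y‖ ^ (N + 1) * (1 + ‖y‖) ^ (-μ)) := by ring
        _ ≤ _ := mul_le_mul_of_nonneg_left (h1 _ hy0) (by positivity)
    · have e1 : (Set.Ioc 0 (R/2)).indicator (fun r => r ^ ((1:ℝ) - n) * h r) ‖y‖ = 0 :=
        Set.indicator_of_notMem (fun hh => absurd hh.2 (by simpa using hc)) _
      rw [e1, mul_zero, zero_add, Set.indicator_of_mem (show ‖y‖ ∈ Set.Ioi (R/2) from hc)]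
      have hgy : |g y| ≤ D * ‖y‖ ^ (-μ) := (hD y).trans (mul_le_mul_of_nonneg_left
        (Real.rpow_le_rpow_of_nonpos hy0 (by linarith) (by linarith)) hD0)
      have hgR : |g y| ≤ D * (R / 2) ^ (-μ) := hgy.trans (mul_le_mul_of_nonneg_left
        (Real.rpow_le_rpow_of_nonpos (by positivity) hc.le (by linarith)) hD0)
      have ey : ‖y‖ ^ ((1:ℝ) - n) * ‖y‖ ^ (q - 1) = ‖y‖ ^ N * ‖y‖ ^ (-μ) := by
        rw [← Real.rpow_natCast, ← Real.rpow_add hy0, ← Real.rpow_add hy0]; congr 1; rw [hq]; ring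
      have k1 : ‖x - y‖ ^ ((2:ℝ) - n) * |g y| ≤
          D * (R / 2) ^ (-μ) * (Set.Ioc 0 R).indicator (fun r => r ^ ((1:ℝ) - n) * r) ‖x - y‖
          + D * 2 ^ N * R ^ ((2:ℝ) - n - N) * (‖y‖ ^ N * ‖y‖ ^ (-μ)) := by
        have pp : 0 ≤ D * 2 ^ N * R ^ ((2:ℝ) - n - N) * (‖y‖ ^ N * ‖y‖ ^ (-μ)) := by positivity
        rcases eq_or_lt_of_le (norm_nonneg (x - y)) with hz | hz
        · rw [← hz] at n2 ⊢
          rw [Real.zero_rpow (by linarith), zero_mul]; linarith only [n2, pp]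
        rcases le_or_gt ‖x - y‖ R with hw | hw
        · rw [Set.indicator_of_mem (show ‖x - y‖ ∈ Set.Ioc 0 R from ⟨hz, hw⟩)]
          have ez : ‖x - y‖ ^ ((1:ℝ) - n) * ‖x - y‖ = ‖x - y‖ ^ ((2:ℝ) - n) := by
            rw [← Real.rpow_add_one hz.ne']; congr 1; ring
          rw [ez]
          have := mul_le_mul_of_nonneg_left hgR (show 0 ≤ ‖x - y‖ ^ ((2:ℝ) - n) by positivity)
          linarith only [this, pp]
        · have a1 : ‖x - y‖ ^ ((2:ℝ) - n) ≤ R ^ ((2:ℝ) - n) := Real.rpow_le_rpow_of_nonpos hR0 hw.le (by linarith)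
          have a2 : R ^ ((2:ℝ) - n) = R ^ ((2:ℝ) - n - N) * R ^ N := by
            rw [← Real.rpow_natCast, ← Real.rpow_add hR0]; congr 1; ring
          have a3 : R ^ N ≤ 2 ^ N * ‖y‖ ^ N := by
            rw [← mul_pow]; exact pow_le_pow_left₀ hR0.le (by linarith) _
          have a4 : ‖x - y‖ ^ ((2:ℝ) - n) ≤ R ^ ((2:ℝ) - n - N) * (2 ^ N * ‖y‖ ^ N) := by
            rw [a2] at a1; exact a1.trans (mul_le_mul_of_nonneg_left a3 (by positivity))
          have := mul_le_mul a4 hgy (abs_nonneg _) (by positivity)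
          linarith only [this, n2]
      have k2 := mul_le_mul_of_nonneg_left hgy (show 0 ≤ B * ‖y‖ ^ N * R ^ ((2:ℝ) - n - N) by positivity)
      have k3 := mul_le_mul_of_nonneg_right (hB x y hx0 hc.le) (abs_nonneg (g y))
      rw [ey]
      linarith only [k1, k2, k3]

end MAE

open Filter Topology Metric

namespace MAE
open MeasureTheory
open MvPolynomial (C)
variable {n : ℕ}

lemma mp_term {μ : ℝ} {g : EE n → ℝ} (hc : Continuous g) (hd : Dec (-μ) g) (k : ℕ) :
    ∃ P : MvPolynomial (Fin n) ℝ, Hp k P ∧ ((k:ℝ) < μ - n → ∀ x : EE n,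
      Integrable (fun y => (-1) ^ k / k.factorial * KK k (ZZ y k) x * g y) ∧
      ∫ y, (-1) ^ k / k.factorial * KK k (ZZ y k) x * g y = KK k P x) := by
  obtain ⟨ι, _, c, q, h1, h2, h3, h4⟩ := ZZ_fam (n := n) k
  refine ⟨C ((-1 : ℝ) ^ k / k.factorial) * ∑ a, C (∫ y, c a y * g y) * q a,
    (Hp.sum _ fun a => (h3 a).C_mul _).C_mul _, fun hk x => ?_⟩
  have hi : ∀ a, Integrable (fun y => c a y * g y) := fun a => by
    have : Dec k (c a) := ⟨1, zero_le_one, fun y => (h2 a y).trans (by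
      rw [one_mul, Real.rpow_natCast]; gcongr; linarith [norm_nonneg y])⟩
    exact (this.mul hd).integrable ((h1 a).mul hc) (by linarith)
  have e : (fun y => (-1) ^ k / k.factorial * KK k (ZZ y k) x * g y) =
      fun y => ∑ a, ((-1) ^ k / k.factorial * KK k (q a) x) * (c a y * g y) := by
    ext y
    simp only [KK, h4, pv, map_sum, map_mul, MvPolynomial.eval_C, Finset.sum_mul, Finset.mul_sum]
    exact Finset.sum_congr rfl fun a _ => by ring
  rw [e]
  refine ⟨integrable_finsetSum _ fun a _ => (hi a).const_mul _, ?_⟩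
  rw [integral_finsetSum _ fun a _ => (hi a).const_mul _]
  simp only [integral_const_mul, KK, pv, map_sum, map_mul, MvPolynomial.eval_C, Finset.sum_mul, Finset.mul_sum]
  exact Finset.sum_congr rfl fun a _ => by ring

lemma mp_int (hn : 3 ≤ n) {μ : ℝ} (hμ : (n:ℝ) < μ) {g : EE n → ℝ} (hd : Dec (-μ) g) (N L : ℕ)
    (hN : N < μ - n) (hL : L = 0 ∧ μ - n < N + 1 ∨ L = 1 ∧ μ - n = N + 1) :
    ∃ K, 0 ≤ K ∧ ∀ x : EE n, 2 ≤ ‖x‖ → |∫ y, Rm N x y * g y| ≤ K * ‖x‖ ^ (2 - μ) * Real.log ‖x‖ ^ L := by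
  have hn' : (3:ℝ) ≤ n := by exact_mod_cast hn
  rcases hL with ⟨rfl, hL⟩ | ⟨rfl, hL⟩
  · set s : ℝ := N + n - μ with hs
    have hs1 : 0 < s + 1 := by linarith
    have key := rem_int hn hμ hd N hN (h := fun r => r ^ s) (H := fun R => R ^ (s + 1) / (s + 1))
      (fun r hr => ?_) fun R hR => ⟨?_, ?_⟩
    · obtain ⟨K, hK0, hK⟩ := key
      refine ⟨K * ((2:ℝ)⁻¹ ^ (s + 1) / (s + 1) + 1), by positivity, fun x hx => (hK x hx).trans_eq ?_⟩
      have hx0 : 0 < ‖x‖ := by linarith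
      rw [div_eq_mul_inv ‖x‖, Real.mul_rpow (by positivity) (by positivity),
        show ‖x‖ ^ (2 - μ) = ‖x‖ ^ ((1:ℝ) - n - N) * ‖x‖ ^ (s + 1) by
          rw [← Real.rpow_add hx0]; congr 1; rw [hs]; ring]
      ring
    · have : (1 + r) ^ (-μ) ≤ r ^ (-μ) := Real.rpow_le_rpow_of_nonpos hr (by linarith) (by linarith)
      refine (mul_le_mul_of_nonneg_left this (by positivity)).trans_eq ?_
      rw [← Real.rpow_natCast, ← Real.rpow_add hr, ← Real.rpow_add hr]; congr 1; push_cast; rw [hs]; ring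
    · exact (intervalIntegrable_iff_integrableOn_Ioc_of_le (by linarith)).1
        (intervalIntegral.intervalIntegrable_rpow' (by linarith))
    · rw [← intervalIntegral.integral_of_le (by linarith), integral_rpow (Or.inl (by linarith)),
        Real.zero_rpow hs1.ne', sub_zero]
  · have key := rem_int hn hμ hd N hN (h := fun r => (1 + r)⁻¹) (H := fun R => Real.log (1 + R))
      (fun r hr => ?_) fun R hR => ⟨?_, ?_⟩
    · obtain ⟨K, hK0, hK⟩ := key
      refine ⟨K * 3, by positivity, fun x hx => (hK x hx).trans ?_⟩
      have hx0 : 0 < ‖x‖ := by linarith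
      have h1 : Real.log (1 + ‖x‖ / 2) ≤ Real.log ‖x‖ := Real.log_le_log (by positivity) (by linarith)
      have h2 : 1 ≤ 2 * Real.log ‖x‖ := by
        have := Real.log_le_log (by norm_num) hx
        linarith [Real.log_two_gt_d9]
      rw [show (1:ℝ) - n - N = 2 - μ by linarith, pow_one]
      have := mul_le_mul_of_nonneg_left (show Real.log (1 + ‖x‖ / 2) + 1 ≤ 3 * Real.log ‖x‖ by linarith)
        (show 0 ≤ K * ‖x‖ ^ (2 - μ) by positivity)
      linarith only [this]
    · have : (1 + r) ^ (1 - μ) ≤ r ^ (1 - μ) := Real.rpow_le_rpow_of_nonpos hr (by linarith) (by linarith)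
      have e : (1 + r) ^ (-μ) = (1 + r) ^ (1 - μ) * (1 + r)⁻¹ := by
        rw [← Real.rpow_neg_one, ← Real.rpow_add (by positivity)]; congr 1; ring
      have e2 : r ^ ((1:ℝ) - n) = r ^ (N + 1) * r ^ (1 - μ) := by
        rw [← Real.rpow_natCast, ← Real.rpow_add hr]; congr 1; push_cast; linarith
      rw [e, e2, mul_assoc]
      gcongr
    · refine (ContinuousOn.integrableOn_Icc ?_).mono_set Set.Ioc_subset_Icc_self
      exact (continuousOn_const.add continuousOn_id).inv₀ fun r hr => (show (1:ℝ) + r ≠ 0 by have := hr.1; linarith)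
    · rw [← intervalIntegral.integral_of_le (by linarith),
        intervalIntegral.integral_comp_add_left (fun r => r⁻¹) 1, integral_inv_of_pos (by norm_num) (by linarith)]
      simp

lemma multipole (hn : 3 ≤ n) {μ : ℝ} (hμ : (n:ℝ) < μ) {g : EE n → ℝ} (hc : Continuous g) (hd : Dec (-μ) g)
    (N L : ℕ) (hN : N < μ - n) (hL : L = 0 ∧ μ - n < N + 1 ∨ L = 1 ∧ μ - n = N + 1) :
    ∃ P : ℕ → MvPolynomial (Fin n) ℝ, (∀ k, Hp k (P k)) ∧ ∃ K, 0 ≤ K ∧ ∀ x : EE n, 2 ≤ ‖x‖ →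
      |(∫ y, ‖x - y‖ ^ ((2:ℝ) - n) * g y) - ∑ k ∈ Finset.range (N + 1), KK k (P k) x|
        ≤ K * ‖x‖ ^ (2 - μ) * Real.log ‖x‖ ^ L := by
  choose P h1 h2 using mp_term hc hd
  obtain ⟨K, hK0, hK⟩ := mp_int hn hμ hd N L hN hL
  refine ⟨P, h1, K, hK0, fun x hx => (le_of_eq ?_).trans (hK x hx)⟩
  have hk : ∀ k ∈ Finset.range (N + 1), (k:ℝ) < μ - n := fun k hk => by
    have : (k:ℝ) ≤ N := by exact_mod_cast Nat.lt_succ_iff.1 (Finset.mem_range.1 hk)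
    linarith
  have hi : Integrable (fun y => ‖x - y‖ ^ ((2:ℝ) - n) * g y) := by
    have := (int_sing hn hμ (h := fun y => g (y + x)) (hc.comp (by fun_prop)) (hd.comp_add (by linarith [n.cast_nonneg (α := ℝ)]) x)).comp_sub_right x
    simp only [sub_add_cancel] at this
    refine this.mono' (((by fun_prop : Measurable fun y : EE n => ‖x - y‖ ^ ((2:ℝ) - n)).mul hc.measurable).aestronglyMeasurable) (Eventually.of_forall fun y => ?_)
    rw [norm_mul, Real.norm_eq_abs, Real.norm_eq_abs, abs_of_nonneg (by positivity), norm_sub_rev]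
  congr 1
  simp only [Rm, sub_mul, Finset.sum_mul]
  rw [integral_sub hi (integrable_finsetSum _ fun k hk' => (h2 k (hk k hk') x).1),
    integral_finsetSum _ fun k hk' => (h2 k (hk k hk') x).1]
  congr 1
  exact Finset.sum_congr rfl fun k hk' => (h2 k (hk k hk') x).2.symm

end MAE

open Filter Topology Metric

namespace MAE
open Bornology Asymptotics
variable {n : ℕ}

noncomputable def wt (L : ℕ) (p : ℝ) (x : EE n) : ℝ := ‖x‖ ^ p * Real.log ‖x‖ ^ L

lemma ev_R {P : EE n → Prop} : (∀ᶠ x in cobounded (EE n), P x) ↔ ∃ R : ℝ, ∀ x, R ≤ ‖x‖ → P x := by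
  rw [hasBasis_cobounded_norm.eventually_iff]; simp

lemma ev_le (R : ℝ) : ∀ᶠ x in cobounded (EE n), R ≤ ‖x‖ := ev_R.2 ⟨R, fun _ h => h⟩

lemma ev_ev {P : EE n → Prop} (h : ∀ᶠ x in cobounded (EE n), P x) :
    ∀ᶠ x in cobounded (EE n), ∀ᶠ y in 𝓝 x, P y := by
  obtain ⟨R, hR⟩ := ev_R.1 h
  refine ev_R.2 ⟨R + 1, fun x hx => ?_⟩
  filter_upwards [continuous_norm.continuousAt.eventually_const_lt (show R < ‖x‖ by linarith)] with y hy
  exact hR y (le_of_lt hy)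

lemma rpow_cmp {a b r s : ℝ} (p : ℝ) (ha : 0 < a) (hb : 0 < b) (hr : 0 < r) (h1 : a * r ≤ s) (h2 : s ≤ b * r) :
    s ^ p ≤ (a ^ p + b ^ p) * r ^ p := by
  have hs : 0 < s := lt_of_lt_of_le (by positivity) h1
  rw [add_mul, ← Real.mul_rpow ha.le hr.le, ← Real.mul_rpow hb.le hr.le]
  rcases le_total 0 p with hp | hp
  · exact (Real.rpow_le_rpow hs.le h2 hp).trans (le_add_of_nonneg_left (by positivity))
  · exact (Real.rpow_le_rpow_of_nonpos (by positivity) h1 hp).trans (le_add_of_nonneg_right (by positivity))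

lemma wt_cmp (L : ℕ) (p : ℝ) {a b : ℝ} (ha : 0 < a) (hb : 0 < b) : ∃ K R : ℝ, 0 < K ∧ 1 ≤ R ∧
    ∀ x y : EE n, R ≤ ‖x‖ → a * ‖x‖ ≤ ‖y‖ → ‖y‖ ≤ b * ‖x‖ → 1 ≤ ‖y‖ ∧ |wt L p y| ≤ K * wt L p x := by
  refine ⟨(a ^ p + b ^ p) * 2 ^ L, max 1 (max a⁻¹ b), by positivity, le_max_left _ _, fun x y hx h1 h2 => ?_⟩
  obtain ⟨hx1, hx2⟩ := max_le_iff.1 hx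
  obtain ⟨hx2, hx3⟩ := max_le_iff.1 hx2
  have hx0 : 0 < ‖x‖ := by linarith
  have hy : 1 ≤ ‖y‖ := le_trans (by rwa [inv_le_iff_one_le_mul₀' ha] at hx2) h1
  refine ⟨hy, ?_⟩
  have hl : Real.log ‖y‖ ≤ 2 * Real.log ‖x‖ := by
    rw [two_mul, ← Real.log_mul hx0.ne' hx0.ne']
    exact Real.log_le_log (by linarith) (h2.trans (mul_le_mul_of_nonneg_right hx3 hx0.le))
  have hl0 := Real.log_nonneg hy
  have hl1 := Real.log_nonneg hx1
  rw [wt, wt, abs_of_nonneg (by positivity)]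
  calc _ ≤ ((a ^ p + b ^ p) * ‖x‖ ^ p) * (2 * Real.log ‖x‖) ^ L :=
        mul_le_mul (rpow_cmp p ha hb hx0 h1 h2) (pow_le_pow_left₀ hl0 hl L) (by positivity) (by positivity)
    _ = _ := by rw [mul_pow]; ring

def OD (L : ℕ) : ℕ → ℝ → (EE n → ℝ) → Prop
  | 0, p, w => w =O[cobounded (EE n)] wt L p
  | k + 1, p, w => w =O[cobounded (EE n)] wt L p ∧ (∀ᶠ x in cobounded (EE n), DifferentiableAt ℝ w x) ∧
      ∀ i, OD L k (p - 1) (pd i w)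

variable {L k : ℕ} {p q : ℝ} {w w' f g : EE n → ℝ}

lemma OD.bd (h : OD L k p w) : w =O[cobounded (EE n)] wt L p := by
  cases k with
  | zero => exact h
  | succ k => exact h.1

lemma pd_ev (i : Fin n) (h : w =ᶠ[cobounded (EE n)] w') : pd i w =ᶠ[cobounded (EE n)] pd i w' := by
  filter_upwards [ev_ev h] with x hx using pd_congr i hx

lemma OD.congr (h : OD L k p w) (e : w =ᶠ[cobounded (EE n)] w') : OD L k p w' := by
  induction k generalizing p w w' with
  | zero => exact h.congr' e EventuallyEq.rfl
  | succ k ih =>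
    refine ⟨h.1.congr' e EventuallyEq.rfl, ?_, fun i => ih (h.2.2 i) (pd_ev i e)⟩
    filter_upwards [h.2.1, ev_ev e] with x hx he using hx.congr_of_eventuallyEq (EventuallyEq.symm he)

lemma OD.le1 (h : OD L (k + 1) p w) : OD L k p w := by
  induction k generalizing p w with
  | zero => exact h.1
  | succ k ih => exact ⟨h.1, h.2.1, fun i => ih (h.2.2 i)⟩

lemma OD.mono (h : OD 0 k p w) (hp : p ≤ q) : OD 0 k q w := by
  have e : ∀ {p q : ℝ}, p ≤ q → wt 0 p =O[cobounded (EE n)] wt (n := n) 0 q := fun hp => by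
    refine IsBigO.of_bound 1 ?_
    filter_upwards [ev_le 1] with x hx
    simp only [wt, pow_zero, mul_one, one_mul]
    rw [Real.norm_of_nonneg (by positivity), Real.norm_of_nonneg (by positivity)]
    exact Real.rpow_le_rpow_of_exponent_le hx hp
  induction k generalizing p q w with
  | zero => exact IsBigO.trans h (e hp)
  | succ k ih => exact ⟨h.1.trans (e hp), h.2.1, fun i => ih (h.2.2 i) (by linarith)⟩

lemma OD.add (hf : OD L k p f) (hg : OD L k p g) : OD L k p (fun x => f x + g x) := by
  induction k generalizing p f g with
  | zero => exact IsBigO.add hf hg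
  | succ k ih =>
    refine ⟨hf.1.add hg.1, ?_, fun i => (ih (hf.2.2 i) (hg.2.2 i)).congr ?_⟩
    · filter_upwards [hf.2.1, hg.2.1] with x h1 h2 using h1.fun_add h2
    · filter_upwards [hf.2.1, hg.2.1] with x h1 h2 using (pd_add i h1 h2).symm

lemma OD.mul (hf : OD 0 k p f) (hg : OD 0 k q g) : OD 0 k (p + q) (fun x => f x * g x) := by
  have e : ∀ {f g : EE n → ℝ} {p q : ℝ}, f =O[cobounded (EE n)] wt 0 p → g =O[cobounded (EE n)] wt 0 q →
      (fun x => f x * g x) =O[cobounded (EE n)] wt 0 (p + q) := fun h1 h2 => by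
    refine (h1.mul h2).congr' EventuallyEq.rfl ?_
    filter_upwards [ev_le 1] with x hx
    simp only [wt, pow_zero, mul_one]
    rw [← Real.rpow_add (by linarith)]
  induction k generalizing p q f g with
  | zero => exact e hf hg
  | succ k ih =>
    refine ⟨e hf.1 hg.1, ?_, fun i => ?_⟩
    · filter_upwards [hf.2.1, hg.2.1] with x h1 h2 using h1.fun_mul h2
    · have h1 := ih hf.le1 (hg.2.2 i)
      have h2 := ih hg.le1 (hf.2.2 i)
      rw [show p + (q - 1) = p + q - 1 by ring] at h1
      rw [show q + (p - 1) = p + q - 1 by ring] at h2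
      refine (h1.add h2).congr ?_
      filter_upwards [hf.2.1, hg.2.1] with x h1 h2 using (pd_mul i h1 h2).symm

lemma OD.zero : OD L k p (fun _ : EE n => 0) := by
  induction k generalizing p with
  | zero => exact isBigO_zero _ _
  | succ k ih =>
    refine ⟨isBigO_zero _ _, by simp, fun i => ?_⟩
    rw [show pd i (fun _ : EE n => (0:ℝ)) = fun _ => 0 from funext (pd_const i 0)]; exact ih

lemma OD.const (c : ℝ) : OD 0 k 0 (fun _ : EE n => c) := by
  have h : (fun _ : EE n => c) =O[cobounded (EE n)] wt 0 0 := by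
    simp only [show wt (n := n) 0 0 = fun _ => 1 by ext; simp [wt]]
    exact isBigO_const_const _ one_ne_zero _
  cases k with
  | zero => exact h
  | succ k =>
    refine ⟨h, by simp, fun i => ?_⟩
    rw [show pd i (fun _ : EE n => c) = fun _ => 0 from funext (pd_const i c)]; exact OD.zero

lemma OD.const_mul (hf : OD 0 k p f) (c : ℝ) : OD 0 k p (fun x => c * f x) := by
  simpa using (OD.const c).mul hf

lemma OD.sub (hf : OD 0 k p f) (hg : OD 0 k p g) : OD 0 k p (fun x => f x - g x) := by
  convert hf.add (hg.const_mul (-1)) using 2; ring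

lemma OD.sum {ι : Type*} (s : Finset ι) {F : ι → EE n → ℝ} (h : ∀ a ∈ s, OD L k p (F a)) :
    OD L k p (fun x => ∑ a ∈ s, F a x) := by
  classical
  induction s using Finset.induction_on with
  | empty => simpa using OD.zero
  | insert a s ha ih =>
    simp only [Finset.sum_insert ha]
    exact (h a (by simp)).add (ih fun b hb => h b (by simp [hb]))

lemma OD.poly {σ : Type*} {H : σ → EE n → ℝ} (h : ∀ s, OD 0 k 0 (H s)) (q : MvPolynomial σ ℝ) :
    OD 0 k 0 (fun x => MvPolynomial.eval (fun s => H s x) q) := by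
  induction q using MvPolynomial.induction_on with
  | C a => simpa using OD.const a
  | add p q hp hq => simpa using hp.add hq
  | mul_X p s hp => simpa using hp.mul (h s)

lemma OD.exp (hp : p ≤ 0) (h : OD 0 k p f) : OD 0 k p (fun x => Real.exp (f x) - 1) := by
  have e : ∀ {p}, p ≤ 0 → f =O[cobounded (EE n)] wt 0 p →
      (fun x => Real.exp (f x) - 1) =O[cobounded (EE n)] wt 0 p := fun {p} hp h => by
    have hb := (OD.mono (k := 0) h hp).bd
    simp only [show wt (n := n) 0 0 = fun _ => 1 by ext; simp [wt]] at hb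
    obtain ⟨C, hC⟩ := hb.bound
    refine IsBigO.trans (IsBigO.of_bound (Real.exp C) ?_) h
    filter_upwards [hC] with x hx
    have hx : |f x| ≤ C := by simpa using hx
    rw [Real.norm_eq_abs, Real.norm_eq_abs]
    have h1 := Real.add_one_le_exp (f x)
    have h2 := Real.add_one_le_exp (-f x)
    have h3 : Real.exp (f x) ≤ Real.exp C := Real.exp_le_exp.2 ((le_abs_self _).trans hx)
    have h4 : 1 ≤ Real.exp C := Real.one_le_exp ((abs_nonneg _).trans hx)
    have h5 : Real.exp (f x) * Real.exp (-f x) = 1 := by rw [← Real.exp_add]; simp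
    have h6 : Real.exp (f x) - 1 ≤ Real.exp (f x) * f x := by nlinarith [Real.exp_pos (f x)]
    rcases le_total 0 (f x) with hf | hf
    · rw [abs_of_nonneg hf, abs_of_nonneg (by linarith)]
      exact h6.trans (mul_le_mul_of_nonneg_right h3 hf)
    · rw [abs_of_nonpos hf, abs_of_nonpos (by nlinarith [Real.exp_pos (f x)])]
      nlinarith
  induction k generalizing p with
  | zero => exact e hp h
  | succ k ih =>
    refine ⟨e hp h.1, ?_, fun i => ?_⟩
    · filter_upwards [h.2.1] with x hx using hx.exp.sub_const 1
    · have h1 := ((ih hp h.le1).mul (h.2.2 i)).mono (show p + (p - 1) ≤ p - 1 by linarith)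
      refine (h1.add (h.2.2 i)).congr ?_
      filter_upwards [h.2.1] with x hx
      rw [pd, pd, fderiv_sub_const, fderiv_exp hx]
      simp; ring

end MAE

open Filter Topology Metric

namespace MAE
open Bornology Asymptotics
variable {n : ℕ} {L k : ℕ} {p q : ℝ} {w w' f g : EE n → ℝ}

def ES (k : ℕ) (w : EE n → ℝ) : Prop := ∀ᶠ x in cobounded (EE n), ContDiffAt ℝ k w x

lemma ES.pd (h : ES (k + 1) w) (i : Fin n) : ES k (pd i w) := by
  filter_upwards [h] with x hx using contDiffAt_pd i hx

lemma ES.mono (h : ES k w) {j : ℕ} (hj : j ≤ k) : ES j w := by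
  filter_upwards [h] with x hx using hx.of_le (by exact_mod_cast hj)

lemma grad_step (hn : 1 ≤ n) (hC : ES 2 w) (h0 : w =O[cobounded (EE n)] wt L p)
    (h1 : lap w =O[cobounded (EE n)] wt L (p - 2)) (i : Fin n) :
    MAE.pd i w =O[cobounded (EE n)] wt L (p - 1) := by
  have hn' : (1:ℝ) ≤ n := by exact_mod_cast hn
  obtain ⟨C, hC0, hc0⟩ := h0.exists_nonneg
  obtain ⟨D, hD0, hd0⟩ := h1.exists_nonneg
  obtain ⟨R, hR⟩ := ev_R.1 (hC.and (hc0.bound.and hd0.bound))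
  obtain ⟨K, R1, hK, hR1, hw⟩ := wt_cmp (n := n) L p (a := 1/2) (b := 2) (by norm_num) (by norm_num)
  obtain ⟨K', R2, hK', -, hw'⟩ := wt_cmp (n := n) L (p - 2) (a := 1/2) (b := 2) (by norm_num) (by norm_num)
  refine IsBigO.of_bound (2 * n * n * (C * K) + D * K') (ev_R.2 ⟨max (2 * R) (max R1 R2), fun x hx => ?_⟩)
  obtain ⟨hx0, hx⟩ := max_le_iff.1 hx
  obtain ⟨hx1, hx2⟩ := max_le_iff.1 hx
  have hxp : 0 < ‖x‖ := by linarith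
  set d := ‖x‖ / (2 * n) with hd
  have hd0 : 0 < d := by positivity
  have hbox : ∀ y : EE n, (∀ j, |y j - x j| ≤ d) → 1/2 * ‖x‖ ≤ ‖y‖ ∧ ‖y‖ ≤ 2 * ‖x‖ := fun y hy => by
    have h1 : ‖y - x‖ ≤ ‖x‖ / 2 := (norm_le_sum _).trans (by
      calc _ ≤ ∑ j : Fin n, d := Finset.sum_le_sum fun j _ => by simpa using hy j
        _ = ‖x‖ / 2 := by simp [hd]; field_simp)
    have h2 := norm_sub_norm_le x y
    have h3 := norm_sub_norm_le y x
    rw [norm_sub_rev] at h2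
    constructor <;> linarith
  have key := grad_est w x (M := C * (K * wt L p x)) (G := D * (K' * wt L (p - 2) x)) hd0 i
    (fun y hy => by have := (hR y (by have := (hbox y hy).1; linarith)).1; exact_mod_cast this)
    (fun y hy => (hR y (by have := (hbox y hy).1; linarith)).2.1.trans
      (mul_le_mul_of_nonneg_left (hw x y hx1 (hbox y hy).1 (hbox y hy).2).2 hC0))
    (fun y hy => (hR y (by have := (hbox y hy).1; linarith)).2.2.trans
      (mul_le_mul_of_nonneg_left (hw' x y hx2 (hbox y hy).1 (hbox y hy).2).2 hD0))
  have hl := Real.log_nonneg (hR1.trans hx1)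
  have e1 : wt L p x / d = 2 * n * wt L (p - 1) x := by
    rw [wt, wt, hd, Real.rpow_sub_one hxp.ne']; field_simp
  have e2 : d * wt L (p - 2) x = (2 * n : ℝ)⁻¹ * wt L (p - 1) x := by
    rw [wt, wt, hd, show p - 1 = p - 2 + 1 by ring, Real.rpow_add_one hxp.ne']; field_simp
  have hp : 0 ≤ wt L (p - 1) x := by unfold wt; positivity
  have hi : (2 * n : ℝ)⁻¹ ≤ 1 := inv_le_one_of_one_le₀ (by linarith)
  rw [Real.norm_eq_abs, Real.norm_of_nonneg hp]
  refine key.trans ?_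
  have e3 : n * (C * (K * wt L p x)) / d + d * (D * (K' * wt L (p - 2) x)) / 2
      = n * (C * K) * (wt L p x / d) + D * K' / 2 * (d * wt L (p - 2) x) := by ring
  rw [e3, e1, e2]
  have := mul_le_mul_of_nonneg_left (mul_le_mul_of_nonneg_right hi hp) (show 0 ≤ D * K' / 2 by positivity)
  have p3 : 0 ≤ D * K' * wt L (p - 1) x := by positivity
  linarith only [this, p3]

lemma lap_pd (h : ES 3 w) (i : Fin n) : MAE.pd i (lap w) =ᶠ[cobounded (EE n)] lap (MAE.pd i w) := by
  filter_upwards [ev_ev h] with x hx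
  have h2 : ∀ j, ContDiffAt ℝ 2 (MAE.pd j w) x := fun j => by
    exact_mod_cast contDiffAt_pd (k := 2) j (by exact_mod_cast hx.self_of_nhds)
  have : MAE.pd i (lap w) x = ∑ j, MAE.pd i (MAE.pd j (MAE.pd j w)) x :=
    pd_sum _ i fun j _ => differentiableAt_pd j (h2 j)
  rw [this, lap]
  refine Finset.sum_congr rfl fun j _ => ?_
  rw [pd_comm i j (h2 j)]
  refine pd_congr j ?_
  filter_upwards [hx] with y hy using pd_comm i j (hy.of_le (by norm_num))

lemma boot (hn : 1 ≤ n) (hC : ES (k + 2) w) (h0 : w =O[cobounded (EE n)] wt L p)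
    (h1 : OD L k (p - 2) (lap w)) : OD L (k + 1) p w := by
  have hd : ∀ᶠ x in cobounded (EE n), DifferentiableAt ℝ w x := by
    filter_upwards [hC] with x hx using hx.differentiableAt (by simp)
  have hg := grad_step hn (hC.mono (by omega)) h0 h1.bd
  induction k generalizing p w with
  | zero => exact ⟨h0, hd, hg⟩
  | succ k ih =>
    refine ⟨h0, hd, fun i => ?_⟩
    have h2 : OD L k (p - 1 - 2) (lap (MAE.pd i w)) := by
      have := (h1.2.2 i).congr (lap_pd (hC.mono (by omega)) i)
      rwa [show p - 2 - 1 = p - 1 - 2 by ring] at this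
    have h3 : ES (k + 2) (MAE.pd i w) := hC.pd i
    refine ih h3 (hg i) h2 ?_ (grad_step hn (h3.mono (by omega)) (hg i) h2.bd)
    filter_upwards [h3] with x hx using hx.differentiableAt (by simp)

lemma OD.of_iter (hC : ES k w) (h : ∀ j ≤ k, (fun x => iteratedFDeriv ℝ j w x) =O[cobounded (EE n)] wt L (p - j)) :
    OD L k p w := by
  have h0 : w =O[cobounded (EE n)] wt L p := by
    have := (h 0 (by omega)).norm_left
    simp only [norm_iteratedFDeriv_zero, Nat.cast_zero, sub_zero] at this
    exact this.of_norm_left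
  induction k generalizing p w with
  | zero => exact h0
  | succ k ih =>
    have hb : ∀ i, ∀ j ≤ k, (fun x => iteratedFDeriv ℝ j (MAE.pd i w) x) =O[cobounded (EE n)] wt L (p - 1 - j) :=
      fun i j hj => by
        have := h (j + 1) (by omega)
        rw [show p - ((j + 1 : ℕ) : ℝ) = p - 1 - j by push_cast; ring] at this
        refine IsBigO.trans (IsBigO.of_bound 1 ?_) this
        filter_upwards [hC] with x hx
        refine (norm_iteratedFDeriv_clm_apply_const (N := k) (hx.fderiv_right (by norm_cast))
          (by exact_mod_cast hj)).trans_eq ?_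
        rw [norm_iteratedFDeriv_fderiv]
        congr 1; exact norm_ei i
    refine ⟨h0, ?_, fun i => ih (hC.pd i) (hb i) ?_⟩
    · filter_upwards [hC] with x hx using hx.differentiableAt (by simp)
    · have := (hb i 0 (by omega)).norm_left
      simp only [norm_iteratedFDeriv_zero, Nat.cast_zero, sub_zero] at this
      exact this.of_norm_left

lemma OD.iter (hC : ES k w) (h : OD L k p w) :
    (fun x => iteratedFDeriv ℝ k w x) =O[cobounded (EE n)] wt L (p - k) := by
  induction k generalizing p w with
  | zero =>
    refine IsBigO.of_norm_left ?_
    simp only [norm_iteratedFDeriv_zero, Nat.cast_zero, sub_zero]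
    exact IsBigO.norm_left h
  | succ k ih =>
    have hi : ∀ i, (fun x => ‖iteratedFDeriv ℝ k (MAE.pd i w) x‖) =O[cobounded (EE n)] wt L (p - (k + 1 : ℕ)) :=
      fun i => by
        have := (ih (hC.pd i) (h.2.2 i)).norm_left
        rwa [show p - 1 - (k:ℝ) = p - (k + 1 : ℕ) by push_cast; ring] at this
    refine IsBigO.trans (IsBigO.of_bound 1 ?_) (IsBigO.sum (s := Finset.univ) fun i _ => hi i)
    filter_upwards [hC] with x hx
    let T : Fin n → ℝ →L[ℝ] (EE n →L[ℝ] ℝ) := fun i =>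
      (ContinuousLinearMap.id ℝ ℝ).smulRight (EuclideanSpace.proj i : EE n →L[ℝ] ℝ)
    have e : fderiv ℝ w = fun y => ∑ i, (T i ∘ MAE.pd i w) y := by
      ext y v
      rw [fderiv_eq_sum]
      simp [T, mul_comm]
    have hp : ∀ i, ContDiffAt ℝ k (MAE.pd i w) x := fun i => contDiffAt_pd i hx
    have hT : ∀ i, ‖T i‖ ≤ 1 := fun i => ContinuousLinearMap.opNorm_le_bound _ zero_le_one fun t => by
      refine ContinuousLinearMap.opNorm_le_bound _ (by positivity) fun v => ?_
      have : |v i| ≤ ‖v‖ := abs_coord_le v i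
      rw [one_mul, show T i t v = t * v i by simp [T], norm_mul]
      exact mul_le_mul_of_nonneg_left this (norm_nonneg t)
    have e2 : iteratedFDeriv ℝ k (fderiv ℝ w) x = ∑ i, iteratedFDeriv ℝ k (T i ∘ MAE.pd i w) x := by
      rw [e]
      simp only [← iteratedFDerivWithin_univ]
      exact iteratedFDerivWithin_fun_sum_apply uniqueDiffOn_univ (Set.mem_univ x)
        fun i _ => ((T i).contDiff.contDiffAt.comp x (hp i)).contDiffWithinAt
    rw [← norm_iteratedFDeriv_fderiv, e2, one_mul, Finset.sum_apply]
    refine (norm_sum_le _ _).trans (le_trans (Finset.sum_le_sum fun i _ => ?_) (Real.le_norm_self _))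
    exact ((T i).norm_iteratedFDeriv_comp_left (hp i) le_rfl).trans (mul_le_of_le_one_left (norm_nonneg _) (hT i))

end MAE

open Filter Topology Metric

namespace MAE
open Bornology Asymptotics
open MvPolynomial (eval)
variable {n : ℕ} {L k : ℕ} {p q : ℝ} {w w' f g : EE n → ℝ}

lemma OD.le {j : ℕ} (h : OD L k p w) (hj : j ≤ k) : OD L j p w := by
  induction k, hj using Nat.le_induction with
  | base => exact h
  | succ k _ ih => exact ih h.le1

lemma OD.toL (h : OD 0 k p w) : OD L k p w := by
  have e : ∀ {p : ℝ}, wt 0 p =O[cobounded (EE n)] wt (n := n) L p := fun {p} => by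
    refine IsBigO.of_bound 1 ?_
    filter_upwards [ev_le (Real.exp 1)] with x hx
    have hx0 : 0 < ‖x‖ := (Real.exp_pos 1).trans_le hx
    have h1 : 1 ≤ Real.log ‖x‖ := by rwa [Real.le_log_iff_exp_le hx0]
    simp only [wt, pow_zero, mul_one, one_mul]
    rw [Real.norm_of_nonneg (by positivity), Real.norm_of_nonneg (by positivity)]
    exact le_mul_of_one_le_right (by positivity) (one_le_pow₀ h1)
  induction k generalizing p w with
  | zero => exact IsBigO.trans h e
  | succ k ih => exact ⟨h.1.trans e, h.2.1, fun i => ih (h.2.2 i)⟩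

lemma dec_of_O (hc : Continuous w) (h : w =O[cobounded (EE n)] wt 0 p) : Dec p w := by
  obtain ⟨C, hC⟩ := h.bound
  obtain ⟨R, hR⟩ := ev_R.1 hC
  refine dec_of_ev (R := R) (C := C) hc fun x hx => (hR x hx).trans_eq ?_
  rw [wt, pow_zero, mul_one, Real.norm_of_nonneg (by positivity)]

lemma lap_sub {x : EE n} (hf : ContDiffAt ℝ 2 f x) (hg : ContDiffAt ℝ 2 g x) :
    lap (fun y => f y - g y) x = lap f x - lap g x := by
  simp only [lap, ← Finset.sum_sub_distrib]
  refine Finset.sum_congr rfl fun i _ => ?_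
  rw [← pd_sub i (differentiableAt_pd i hf) (differentiableAt_pd i hg)]
  refine pd_congr i ?_
  filter_upwards [hf.eventually (by simp), hg.eventually (by simp)] with y h1 h2
  exact pd_sub i (h1.differentiableAt (by simp)) (h2.differentiableAt (by simp))

lemma lap_quad {v g0 : EE n → ℝ} {k : ℕ} {μ : ℝ} (hn : 3 ≤ n) (hμ1 : (n:ℝ) < μ) (hμ2 : μ ≤ 2 * n)
    (hdet : ∀ x, (1 + Matrix.of fun i j => pd i (pd j v) x).det = Real.exp (g0 x))
    (hg : OD 0 k (-μ) g0) (hH : ∀ i j, OD 0 k (-n) (pd i (pd j v))) : OD 0 k (-μ) (lap v) := by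
  have hn' : (3:ℝ) ≤ n := by exact_mod_cast hn
  obtain ⟨c, hc⟩ := hadamard (detP n)
  choose d hd using fun s => hadamard (c s)
  let Y : Fin n × Fin n → EE n → ℝ := fun s => pd s.1 (pd s.2 v)
  let Z : (Fin n × Fin n) ⊕ (Fin n × Fin n) → EE n → ℝ := Sum.elim (fun _ _ => 0) Y
  let W : ((Fin n × Fin n) ⊕ (Fin n × Fin n)) ⊕ ((Fin n × Fin n) ⊕ (Fin n × Fin n)) → EE n → ℝ :=
    Sum.elim (fun _ _ => 0) Z
  have hZ : ∀ t, OD 0 k (-n) (Z t) := by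
    rintro (t | t)
    · exact OD.zero
    · exact hH t.1 t.2
  have hW : ∀ t, OD 0 k 0 (W t) := by
    rintro (t | t)
    · exact OD.zero
    · exact (hZ t).mono (by linarith)
  have e : lap v = fun x => (Real.exp (g0 x) - 1) - ∑ s, (∑ t, eval (fun r => W r x) (d s t) * Z t x) * Y s x := by
    ext x
    have hZx : (Sum.elim (0 : Fin n × Fin n → ℝ) fun s => Y s x) = fun t => Z t x := by ext (t | t) <;> rfl
    have hWx : (Sum.elim (0 : (Fin n × Fin n) ⊕ (Fin n × Fin n) → ℝ) fun s => Z s x) = fun t => W t x := by ext (t | t) <;> rfl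
    have h1 := hc 0 (fun s => Y s x)
    rw [eval_detP, eval_detP, hdet x, hZx] at h1
    have h0 : (1 + Matrix.of fun i j : Fin n => (0 : Fin n × Fin n → ℝ) (i, j)).det = 1 := by
      rw [show (Matrix.of fun i j : Fin n => (0 : Fin n × Fin n → ℝ) (i, j)) = 0 by ext; simp]; simp
    rw [h0] at h1
    have h2 : ∀ s, eval (fun t => Z t x) (c s) = dl s.1 s.2 + ∑ t, eval (fun r => W r x) (d s t) * Z t x := fun s => by
      have := hd s 0 (fun t => Z t x)
      rw [had_zero c hc s.1 s.2, hWx] at this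
      simp only [Pi.zero_apply, sub_zero] at this
      linarith
    simp only [h2, Pi.zero_apply, sub_zero, add_mul, Finset.sum_add_distrib] at h1
    have h3 : ∑ s : Fin n × Fin n, dl s.1 s.2 * Y s x = lap v x := by
      rw [Fintype.sum_prod_type]; simp [dl, Y, lap]
    rw [h3] at h1
    linarith
  rw [e]
  refine (hg.exp (by linarith)).sub ?_
  refine OD.mono (p := 0 + -n + -n) (OD.sum _ fun s _ => OD.mul (OD.sum _ fun t _ => (OD.poly hW _).mul (hZ t))
    (hH s.1 s.2)) (by linarith)

theorem core (hn : 3 ≤ n) {m : ℕ} (hm : 2 ≤ m) {μ : ℝ} (hμ1 : (n:ℝ) < μ) (hμ2 : μ ≤ 2 * n) {v g0 : EE n → ℝ}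
    (hv : ContDiff ℝ 2 v) (hdet : ∀ x, (1 + Matrix.of fun i j => pd i (pd j v) x).det = Real.exp (g0 x))
    (hg : OD 0 m (-μ) g0) (hgC : ES m g0)
    (hf : ∀ k ≤ m + 1, (fun x => iteratedFDeriv ℝ k v x) =O[cobounded (EE n)] wt 0 (2 - n - k))
    (N : ℕ) (hN : N < μ - n) (hL : L = 0 ∧ μ - n < N + 1 ∨ L = 1 ∧ μ - n = N + 1) :
    ∃ P : ℕ → MvPolynomial (Fin n) ℝ, (∀ k, Hp k (P k)) ∧ ∀ k ≤ m,
      ES k (fun x => v x - ∑ k ∈ Finset.range (N + 1), KK k (P k) x) ∧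
      (fun x => iteratedFDeriv ℝ k (fun x => v x - ∑ k ∈ Finset.range (N + 1), KK k (P k) x) x)
        =O[cobounded (EE n)] wt L (2 - μ - k) := by
  have hn' : (3:ℝ) ≤ n := by exact_mod_cast hn
  have hE2 : ES 2 v := Eventually.of_forall fun x => by exact_mod_cast hv.contDiffAt
  have hv2 : OD 0 2 (2 - n) v := OD.of_iter hE2 fun j hj => hf j (by omega)
  have hEm : ES (m + 1) v := by
    obtain ⟨δ, hδ, -, hr⟩ := reg (n := n) (by omega) hm
    have hsm : ∀ i j, ∀ᶠ x in cobounded (EE n), |pd i (pd j v) x| ≤ δ := fun i j => by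
      have h1 : Tendsto (wt (n := n) 0 (2 - n - 1 - 1)) (cobounded (EE n)) (𝓝 0) := by
        have := (tendsto_rpow_neg_atTop (y := (n:ℝ)) (by linarith)).comp (tendsto_norm_cobounded_atTop (E := EE n))
        refine this.congr fun x => ?_
        simp only [Function.comp, wt, pow_zero, mul_one]; congr 1; ring
      have h2 := (((hv2.2.2 j).2.2 i).bd).trans_tendsto h1
      filter_upwards [h2.eventually (Metric.ball_mem_nhds 0 hδ)] with x hx
      simpa using (mem_ball.1 hx).le
    obtain ⟨R, hR⟩ := ev_R.1 ((eventually_all.2 fun i => eventually_all.2 (hsm i)).and hgC)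
    refine ev_R.2 ⟨R + 1, fun x hx => hr {x | R < ‖x‖} v (fun x => Real.exp (g0 x)) (isOpen_lt continuous_const continuous_norm)
      (fun y _ => hv.contDiffAt) (fun y hy => (hR y (le_of_lt hy)).1) (fun y _ => hdet y)
      (fun y hy => (hR y (le_of_lt hy)).2.exp) x (show R < ‖x‖ by linarith)⟩
  have hvm : OD 0 (m + 1) (2 - n) v := OD.of_iter hEm hf
  obtain ⟨m, rfl⟩ : ∃ m', m = m' + 1 := ⟨m - 1, by omega⟩
  have hl : OD 0 m (-μ) (lap v) := lap_quad hn hμ1 hμ2 hdet hg.le1 fun i j => by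
    have := (hvm.2.2 j).2.2 i
    rwa [show (2:ℝ) - n - 1 - 1 = -n by ring] at this
  have hld := dec_of_O (continuous_lap hv) hl.bd
  obtain ⟨P0, hP0, K, hK0, hK⟩ := multipole hn hμ1 (continuous_lap hv) hld N L hN hL
  have hgreen := green hn hv (dec_of_O hv.continuous hv2.bd)
    (fun i => by
      have := dec_of_O (continuous_pd i (hv.of_le (by norm_num))) (hv2.2.2 i).bd
      rwa [show (2:ℝ) - n - 1 = 1 - n by ring] at this)
    (fun i => by
      have := dec_of_O (continuous_pd i (contDiff_pd i hv)) ((hv2.2.2 i).2.2 i).bd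
      rwa [show (2:ℝ) - n - 1 - 1 = -n by ring] at this) hμ1 hld
  have hκ := kap_pos hn
  refine ⟨fun k => MvPolynomial.C (-(kap n)⁻¹) * P0 k, fun k => (hP0 k).C_mul _, ?_⟩
  set P := fun k => MvPolynomial.C (-(kap n)⁻¹) * P0 k with hP
  set w : EE n → ℝ := fun x => v x - ∑ k ∈ Finset.range (N + 1), KK k (P k) x with hw
  have hw0 : w =O[cobounded (EE n)] wt L (2 - μ) := by
    refine IsBigO.of_bound ((kap n)⁻¹ * K) ?_
    filter_upwards [ev_le 2] with x hx
    have e : w x = -(kap n)⁻¹ * ((∫ y, ‖x - y‖ ^ ((2:ℝ) - n) * lap v y) - ∑ k ∈ Finset.range (N + 1), KK k (P0 k) x) := by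
      rw [hgreen x, mul_sub, Finset.mul_sum]
      simp only [hw, hP, KK, pv, map_mul, MvPolynomial.eval_C, mul_assoc]
      congr 1
      field_simp
    rw [e, norm_mul, norm_neg, Real.norm_of_nonneg (by positivity), mul_assoc]
    refine mul_le_mul_of_nonneg_left ((hK x hx).trans ?_) (by positivity)
    rw [mul_assoc]
    exact mul_le_mul_of_nonneg_left (Real.le_norm_self _) hK0
  have hEw : ES (m + 2) w := by
    filter_upwards [hEm, ev_le 1] with x hx h1
    exact hx.sub (ContDiffAt.sum fun k _ => contDiffAt_KK k (P k) (norm_pos_iff.1 (by linarith)))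
  have hlw : lap v =ᶠ[cobounded (EE n)] lap w := by
    filter_upwards [ev_le 1] with x h1
    have hx0 : x ≠ 0 := norm_pos_iff.1 (by linarith)
    have : ∀ M, lap (fun x => v x - ∑ k ∈ Finset.range M, KK k (P k) x) x = lap v x := fun M => by
      induction M with
      | zero => simp
      | succ M ih =>
        simp only [Finset.sum_range_succ, ← sub_sub]
        rw [lap_sub (hv.contDiffAt.sub (ContDiffAt.sum fun k _ => contDiffAt_KK k (P k) hx0)) (contDiffAt_KK _ _ hx0),
          ih, lap_KK ((hP0 M).C_mul _) hx0, sub_zero]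
    exact (this _).symm
  have hfin : OD L (m + 1) (2 - μ) w := boot (by omega) hEw hw0
    (by rw [show 2 - μ - 2 = -μ by ring]; exact hl.toL.congr hlw)
  exact fun k hk => ⟨hEw.mono (by omega), OD.iter (hEw.mono (by omega)) (hfin.le hk)⟩

end MAE

open Filter Topology Metric

namespace MAE
open Bornology Asymptotics
variable {n : ℕ} {L k : ℕ} {p : ℝ} {w : EE n → ℝ}

lemma comp_bd (e : EE n ≃L[ℝ] EE n) {c : ℝ} (hc : c ≠ 0)
    (h : (fun x => iteratedFDeriv ℝ k w x) =O[cobounded (EE n)] wt L p) :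
    (fun x => iteratedFDeriv ℝ k (fun x => c * w (e x)) x) =O[cobounded (EE n)] wt L p := by
  obtain ⟨C, hC0, hC⟩ := h.exists_nonneg
  obtain ⟨R, hR⟩ := ev_R.1 hC.bound
  set a : ℝ := ‖(e.symm : EE n →L[ℝ] EE n)‖ + 1
  set b : ℝ := ‖(e : EE n →L[ℝ] EE n)‖ + 1
  have ha : 0 < a := by positivity
  have hb : 0 < b := by positivity
  have h1 : ∀ x, a⁻¹ * ‖x‖ ≤ ‖e x‖ := fun x => by
    rw [inv_mul_le_iff₀ ha]
    have := (e.symm : EE n →L[ℝ] EE n).le_opNorm (e x)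
    rw [ContinuousLinearEquiv.coe_coe, e.symm_apply_apply] at this
    exact this.trans (mul_le_mul_of_nonneg_right (by simp [a]) (norm_nonneg _))
  have h2 : ∀ x, ‖e x‖ ≤ b * ‖x‖ := fun x =>
    ((e : EE n →L[ℝ] EE n).le_opNorm x).trans (mul_le_mul_of_nonneg_right (by simp [b]) (norm_nonneg _))
  obtain ⟨K, R', hK, hR1, hw⟩ := wt_cmp (n := n) L p (inv_pos.2 ha) hb
  let g : ℝ ≃L[ℝ] ℝ := ContinuousLinearEquiv.unitsEquivAut ℝ (Units.mk0 c hc)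
  have e0 : (fun x => c * w (e x)) = g ∘ (w ∘ e) := by
    ext x; simp [g, mul_comm]
  refine IsBigO.of_bound (‖(g : ℝ →L[ℝ] ℝ)‖ * (C * K * b ^ k)) (ev_R.2 ⟨max R' (a * R), fun x hx => ?_⟩)
  have hx1 := (le_max_left _ _).trans hx
  obtain ⟨-, h4⟩ := hw x (e x) hx1 (h1 x) (h2 x)
  have h3 := hR (e x) (by
    refine le_trans ?_ (h1 x)
    rw [← div_eq_inv_mul, le_div_iff₀ ha, mul_comm]; exact (le_max_right _ _).trans hx)
  have hw0 : 0 ≤ wt L p x := by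
    have := Real.log_nonneg (hR1.trans hx1); unfold wt; positivity
  rw [e0, ContinuousLinearEquiv.iteratedFDeriv_comp_left]
  refine (ContinuousLinearMap.norm_compContinuousMultilinearMap_le _ _).trans ?_
  rw [mul_assoc]
  refine mul_le_mul_of_nonneg_left ?_ (norm_nonneg _)
  have e1 : iteratedFDeriv ℝ k (w ∘ e) x
      = (iteratedFDeriv ℝ k w (e x)).compContinuousLinearMap fun _ => (e : EE n →L[ℝ] EE n) := by
    have := e.iteratedFDerivWithin_comp_right w uniqueDiffOn_univ (x := x) (Set.mem_univ _) k
    simpa only [Set.preimage_univ, iteratedFDerivWithin_univ] using this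
  rw [e1]
  refine (ContinuousMultilinearMap.norm_compContinuousLinearMap_le _ _).trans ?_
  rw [Finset.prod_const, Finset.card_univ, Fintype.card_fin, Real.norm_of_nonneg hw0]
  calc _ ≤ (C * (K * wt L p x)) * b ^ k := by
        refine mul_le_mul (h3.trans (mul_le_mul_of_nonneg_left h4 hC0)) ?_ (by positivity) (by positivity)
        exact pow_le_pow_left₀ (norm_nonneg _) (by simp [b]) _
    _ = _ := by ring

lemma hs_comp (e : EE n ≃L[ℝ] EE n) (x p q : EE n) : hs (w ∘ e) x p q = hs w (e x) (e p) (e q) := by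
  have := e.iteratedFDerivWithin_comp_right w uniqueDiffOn_univ (x := x) (Set.mem_univ _) 2
  simp only [Set.preimage_univ, iteratedFDerivWithin_univ] at this
  have := congrArg (fun m => m ![p, q]) this
  simpa [iteratedFDeriv_two_apply, hs] using this

lemma pd_cor (i j : Fin n) (x : EE n) : pd i (fun y : EE n => y j) x = if j = i then 1 else 0 := by
  have : (fun y : EE n => y j) = (EuclideanSpace.proj j : EE n →L[ℝ] ℝ) := rfl
  rw [pd, this, ContinuousLinearMap.fderiv]; simp [ei_apply]

lemma cd_coord (j : Fin n) : ContDiff ℝ 2 (fun y : EE n => y j) :=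
  (EuclideanSpace.proj j : EE n →L[ℝ] ℝ).contDiff

noncomputable def QQ (A : Matrix (Fin n) (Fin n) ℝ) (b : Fin n → ℝ) (c : ℝ) (y : EE n) : ℝ :=
  (1/2) * ∑ i, ∑ j, A i j * y i * y j + ∑ i, b i * y i + c

lemma cd_QQ (A : Matrix (Fin n) (Fin n) ℝ) (b : Fin n → ℝ) (c : ℝ) : ContDiff ℝ 2 (QQ A b c) := by
  unfold QQ
  have := cd_coord (n := n)
  fun_prop

lemma hs_QQ (A : Matrix (Fin n) (Fin n) ℝ) (hA : ∀ i j, A i j = A j i) (b : Fin n → ℝ) (c : ℝ) (i j : Fin n) (x : EE n) :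
    pd i (pd j (QQ A b c)) x = A i j := by
  have hd : ∀ j (x : EE n), DifferentiableAt ℝ (fun y : EE n => y j) x := fun j x =>
    (cd_coord j).contDiffAt.differentiableAt (by simp)
  have h1 : pd j (QQ A b c) = fun y => ∑ l, A j l * y l + b j := by
    ext y
    have e1 : pd j (fun y : EE n => ∑ i, ∑ j, A i j * y i * y j) y = 2 * ∑ l, A j l * y l := by
      rw [pd_sum _ _ (by fun_prop)]
      have : ∀ a, pd j (fun y : EE n => ∑ l, A a l * y a * y l) y
          = A a j * y a + (if a = j then 1 else 0) * ∑ l, A a l * y l := fun a => by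
        rw [pd_sum _ _ (by fun_prop)]
        have : ∀ l, pd j (fun y : EE n => A a l * y a * y l) y
            = A a l * y a * (if l = j then 1 else 0) + y l * (A a l * if a = j then 1 else 0) := fun l => by
          rw [pd_mul j (f := fun y : EE n => A a l * y a) (g := fun y => y l) (by fun_prop) (hd _ _),
            pd_const_mul _ _ (hd _ _), pd_cor, pd_cor]
        simp only [this, Finset.sum_add_distrib]
        congr 1
        · simp
        · rw [Finset.mul_sum]; exact Finset.sum_congr rfl fun l _ => by ring
      simp only [this, Finset.sum_add_distrib]
      simp only [hA _ j]; simp; ring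
    have e2 : pd j (fun y : EE n => ∑ i, b i * y i) y = b j := by
      rw [pd_sum _ _ (by fun_prop)]
      simp only [pd_const_mul _ _ (hd _ _), pd_cor]; simp
    unfold QQ
    rw [pd_add _ (by fun_prop) (by fun_prop), pd_add _ (by fun_prop) (by fun_prop), pd_const_mul _ _ (by fun_prop),
      e1, e2, pd_const]
    ring
  rw [h1, pd_add _ (by fun_prop) (by fun_prop), pd_sum _ _ (by fun_prop), pd_const]
  simp only [pd_const_mul _ _ (hd _ _), pd_cor]; simp [hA i j]

end MAE

open Filter Topology Metric

namespace MAE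
open Bornology Asymptotics
variable {n : ℕ} {L k : ℕ} {p : ℝ} {w : EE n → ℝ}

open scoped MatrixOrder in
lemma exists_sqrt {B : Matrix (Fin n) (Fin n) ℝ} (hB : B.PosDef) : ∃ S : Matrix (Fin n) (Fin n) ℝ, S.PosDef ∧ S * S = B := by
  have h1 : CFC.sqrt B * CFC.sqrt B = B := CFC.sqrt_mul_sqrt_self B hB.posSemidef.nonneg
  refine ⟨CFC.sqrt B, ?_, h1⟩
  rw [(Matrix.nonneg_iff_posSemidef.1 (CFC.sqrt_nonneg B)).posDef_iff_det_ne_zero]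
  intro h
  have := congrArg Matrix.det h1
  rw [Matrix.det_mul, h, zero_mul] at this
  exact hB.det_pos.ne this

lemma exists_equiv {S T : Matrix (Fin n) (Fin n) ℝ} (h1 : S * T = 1) (h2 : T * S = 1) :
    ∃ e : EE n ≃L[ℝ] EE n, (∀ x i, e x i = ∑ j, S i j * x j) ∧ ∀ x i, e.symm x i = ∑ j, T i j * x j := by
  have a : ∀ (S : Matrix (Fin n) (Fin n) ℝ) (x : EE n) i, Matrix.toEuclideanLin S x i = ∑ j, S i j * x j := fun S x i => by
    simp [Matrix.ofLp_toEuclideanLin_apply, Matrix.mulVec, dotProduct]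
  have b : ∀ {S T : Matrix (Fin n) (Fin n) ℝ}, S * T = 1 →
      Matrix.toEuclideanLin S ∘ₗ Matrix.toEuclideanLin T = LinearMap.id := fun {S T} h => by
    ext x i
    simp [Matrix.toEuclideanLin_apply, Matrix.mulVec_mulVec, h]
  exact ⟨(LinearEquiv.ofLinearMap (Matrix.toEuclideanLin S) (Matrix.toEuclideanLin T) (b h1) (b h2)).toContinuousLinearEquiv,
    a S, a T⟩

lemma hom_scale {q : MvPolynomial (Fin n) ℝ} (h : q.IsHomogeneous k) (t : ℝ) (y : Fin n → ℝ) :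
    MvPolynomial.eval (fun i => t * y i) q = t ^ k * MvPolynomial.eval y q := by
  simp only [MvPolynomial.eval_eq, Finset.mul_sum]
  refine Finset.sum_congr rfl fun d hd => ?_
  have : ∑ i, d i = k := by
    have := h (MvPolynomial.mem_support_iff.1 hd)
    rw [Finsupp.weight_apply, Finsupp.sum_fintype _ _ (by simp)] at this
    simpa using this
  simp only [mul_pow, Finset.prod_mul_distrib]
  have h3 : ∏ i ∈ d.support, t ^ d i = t ^ k := by
    rw [Finset.prod_pow_eq_pow_sum, ← this]; congr 1
    exact Finset.sum_subset (Finset.subset_univ _) (by simp)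
  rw [h3]; ring

lemma bigO_out {C' : Type*} [NormedAddCommGroup C'] {F : EE n → C'} (h : F =O[cobounded (EE n)] wt L p) :
    ∃ C R : ℝ, 0 < C ∧ 1 < R ∧ ∀ x : EE n, R ≤ ‖x‖ → ‖F x‖ ≤ C * ‖x‖ ^ p * Real.log ‖x‖ ^ L := by
  obtain ⟨C, hC, h⟩ := h.exists_pos
  obtain ⟨R, hR⟩ := ev_R.1 h.bound
  refine ⟨C, max R 2, hC, by simp, fun x hx => (hR x ((le_max_left _ _).trans hx)).trans_eq ?_⟩
  have := Real.log_nonneg (show 1 ≤ ‖x‖ by linarith [(le_max_right R 2).trans hx])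
  rw [wt, Real.norm_of_nonneg (by positivity), mul_assoc]

lemma bigO_in {C' : Type*} [NormedAddCommGroup C'] {F : EE n → C'} {C R : ℝ} (hR : 0 < R)
    (h : ∀ x : EE n, R ≤ ‖x‖ → ‖F x‖ ≤ C * ‖x‖ ^ p) : F =O[cobounded (EE n)] wt 0 p :=
  IsBigO.of_bound C (ev_R.2 ⟨R, fun x hx => (h x hx).trans_eq (by
    rw [wt, pow_zero, mul_one, Real.norm_of_nonneg (by positivity)])⟩)

lemma det_id {S T A H M : Matrix (Fin n) (Fin n) ℝ} {a b : ℝ} (hn : (n:ℝ) ≠ 0) (hST : S * T = 1) (hTS : T * S = 1)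
    (hS : S * S = (n:ℝ) • A)
    (hA : A.det = Real.exp b) (hH : H.det = Real.exp a) (hM : M = T * ((n:ℝ) • (H - A)) * T) :
    (1 + M).det = Real.exp (a - b) := by
  have h1 : 1 = T * ((n:ℝ) • A) * T := by
    rw [← hS, ← mul_assoc, hTS, one_mul, hST]
  have h2 : 1 + M = T * ((n:ℝ) • H) * T := by
    rw [hM, smul_sub, mul_sub, sub_mul, ← h1]; abel
  have h3 := congrArg Matrix.det h1
  rw [h2]
  simp only [Matrix.det_mul, Matrix.det_smul, hA, hH, Matrix.det_one] at h3 ⊢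
  rw [Real.exp_sub, eq_div_iff (Real.exp_pos b).ne']
  linear_combination (-Real.exp a) * h3

lemma arith {ζ : ℝ} (hn : 3 ≤ n) (hζ : (n : ℝ) < ζ) {N : ℕ}
    (hN : N = if 2 * (n : ℝ) ≤ ζ then n - 1 else n - 1 - (⌊2 * (n : ℝ) - ζ⌋).toNat) :
    N < min (2 * (n:ℝ)) ζ - n ∧ ((¬ (∃ z : ℤ, min (2 * (n : ℝ)) ζ - n = (z : ℝ)) → min (2 * (n:ℝ)) ζ - n < N + 1) ∧
      ((∃ z : ℤ, min (2 * (n : ℝ)) ζ - n = (z : ℝ)) → min (2 * (n:ℝ)) ζ - n = N + 1)) := by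
  split_ifs at hN with h
  · have e : (N:ℝ) + 1 = n := by rw [hN]; norm_cast; omega
    rw [min_eq_left h]
    exact ⟨by linarith, fun h => (h ⟨n, by push_cast; ring⟩).elim, fun _ => by linarith⟩
  · rw [not_le] at h
    rw [min_eq_right h.le]
    set F := ⌊2 * (n : ℝ) - ζ⌋
    have f0 : 0 ≤ F := Int.floor_nonneg.2 (by linarith)
    have f1 : F < n := Int.floor_lt.2 (by push_cast; linarith)
    have e : (N:ℝ) + 1 = n - F := by
      have : (N:ℤ) + 1 = n - F := by omega
      exact_mod_cast this
    have g1 := Int.floor_le (2 * (n : ℝ) - ζ)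
    have g2 := Int.lt_floor_add_one (2 * (n : ℝ) - ζ)
    refine ⟨by linarith, fun hz => ?_, fun ⟨z, hz⟩ => ?_⟩
    · refine lt_of_le_of_ne (by linarith) fun he => hz ⟨N + 1, by push_cast; linarith⟩
    · have : F = n - z := by
        rw [show F = ⌊((n - z : ℤ) : ℝ)⌋ by simp only [F]; congr 1; push_cast; linarith, Int.floor_intCast]
      rw [e, this]; push_cast; linarith
end MAE

open Filter
open MAE Topology Bornology Asymptotics
/-- **Theorem 1.2, case τ = 0 (Monge–Ampère), higher order expansion**: under the
hypotheses of Theorem 1.1 with `ζ > n`, given the quadratic polynomial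
`Q(x) = ½xᵀAx + b·x + c` with `u - Q = O_{m+1}(|x|^{2-n})`, there exist `c₀ ∈ ℝ` and
homogeneous harmonic polynomials `P_k` of degree `k`, `1 ≤ k ≤ N` with
`N = n - 1 - ⌊2n-ζ⌋` (`= n-1` if `ζ ≥ 2n`), such that
`u - Q - c₀(n xᵀAx)^{(2-n)/2} - Σ_k P_k(θ)(n xᵀAx)^{(2-n-k)/2} = O_m(|x|^{2-min{2n,ζ}})`
(extra `ln|x|` factor when `min{2n,ζ} - n ∈ ℕ`), where `θ = (nA)^{1/2}x/(n xᵀAx)^{1/2}`,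
`(nA)^{1/2}` being the positive definite symmetric square root `S` of `nA`. -/
theorem higher_order_expansion_MongeAmpere
    (n m : ℕ) (hn : 3 ≤ n) (hm : 2 ≤ m) (ζ : ℝ) (hζ : (n : ℝ) < ζ)
    (f : EuclideanSpace ℝ (Fin n) → ℝ) (finf : ℝ)
    (hf_cont : Continuous f)
    (hf_Cm : ∃ K : Set (EuclideanSpace ℝ (Fin n)), IsCompact K ∧ ContDiffOn ℝ m f Kᶜ)
    (hf_lim : Tendsto f (cocompact _) (nhds finf))
    (hf_decay : ∀ k : ℕ, k ≤ m → ∃ C R : ℝ, 0 < C ∧ 0 < R ∧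
      ∀ x : EuclideanSpace ℝ (Fin n), R ≤ ‖x‖ →
        ‖x‖ ^ (ζ + k) * ‖iteratedFDeriv ℝ k (fun y => f y - finf) x‖ ≤ C)
    (u : EuclideanSpace ℝ (Fin n) → ℝ) (hu : ContDiff ℝ 2 u)
    (hMA : ∀ x, (hess u x).det = Real.exp (n * f x))
    (hconv : ∀ x, (hess u x).PosDef)
    (A : Matrix (Fin n) (Fin n) ℝ) (b : Fin n → ℝ) (c : ℝ)
    (hA : A.PosDef) (hdetA : A.det = Real.exp (n * finf))
    (hfirst : ∀ k : ℕ, k ≤ m + 1 → ∃ C R : ℝ, 0 < C ∧ 1 < R ∧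
      ∀ x : EuclideanSpace ℝ (Fin n), R ≤ ‖x‖ →
        ‖iteratedFDeriv ℝ k
            (fun y => u y - ((1/2) * ∑ i, ∑ j, A i j * y i * y j + ∑ i, b i * y i + c)) x‖
          ≤ C * ‖x‖ ^ ((2 : ℝ) - n - k))
    (N : ℕ) (hN : N = if 2 * (n : ℝ) ≤ ζ then n - 1 else n - 1 - (⌊2 * (n : ℝ) - ζ⌋).toNat) :
    ∃ (S : Matrix (Fin n) (Fin n) ℝ) (c₀ : ℝ) (P : ℕ → MvPolynomial (Fin n) ℝ),
      S.PosDef ∧ S * S = (n : ℝ) • A ∧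
      (∀ k : ℕ, 1 ≤ k → k ≤ N → (P k).IsHomogeneous k ∧
        ∑ i, MvPolynomial.pderiv i (MvPolynomial.pderiv i (P k)) = 0) ∧
      ((¬ (∃ z : ℤ, min (2 * (n : ℝ)) ζ - n = (z : ℝ)) →
        ∀ k : ℕ, k ≤ m → ∃ C R : ℝ, 0 < C ∧ 1 < R ∧
          ∀ x : EuclideanSpace ℝ (Fin n), R ≤ ‖x‖ →
            ‖iteratedFDeriv ℝ k (fun y =>
                u y - ((1/2) * ∑ i, ∑ j, A i j * y i * y j + ∑ i, b i * y i + c)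
                - c₀ * ((n : ℝ) * ∑ i, ∑ j, A i j * y i * y j) ^ (((2 : ℝ) - n) / 2)
                - ∑ k ∈ Finset.Icc 1 N,
                    MvPolynomial.eval
                      (fun i => (∑ j, S i j * y j) /
                        Real.sqrt ((n : ℝ) * ∑ i', ∑ j', A i' j' * y i' * y j')) (P k) *
                    ((n : ℝ) * ∑ i, ∑ j, A i j * y i * y j) ^ (((2 : ℝ) - n - k) / 2)) x‖
              ≤ C * ‖x‖ ^ ((2 : ℝ) - min (2 * (n : ℝ)) ζ - k)) ∧
      ((∃ z : ℤ, min (2 * (n : ℝ)) ζ - n = (z : ℝ)) →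
        ∀ k : ℕ, k ≤ m → ∃ C R : ℝ, 0 < C ∧ 1 < R ∧
          ∀ x : EuclideanSpace ℝ (Fin n), R ≤ ‖x‖ →
            ‖iteratedFDeriv ℝ k (fun y =>
                u y - ((1/2) * ∑ i, ∑ j, A i j * y i * y j + ∑ i, b i * y i + c)
                - c₀ * ((n : ℝ) * ∑ i, ∑ j, A i j * y i * y j) ^ (((2 : ℝ) - n) / 2)
                - ∑ k ∈ Finset.Icc 1 N,
                    MvPolynomial.eval
                      (fun i => (∑ j, S i j * y j) /
                        Real.sqrt ((n : ℝ) * ∑ i', ∑ j', A i' j' * y i' * y j')) (P k) *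
                    ((n : ℝ) * ∑ i, ∑ j, A i j * y i * y j) ^ (((2 : ℝ) - n - k) / 2)) x‖
              ≤ C * ‖x‖ ^ ((2 : ℝ) - min (2 * (n : ℝ)) ζ - k) * Real.log ‖x‖)) := by
  classical
  have hn0 : (0:ℝ) < n := by exact_mod_cast (show 0 < n by omega)
  obtain ⟨S, hSp, hSS⟩ := exists_sqrt (hA.smul hn0)
  have hdS : IsUnit S.det := hSp.det_pos.ne'.isUnit
  set T := S⁻¹
  have hST : S * T = 1 := Matrix.mul_nonsing_inv S hdS
  have hTS : T * S = 1 := Matrix.nonsing_inv_mul S hdS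
  have hSs : ∀ i j, S i j = S j i := fun i j => by simpa using hSp.1.apply j i
  have hTs : ∀ i j, T i j = T j i := fun i j => by simpa using hSp.inv.1.apply j i
  have hAs : ∀ i j, A i j = A j i := fun i j => by simpa using hA.1.apply j i
  obtain ⟨e, he, he'⟩ := exists_equiv hST hTS
  have hq : ∀ x : EE n, (n:ℝ) * ∑ i, ∑ j, A i j * x i * x j = ‖e x‖ ^ 2 := fun x => by
    rw [EuclideanSpace.real_norm_sq_eq]
    have h1 : ∀ i j, ∑ l, S l i * S l j = n * A i j := fun i j => by
      have := congrFun (congrFun hSS i) j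
      simp only [Matrix.mul_apply, Matrix.smul_apply, smul_eq_mul] at this
      rw [← this]; exact Finset.sum_congr rfl fun l _ => by rw [hSs i l]
    have h2 : ∀ i, e x i ^ 2 = ∑ a, ∑ b, S i a * S i b * (x a * x b) := fun i => by
      rw [he, sq, Finset.sum_mul_sum]
      exact Finset.sum_congr rfl fun a _ => Finset.sum_congr rfl fun b _ => by ring
    simp only [h2]
    symm
    rw [Finset.sum_comm, Finset.mul_sum]
    refine Finset.sum_congr rfl fun a _ => ?_
    rw [Finset.sum_comm, Finset.mul_sum]
    refine Finset.sum_congr rfl fun b _ => ?_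
    rw [← Finset.sum_mul, h1]; ring
  set μ := min (2 * (n:ℝ)) ζ
  have hμ1 : (n:ℝ) < μ := lt_min (by linarith) hζ
  obtain ⟨hNμ, hL0, hL1⟩ := arith hn hζ hN
  let φ : EE n → ℝ := fun y => u y - QQ A b c y
  let v : EE n → ℝ := fun y => n * φ (e.symm y)
  let g0 : EE n → ℝ := fun y => n * (f (e.symm y) - finf)
  have hφ : ContDiff ℝ 2 φ := hu.sub (cd_QQ A b c)
  have hv : ContDiff ℝ 2 v := contDiff_const.mul (hφ.comp e.symm.contDiff)
  have hdet : ∀ y, (1 + Matrix.of fun i j => pd i (pd j v) y).det = Real.exp (g0 y) := fun y => by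
    have := det_id (M := Matrix.of fun i j => pd i (pd j v) y) hn0.ne' hST hTS hSS hdetA (hMA (e.symm y)) (by
      ext i j
      have h1 : ∀ a b, hs φ (e.symm y) (ei a) (ei b) = hess u (e.symm y) a b - A a b := fun a b' => by
        rw [← pd_pd _ _ hφ.contDiffAt, hess_eq hu.contDiffAt, ← hs_QQ A hAs b c a b' (e.symm y),
          ← pd_sub _ (differentiableAt_pd _ hu.contDiffAt) (differentiableAt_pd _ (cd_QQ A b c).contDiffAt)]
        congr 1; ext z
        exact pd_sub _ (hu.contDiffAt.differentiableAt (by simp)) ((cd_QQ A b c).contDiffAt.differentiableAt (by simp))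
      have h2 : ∀ a b, e.symm (ei a) b = T a b := fun a b => by
        rw [he']; simp [ei_apply, hTs a b]
      have h3 : pd i (pd j v) y = n * hs (φ ∘ e.symm) y (ei i) (ei j) := by
        have hc : ContDiff ℝ 2 (φ ∘ e.symm) := hφ.comp e.symm.contDiff
        rw [← pd_pd _ _ hc.contDiffAt, ← pd_const_mul _ _ (differentiableAt_pd _ hc.contDiffAt)]
        congr 1; ext z
        exact pd_const_mul _ _ (hc.contDiffAt.differentiableAt (by simp))
      rw [Matrix.of_apply, h3, hs_comp, hs_eq_sum, Matrix.mul_assoc, Matrix.mul_apply, Finset.mul_sum]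
      refine Finset.sum_congr rfl fun a _ => ?_
      rw [Matrix.mul_apply, Finset.mul_sum, Finset.mul_sum]
      refine Finset.sum_congr rfl fun b _ => ?_
      rw [h1, h2, h2, Matrix.smul_apply, Matrix.sub_apply, smul_eq_mul, hTs j b]; ring)
    rw [this]; congr 1; simp only [g0]; ring
  have hfv : ∀ k ≤ m + 1, (fun x => iteratedFDeriv ℝ k v x) =O[cobounded (EE n)] wt 0 (2 - n - k) := fun k hk => by
    obtain ⟨C, R, -, hR, h⟩ := hfirst k hk
    exact comp_bd e.symm hn0.ne' (bigO_in (by linarith) h)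
  have hgC : ES m g0 := by
    obtain ⟨K, hK, hf⟩ := hf_Cm
    obtain ⟨R, hR⟩ := ev_R.1 (show ∀ᶠ x in cobounded (EE n), x ∈ Kᶜ from hK.isBounded)
    have := e.symm.antilipschitz.tendsto_cobounded.eventually (show ∀ᶠ x in cobounded (EE n), x ∈ Kᶜ from hK.isBounded)
    filter_upwards [this] with x hx
    refine contDiffAt_const.mul (ContDiffAt.sub ?_ contDiffAt_const)
    exact (hf.contDiffAt (hK.isClosed.isOpen_compl.mem_nhds hx)).comp x e.symm.contDiff.contDiffAt
  have hg : OD 0 m (-μ) g0 := by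
    refine (OD.of_iter (p := -ζ) hgC fun k hk => ?_).mono (neg_le_neg (min_le_right _ _))
    obtain ⟨C, R, -, hR, h⟩ := hf_decay k hk
    refine comp_bd (w := fun y => f y - finf) e.symm hn0.ne' (bigO_in (C := C) hR fun x hx => ?_)
    have hx0 : 0 < ‖x‖ := hR.trans_le hx
    rw [show -ζ - (k:ℝ) = -(ζ + k) by ring, Real.rpow_neg hx0.le, ← div_eq_mul_inv, le_div_iff₀ (by positivity), mul_comm]
    exact h x hx
  have main : ∀ L : ℕ, (L = 0 ∧ μ - n < N + 1 ∨ L = 1 ∧ μ - n = N + 1) →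
      ∃ (c₀ : ℝ) (P : ℕ → MvPolynomial (Fin n) ℝ), (∀ k, Hp k (P k)) ∧ ∀ k ≤ m,
        (fun x => iteratedFDeriv ℝ k (fun y : EE n =>
                u y - ((1/2) * ∑ i, ∑ j, A i j * y i * y j + ∑ i, b i * y i + c)
                - c₀ * ((n : ℝ) * ∑ i, ∑ j, A i j * y i * y j) ^ (((2 : ℝ) - n) / 2)
                - ∑ k ∈ Finset.Icc 1 N,
                    MvPolynomial.eval
                      (fun i => (∑ j, S i j * y j) /
                        Real.sqrt ((n : ℝ) * ∑ i', ∑ j', A i' j' * y i' * y j')) (P k) *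
                    ((n : ℝ) * ∑ i, ∑ j, A i j * y i * y j) ^ (((2 : ℝ) - n - k) / 2)) x)
          =O[cobounded (EE n)] wt L (2 - μ - k) := fun L hL => by
    obtain ⟨P, hP, hb⟩ := core hn hm hμ1 (min_le_left _ _) hv hdet hg hgC hfv N hNμ hL
    refine ⟨(n:ℝ)⁻¹ * pv (P 0) 0, fun k => MvPolynomial.C (n:ℝ)⁻¹ * P k, fun k => (hP k).C_mul _, fun k hk => ?_⟩
    refine (comp_bd e (inv_ne_zero hn0.ne') (hb k hk).2).congr' ?_ EventuallyEq.rfl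
    filter_upwards [ev_ev (ev_le 1)] with x hx
    refine (EventuallyEq.iteratedFDeriv ℝ (f₂ := _) ?_ k).eq_of_nhds
    filter_upwards [hx] with y hy
    have hy0 : 0 < ‖e y‖ := norm_pos_iff.2 fun h => by
      rw [e.map_eq_zero_iff] at h; rw [h, norm_zero] at hy; linarith
    have hr : ∀ s : ℝ, (‖e y‖ ^ 2) ^ (s / 2) = ‖e y‖ ^ s := fun s => by
      rw [← Real.rpow_natCast, ← Real.rpow_mul hy0.le]; congr 1; push_cast; ring
    have h0 : pv (P 0) 0 = pv (P 0) (e y) := by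
      have := hom_scale (hP 0).1 0 (fun i => e y i)
      simpa [pv] using this
    have hK : ∀ k, MvPolynomial.eval (fun i => (∑ j, S i j * y j) / ‖e y‖) (P k) * ‖e y‖ ^ ((2:ℝ) - n - k)
        = KK k (P k) (e y) := fun k => by
      have := hom_scale (hP k).1 ‖e y‖⁻¹ (fun i => e y i)
      simp only [div_eq_inv_mul, ← he]
      rw [this, KK, pv, mul_right_comm, mul_comm, ← Real.rpow_natCast, Real.inv_rpow hy0.le, ← Real.rpow_neg hy0.le,
        ← Real.rpow_add hy0, cc]
      congr 2; ring
    have hK2 : ∀ k, MvPolynomial.eval (fun i => (∑ j, S i j * y j) / ‖e y‖) (MvPolynomial.C (n:ℝ)⁻¹ * P k)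
        * ‖e y‖ ^ ((2:ℝ) - n - k) = (n:ℝ)⁻¹ * KK k (P k) (e y) := fun k => by
      rw [map_mul, MvPolynomial.eval_C, mul_assoc, hK]
    have hr2 : Finset.range (N + 1) = insert 0 (Finset.Icc 1 N) := by ext; simp; omega
    simp only [hq, Real.sqrt_sq hy0.le, hr, hK2, ← Finset.mul_sum]
    rw [hr2, Finset.sum_insert (by simp), KK, h0, cc]
    simp only [v, φ, e.symm_apply_apply, QQ, Nat.cast_zero, mul_zero, sub_zero]
    field_simp
    ring
  by_cases hz : ∃ z : ℤ, μ - n = (z : ℝ)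
  · obtain ⟨c₀, P, hP, h⟩ := main 1 (Or.inr ⟨rfl, hL1 hz⟩)
    refine ⟨S, c₀, P, hSp, hSS, fun k _ _ => hP k, fun h => (h hz).elim, fun _ k hk => ?_⟩
    simpa only [pow_one] using bigO_out (h k hk)
  · obtain ⟨c₀, P, hP, h⟩ := main 0 (Or.inl ⟨rfl, hL0 hz⟩)
    refine ⟨S, c₀, P, hSp, hSS, fun k _ _ => hP k, fun _ k hk => ?_, fun h => (hz h).elim⟩
    simpa only [pow_zero, mul_one] using bigO_out (h k hk)
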